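/- arXiv:1203.5177 — 8 statements merged into one kernel-verified Lean document; each statement's English description precedes it below -/
import Mathlib

section
/- Let K be a real Hilbert space and ξ ∈ K. Suppose F is an ℝⁿ-valued map defined on a neighborhood of ξ in K that is Fréchet continuously differentiable with bounded derivative DF, and suppose the continuous linear map DF(ξ) : K → ℝⁿ is surjective. Let L be a real Banach space that is continuously and densely embedded in K. Then there exists a sequence (ξ_j)_{j≥1} with ξ_j ∈ L for all j, ‖ξ_j − ξ‖_K → 0 as j → ∞, and F(ξ_j) = F(ξ) for all j. -/
open Filter Set

/-- let `K` be a real Hilbert space, `F` an `ℝⁿ`-valued Fréchet-`C¹`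
map on an open neighborhood `U` of `ξ` with bounded derivative `F'`, such that the
continuous linear map `F' ξ : K → ℝⁿ` is surjective. If `L` is a real Banach space
continuously and densely embedded in `K` (via an injective continuous linear map
`ι` with dense range), then there is a sequence `ξ j` lying in the image of `L`
with `‖ξ j - ξ‖ → 0` and `F (ξ j) = F ξ` for all `j`. -/
theorem statement0 {K : Type*} [NormedAddCommGroup K] [InnerProductSpace ℝ K]
    [CompleteSpace K]
    {L : Type*} [NormedAddCommGroup L] [NormedSpace ℝ L] [CompleteSpace L]
    (n : ℕ) (ξ : K) (U : Set K) (hU : IsOpen U) (hξU : ξ ∈ U)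
    (F : K → EuclideanSpace ℝ (Fin n))
    (F' : K → K →L[ℝ] EuclideanSpace ℝ (Fin n))
    (hF : ∀ η ∈ U, HasFDerivAt F (F' η) η)
    (hF'cont : ContinuousOn F' U)
    (hF'bdd : ∃ C : ℝ, ∀ η ∈ U, ‖F' η‖ ≤ C)
    (hsurj : Function.Surjective (F' ξ))
    (ι : L →L[ℝ] K) (hinj : Function.Injective ι) (hdense : DenseRange ι) :
    ∃ ξseq : ℕ → K, (∀ j, ξseq j ∈ Set.range ι) ∧
      Tendsto (fun j => ‖ξseq j - ξ‖) atTop (nhds 0) ∧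
      ∀ j, F (ξseq j) = F ξ := by
  have hstrict : HasStrictFDerivAt F (F' ξ) ξ :=
    hasStrictFDerivAt_of_hasFDerivAt_of_continuousAt
      (Filter.eventually_of_mem (hU.mem_nhds hξU) hF)
      (hF'cont.continuousAt (hU.mem_nhds hξU))
  have hAs : Function.Surjective ((F' ξ).comp ι) := by
    have hd : DenseRange ((F' ξ).comp ι) := by
      have := hsurj.denseRange.comp hdense (F' ξ).continuous
      exact this
    have hc : IsClosed (LinearMap.range ((F' ξ).comp ι).toLinearMap :
        Set (EuclideanSpace ℝ (Fin n))) := Submodule.closed_of_finiteDimensional _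
    have h2 : IsClosed (Set.range ((F' ξ).comp ι)) := by
      rw [LinearMap.coe_range] at hc
      exact hc
    have h3 := hd.closure_range
    rw [h2.closure_eq] at h3
    exact Set.range_eq_univ.1 h3
  obtain ⟨S, hS⟩ := LinearMap.exists_rightInverse_of_surjective
    ((F' ξ).comp ι).toLinearMap (LinearMap.range_eq_top.2 hAs)
  let R : EuclideanSpace ℝ (Fin n) →L[ℝ] K := ι.comp (LinearMap.toContinuousLinearMap S)
  have hR : ∀ y, F' ξ (R y) = y := fun y => LinearMap.congr_fun hS y
  let T : K × EuclideanSpace ℝ (Fin n) →L[ℝ] K :=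
    ContinuousLinearMap.fst ℝ _ _ + R.comp (ContinuousLinearMap.snd ℝ _ _)
  have hT0 : T (ξ, 0) = ξ := by simp [T]
  have hG : HasStrictFDerivAt (fun p : K × EuclideanSpace ℝ (Fin n) => (p.1, F (T p)))
      ((ContinuousLinearMap.fst ℝ _ _).prod ((F' ξ).comp T)) (ξ, 0) := by
    refine hasStrictFDerivAt_fst.prodMk ?_
    have h1 : HasStrictFDerivAt F (F' ξ) (T (ξ, 0)) := by rw [hT0]; exact hstrict
    exact h1.comp (ξ, 0) T.hasStrictFDerivAt
  have hmap := hG.map_nhds_eq_of_surj (by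
    refine LinearMap.range_eq_top.2 ?_
    rintro ⟨h, y⟩
    refine ⟨(h, y - F' ξ h), ?_⟩
    simp [T, hR])
  have key : ∀ ε : ℝ, 0 < ε → ∃ x ∈ Set.range ι, ‖x - ξ‖ < ε ∧ F x = F ξ := by
    intro ε hε
    have hV : T ⁻¹' Metric.ball ξ ε ∈ nhds ((ξ, 0) : K × EuclideanSpace ℝ (Fin n)) := by
      apply T.continuous.continuousAt
      rw [hT0]
      exact Metric.ball_mem_nhds _ hε
    have hI := Filter.image_mem_map (m := fun p : K × EuclideanSpace ℝ (Fin n) => (p.1, F (T p))) hV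
    rw [hmap] at hI
    simp only [hT0] at hI
    have hc : ContinuousAt (fun η : K => (η, F ξ)) ξ := by fun_prop
    have hW := hc hI
    obtain ⟨l, hl⟩ := hdense.exists_mem_open isOpen_interior
      ⟨ξ, mem_interior_iff_mem_nhds.2 hW⟩
    obtain ⟨⟨η, y⟩, hp, hq⟩ := interior_subset hl
    simp only [Prod.mk.injEq] at hq
    obtain ⟨rfl, hq⟩ := hq
    refine ⟨T (ι l, y), ⟨l + S y, by simp [T, R]⟩, ?_, hq⟩
    exact mem_ball_iff_norm.1 hp
  choose x hx1 hx2 hx3 using fun j : ℕ => key (1 / ((j : ℝ) + 1)) Nat.one_div_pos_of_nat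
  exact ⟨x, hx1, squeeze_zero (fun _ => norm_nonneg _) (fun j => (hx2 j).le)
    tendsto_one_div_add_atTop_nhds_zero_nat, hx3⟩
end

section
/- Let n ≥ 2 and let S^{n−1} = { a ∈ ℝⁿ : |a| = 1 }. Let f : [0,1] × S^{n−1} → ℝⁿ be a continuous map such that f(0, a) = a for all a ∈ S^{n−1} and f(1, ·) is a constant map. Then there exists (s, a) ∈ [0,1] × S^{n−1} such that f(s, a) = 0. -/
open Set Metric


theorem aux_det_poly (n : ℕ) (A : EuclideanSpace ℝ (Fin n) →L[ℝ] EuclideanSpace ℝ (Fin n)) :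
    ∃ P : Polynomial ℝ, P.natDegree ≤ n ∧
      ∀ t : ℝ, P.eval t = (ContinuousLinearMap.id ℝ _ + t • A).det := by
  let b := (EuclideanSpace.basisFun (Fin n) ℝ).toBasis
  let M := LinearMap.toMatrix b b (A : EuclideanSpace ℝ (Fin n) →ₗ[ℝ] EuclideanSpace ℝ (Fin n))
  refine ⟨Matrix.det ((Polynomial.X : Polynomial ℝ) • M.map Polynomial.C +
    (1 : Matrix (Fin n) (Fin n) ℝ).map Polynomial.C), ?_, ?_⟩
  · simpa using Polynomial.natDegree_det_X_add_C_le M 1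
  · intro t
    rw [ContinuousLinearMap.det, ← LinearMap.det_toMatrix b, ← Polynomial.coe_evalRingHom,
      RingHom.map_det]
    congr 1
    ext i j
    by_cases hij : i = j <;>
      simp [M, LinearMap.toMatrix_apply, b, hij, add_comm] <;> ring

theorem aux_det_pos (n : ℕ) (A : EuclideanSpace ℝ (Fin n) →L[ℝ] EuclideanSpace ℝ (Fin n))
    (t : ℝ) (ht : 0 ≤ t) (h : t * ‖A‖ < 1) :
    0 < (ContinuousLinearMap.id ℝ _ + t • A).det := by
  obtain ⟨P, -, hP⟩ := aux_det_poly n A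
  rw [← hP]
  by_contra! hneg
  have h0 : P.eval 0 = 1 := by simp [hP, ContinuousLinearMap.det]
  have := intermediate_value_Icc' ht (f := fun t => P.eval t) P.continuous.continuousOn
  obtain ⟨s, hs, hs0⟩ := this (show (0:ℝ) ∈ _ from ⟨hneg, by simp [h0]⟩)
  simp only [hP] at hs0
  have hlt : ‖-(s • A)‖ < 1 := by
    rw [norm_neg, norm_smul, Real.norm_of_nonneg hs.1]
    exact lt_of_le_of_lt (mul_le_mul_of_nonneg_right hs.2 (norm_nonneg _)) h
  have hu := isUnit_one_sub_of_norm_lt_one hlt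
  rw [sub_neg_eq_add] at hu
  have hu2 := (hu.map (ContinuousLinearMap.toLinearMapRingHom (R₁ := ℝ) (M₁ := EuclideanSpace ℝ (Fin n)))).map (LinearMap.det (M := EuclideanSpace ℝ (Fin n)) (A := ℝ))
  exact hu2.ne_zero hs0

theorem aux_lagrange (n : ℕ) (v : Fin (n+1) → ℝ) (hv : Function.Injective v) :
    ∃ w : Fin (n+1) → ℝ, ∑ i, w i = 1 ∧ ∀ P : Polynomial ℝ, P.natDegree ≤ n →
      P.eval 1 = ∑ i, w i * P.eval (v i) := by
  refine ⟨fun i => (Lagrange.basis Finset.univ v i).eval 1, ?_, ?_⟩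
  · rw [← Polynomial.eval_finsetSum, Lagrange.sum_basis hv.injOn ⟨0, Finset.mem_univ _⟩]; simp
  · intro P hP
    have hd : P.degree < (Finset.univ : Finset (Fin (n+1))).card := by
      refine lt_of_le_of_lt Polynomial.degree_le_natDegree ?_
      simp only [Finset.card_univ, Fintype.card_fin]
      exact_mod_cast Nat.lt_succ_of_le hP
    conv_lhs => rw [Lagrange.eq_interpolate (v := v) hv.injOn hd]
    rw [Lagrange.interpolate_apply, Polynomial.eval_finsetSum]
    simp [mul_comm]

theorem aux_vol (n : ℕ) [Nontrivial (EuclideanSpace ℝ (Fin n))]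
    (r : EuclideanSpace ℝ (Fin n) → EuclideanSpace ℝ (Fin n)) (hr : ContDiff ℝ 1 r) (R : ℝ)
    (hR : 0 < R) (hn : ∀ x, ‖r x‖ = R) (hid : ∀ x, ‖x‖ = R → r x = x) (K : NNReal)
    (hK : ∀ x ∈ closedBall (0 : EuclideanSpace ℝ (Fin n)) R,
      ‖fderiv ℝ r x - ContinuousLinearMap.id ℝ _‖ ≤ K)
    (t : ℝ) (ht : 0 < t) (ht1 : t < 1) (htK : t * K < 1) :
    ∫ x in ball (0 : EuclideanSpace ℝ (Fin n)) R, (ContinuousLinearMap.id ℝ _ +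
      t • (fderiv ℝ r x - ContinuousLinearMap.id ℝ _)).det =
      MeasureTheory.volume.real (ball (0 : EuclideanSpace ℝ (Fin n)) R) := by
  let g : (EuclideanSpace ℝ (Fin n)) → (EuclideanSpace ℝ (Fin n)) := fun x => x + t • (r x - x)
  have hrd : ∀ x, HasFDerivAt r (fderiv ℝ r x) x := fun x =>
    (hr.differentiable one_ne_zero x).hasFDerivAt
  have hhd : ∀ x, HasFDerivAt (fun x => r x - x) (fderiv ℝ r x - ContinuousLinearMap.id ℝ _) x :=
    fun x => (hrd x).sub (hasFDerivAt_id x)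
  have hgd : ∀ x, HasFDerivAt g (ContinuousLinearMap.id ℝ _ +
      t • (fderiv ℝ r x - ContinuousLinearMap.id ℝ _)) x :=
    fun x => (hasFDerivAt_id x).add ((hhd x).const_smul t)
  have hgc : Continuous g := by
    have := hr.continuous
    fun_prop
  have hlip : ∀ x ∈ ball (0:(EuclideanSpace ℝ (Fin n))) R, ∀ y ∈ ball (0:(EuclideanSpace ℝ (Fin n))) R, ‖(r x - x) - (r y - y)‖ ≤ K * ‖x - y‖ := by
    intro x hx y hy
    exact (convex_ball (0:(EuclideanSpace ℝ (Fin n))) R).norm_image_sub_le_of_norm_hasFDerivWithin_le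
      (f := fun x => r x - x) (fun z hz => (hhd z).hasFDerivWithinAt)
      (fun z hz => hK z (ball_subset_closedBall hz)) hy hx
  let c : NNReal := ⟨t, ht.le⟩ * K
  have hc1 : c < 1 := by
    rw [← NNReal.coe_lt_coe]; exact htK
  have happ : ApproximatesLinearOn g ((ContinuousLinearEquiv.refl ℝ (EuclideanSpace ℝ (Fin n)) : (EuclideanSpace ℝ (Fin n)) ≃L[ℝ] (EuclideanSpace ℝ (Fin n))) : (EuclideanSpace ℝ (Fin n)) →L[ℝ] (EuclideanSpace ℝ (Fin n)))
      (ball 0 R) c := by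
    intro x hx y hy
    have : g x - g y - (x - y) = t • ((r x - x) - (r y - y)) := by
      simp only [g, smul_sub]; abel
    change ‖g x - g y - (x - y)‖ ≤ _
    rw [this, norm_smul, Real.norm_of_nonneg ht.le]
    change _ ≤ t * K * _
    rw [mul_assoc]
    exact mul_le_mul_of_nonneg_left (hlip x hx y hy) ht.le
  have hcN : Subsingleton (EuclideanSpace ℝ (Fin n)) ∨ c < ‖((ContinuousLinearEquiv.refl ℝ (EuclideanSpace ℝ (Fin n))).symm : (EuclideanSpace ℝ (Fin n)) →L[ℝ] (EuclideanSpace ℝ (Fin n)))‖₊⁻¹ := by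
    right
    have : ‖((ContinuousLinearEquiv.refl ℝ (EuclideanSpace ℝ (Fin n))).symm : (EuclideanSpace ℝ (Fin n)) →L[ℝ] (EuclideanSpace ℝ (Fin n)))‖₊ = 1 := by
      ext; exact ContinuousLinearMap.norm_id
    rw [this]; simpa using hc1
  have hinj : InjOn g (ball 0 R) := happ.injOn hcN
  have hopen : IsOpen (g '' ball 0 R) :=
    (happ.toOpenPartialHomeomorph g (ball 0 R) hcN isOpen_ball).open_target
  have hmaps : ∀ x ∈ ball (0:(EuclideanSpace ℝ (Fin n))) R, g x ∈ ball (0:(EuclideanSpace ℝ (Fin n))) R := by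
    intro x hx
    rw [mem_ball_zero_iff] at *
    have : g x = (1 - t) • x + t • r x := by
      simp only [g, smul_sub, sub_smul, one_smul]; abel
    rw [this]
    refine (norm_add_le _ _).trans_lt ?_
    rw [norm_smul, norm_smul, hn, Real.norm_of_nonneg ht.le, Real.norm_of_nonneg (by linarith)]
    nlinarith
  have himg : g '' ball 0 R = ball 0 R := by
    refine Subset.antisymm (by rintro _ ⟨x, hx, rfl⟩; exact hmaps x hx) ?_
    have hcl : IsClosed (g '' closedBall 0 R) :=
      ((isCompact_closedBall (0:(EuclideanSpace ℝ (Fin n))) R).image hgc).isClosed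
    refine ((convex_ball (0:(EuclideanSpace ℝ (Fin n))) R).isPreconnected).subset_left_of_subset_union hopen
      hcl.isOpen_compl ?_ ?_ ?_
    · exact disjoint_compl_right_iff_subset.2 (image_mono ball_subset_closedBall)
    · intro y hy
      by_cases h : y ∈ g '' closedBall 0 R
      · left
        obtain ⟨x, hx, rfl⟩ := h
        rw [mem_closedBall_zero_iff] at hx
        rcases hx.lt_or_eq with h | h
        · exact ⟨x, by simpa using h, rfl⟩
        · exfalso
          have : g x = x := by simp [g, hid x h]
          rw [this, mem_ball_zero_iff] at hy
          linarith
      · right; exact h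
    · exact ⟨g 0, hmaps 0 (by simpa using hR), 0, by simpa using hR, rfl⟩
  have key := MeasureTheory.integral_image_eq_integral_abs_det_fderiv_smul
    MeasureTheory.volume (measurableSet_ball (x := (0:(EuclideanSpace ℝ (Fin n)))) (ε := R))
    (fun x _ => (hgd x).hasFDerivWithinAt) hinj (fun _ => (1:ℝ))
  rw [himg] at key
  simp only [MeasureTheory.integral_const, smul_eq_mul, mul_one,
    MeasureTheory.measureReal_restrict_apply_univ] at key
  rw [key]
  refine MeasureTheory.setIntegral_congr_fun measurableSet_ball fun x hx => ?_
  refine (abs_of_pos (aux_det_pos n _ t ht.le ?_)).symm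
  exact lt_of_le_of_lt (mul_le_mul_of_nonneg_left (hK x (ball_subset_closedBall hx)) ht.le) htK

theorem aux_noretract (n : ℕ) [Nontrivial (EuclideanSpace ℝ (Fin n))]
    (r : EuclideanSpace ℝ (Fin n) → EuclideanSpace ℝ (Fin n)) (hr : ContDiff ℝ 1 r) (R : ℝ)
    (hR : 0 < R) (hn : ∀ x, ‖r x‖ = R) (hid : ∀ x, ‖x‖ = R → r x = x) : False := by
  have hcont : Continuous fun x => fderiv ℝ r x - ContinuousLinearMap.id ℝ (EuclideanSpace ℝ (Fin n)) :=
    (hr.continuous_fderiv one_ne_zero).sub continuous_const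
  obtain ⟨K0, hK0⟩ := (isCompact_closedBall (0:(EuclideanSpace ℝ (Fin n))) R).exists_bound_of_continuousOn hcont.continuousOn
  let K : NNReal := K0.toNNReal
  have hK : ∀ x ∈ closedBall (0 : (EuclideanSpace ℝ (Fin n))) R,
      ‖fderiv ℝ r x - ContinuousLinearMap.id ℝ (EuclideanSpace ℝ (Fin n))‖ ≤ K :=
    fun x hx => (hK0 x hx).trans (Real.le_coe_toNNReal _)
  let v : Fin (n+1) → ℝ := fun i => 1 / ((K + 1) * ((i:ℕ) + 2))
  have hKp : (0:ℝ) ≤ K := K.2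
  have hvinj : Function.Injective v := by
    intro i j hij
    simp only [v] at hij
    have h1 : ((K:ℝ) + 1) ≠ 0 := by positivity
    have h2 := inv_injective (by simpa only [one_div] using hij)
    have h3 := mul_left_cancel₀ h1 h2
    ext
    have h4 : ((i:ℕ):ℝ) = (j:ℕ) := by linarith
    exact_mod_cast h4
  have hv0 : ∀ i, 0 < v i := fun i => by positivity
  have hv1 : ∀ i, v i < 1 := fun i => by
    have : (0:ℝ) ≤ (i:ℕ) := by positivity
    simp only [v]; rw [div_lt_one (by positivity)]; nlinarith
  have hvK : ∀ i, v i * K < 1 := fun i => by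
    have : (0:ℝ) ≤ (i:ℕ) := by positivity
    simp only [v]; rw [div_mul_eq_mul_div, div_lt_one (by positivity)]; nlinarith
  obtain ⟨w, hw1, hw⟩ := aux_lagrange n v hvinj
  have hdet0 : ∀ x, (fderiv ℝ r x).det = 0 := by
    intro x
    by_contra hne
    have hsurj : Function.Surjective (fderiv ℝ r x) := by
      have := (LinearMap.equivOfDetNeZero (fderiv ℝ r x : (EuclideanSpace ℝ (Fin n)) →ₗ[ℝ] (EuclideanSpace ℝ (Fin n))) hne).surjective
      exact this
    obtain ⟨u, hu⟩ := hsurj (r x)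
    have hrd : HasFDerivAt r (fderiv ℝ r x) x := (hr.differentiable one_ne_zero x).hasFDerivAt
    have h1 := hrd.norm_sq
    have h2 : (fun x => ‖r x‖ ^ 2) = fun _ => R ^ 2 := by ext; rw [hn]
    rw [h2] at h1
    have h3 := h1.unique (hasFDerivAt_const _ _)
    have h4 := DFunLike.congr_fun h3 u
    simp [hu, hn] at h4
    exact hR.ne' h4
  have hpt : ∀ x, (0:ℝ) = ∑ i, w i * (ContinuousLinearMap.id ℝ (EuclideanSpace ℝ (Fin n)) +
      v i • (fderiv ℝ r x - ContinuousLinearMap.id ℝ (EuclideanSpace ℝ (Fin n)))).det := by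
    intro x
    obtain ⟨P, hPd, hP⟩ := aux_det_poly n (fderiv ℝ r x - ContinuousLinearMap.id ℝ (EuclideanSpace ℝ (Fin n)))
    have := hw P hPd
    simp only [hP] at this
    rw [← this, one_smul, add_sub_cancel, hdet0]
  have hint : (∫ x in ball (0:(EuclideanSpace ℝ (Fin n))) R, (0:ℝ)) = ∫ x in ball (0:(EuclideanSpace ℝ (Fin n))) R,
      ∑ i, w i * (ContinuousLinearMap.id ℝ (EuclideanSpace ℝ (Fin n)) +
      v i • (fderiv ℝ r x - ContinuousLinearMap.id ℝ (EuclideanSpace ℝ (Fin n)))).det := by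
    congr 1; ext x; exact hpt x
  rw [MeasureTheory.integral_finsetSum] at hint
  · simp only [MeasureTheory.integral_const_mul] at hint
    simp_rw [fun i => aux_vol n r hr R hR hn hid K hK (v i) (hv0 i) (hv1 i) (hvK i)] at hint
    rw [← Finset.sum_mul, hw1, one_mul, MeasureTheory.integral_zero] at hint
    have : 0 < MeasureTheory.volume.real (ball (0:(EuclideanSpace ℝ (Fin n))) R) :=
      ENNReal.toReal_pos (measure_ball_pos _ _ hR).ne' MeasureTheory.measure_ball_lt_top.ne
    linarith
  · intro i _
    have hc : Continuous fun x => w i * (ContinuousLinearMap.id ℝ (EuclideanSpace ℝ (Fin n)) +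
      v i • (fderiv ℝ r x - ContinuousLinearMap.id ℝ (EuclideanSpace ℝ (Fin n)))).det :=
      continuous_const.mul (ContinuousLinearMap.continuous_det.comp
        (continuous_const.add (hcont.const_smul (v i))))
    exact (hc.continuousOn.integrableOn_compact (isCompact_closedBall (0:(EuclideanSpace ℝ (Fin n))) R)).mono_set
      ball_subset_closedBall

open scoped Manifold ContDiff Topology in
theorem aux_main (n : ℕ) [Nontrivial (EuclideanSpace ℝ (Fin n))]
    (F : EuclideanSpace ℝ (Fin n) → EuclideanSpace ℝ (Fin n)) (hF : Continuous F)
    (h0 : ∀ x, F x ≠ 0) (hid : ∀ x, 1 ≤ ‖x‖ → F x = x) : False := by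
  let T : (EuclideanSpace ℝ (Fin n)) → Set (EuclideanSpace ℝ (Fin n)) := fun x => ball (F x) ‖F x‖ ∩ {y | 2 ≤ ‖x‖ → y = x}
  obtain ⟨G, hG⟩ := exists_contMDiffMap_forall_mem_convex_of_local (n := 1) (𝓘(ℝ, (EuclideanSpace ℝ (Fin n)))) (t := T)
    (by
      intro x
      refine (convex_ball _ _).inter ?_
      by_cases h : 2 ≤ ‖x‖
      · simpa [h] using convex_singleton x
      · simpa [h] using convex_univ)
    (by
      intro x
      by_cases h : 2 ≤ ‖x‖
      · refine ⟨{y | 1 < ‖y‖}, (isOpen_lt continuous_const continuous_norm).mem_nhds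
          (show 1 < ‖x‖ by linarith), id, contMDiffOn_id, ?_⟩
        intro y hy
        refine ⟨?_, fun _ => rfl⟩
        have hy' : 1 < ‖y‖ := hy
        rw [hid y hy'.le]
        simpa using (by linarith : 0 < ‖y‖)
      · refine ⟨{y | ‖y‖ < 2} ∩ {y | dist (F x) (F y) < ‖F y‖}, ?_, fun _ => F x,
          contMDiffOn_const, ?_⟩
        · refine ((isOpen_lt continuous_norm continuous_const).inter
            (isOpen_lt (continuous_const.dist hF) hF.norm)).mem_nhds ⟨not_le.1 h, ?_⟩
          simpa using h0 x
        · rintro y ⟨hy1, hy2⟩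
          exact ⟨hy2, fun h => absurd h (not_le.2 hy1)⟩)
  have hGc : ContDiff ℝ 1 G := G.contMDiff.contDiff
  have hG0 : ∀ x, G x ≠ 0 := by
    intro x hx
    have := (hG x).1
    rw [hx] at this
    simp at this
  refine aux_noretract n (fun x => (2 * ‖G x‖⁻¹) • G x) ?_ 2 two_pos ?_ ?_
  · exact (contDiff_const.mul ((hGc.norm ℝ hG0).inv fun x => norm_ne_zero_iff.2 (hG0 x))).smul hGc
  · intro x
    have := norm_ne_zero_iff.2 (hG0 x)
    rw [norm_smul, Real.norm_of_nonneg (by positivity)]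
    field_simp
  · intro x hx
    have : G x = x := (hG x).2 hx.ge
    simp [this, hx]

/-- if `f : [0,1] × S^{n-1} → ℝⁿ` (`n ≥ 2`) is continuous with
`f(0, ·) = id` on the sphere and `f(1, ·)` constant, then `f` vanishes somewhere
on `[0,1] × S^{n-1}`. -/
theorem statement1 (n : ℕ) (hn : 2 ≤ n)
    (f : ℝ × EuclideanSpace ℝ (Fin n) → EuclideanSpace ℝ (Fin n))
    (hf : ContinuousOn f
      (Set.Icc (0 : ℝ) 1 ×ˢ Metric.sphere (0 : EuclideanSpace ℝ (Fin n)) 1))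
    (hf0 : ∀ a ∈ Metric.sphere (0 : EuclideanSpace ℝ (Fin n)) 1, f (0, a) = a)
    (hf1 : ∃ c, ∀ a ∈ Metric.sphere (0 : EuclideanSpace ℝ (Fin n)) 1, f (1, a) = c) :
    ∃ s ∈ Set.Icc (0 : ℝ) 1, ∃ a ∈ Metric.sphere (0 : EuclideanSpace ℝ (Fin n)) 1,
      f (s, a) = 0 := by
  by_contra! hne
  obtain ⟨c, hc⟩ := hf1
  have : Nonempty (Fin n) := ⟨⟨0, by omega⟩⟩
  have : Nontrivial (EuclideanSpace ℝ (Fin n)) := inferInstance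
  obtain ⟨e, he⟩ := NormedSpace.sphere_nonempty (E := (EuclideanSpace ℝ (Fin n))) (x := 0) (r := 1) |>.2 zero_le_one
  have hc0 : c ≠ 0 := by
    rw [← hc e he]; exact hne 1 (by simp) e he
  classical
  let σ : (EuclideanSpace ℝ (Fin n)) → ℝ := fun x => max 0 (min 1 (2 - 2 * ‖x‖))
  have hσ : ∀ x, σ x ∈ Icc (0:ℝ) 1 := fun x => ⟨le_max_left _ _, max_le zero_le_one (min_le_left _ _)⟩
  have hσc : Continuous σ := by fun_prop
  have hu : ∀ x : (EuclideanSpace ℝ (Fin n)), x ≠ 0 → ‖x‖⁻¹ • x ∈ sphere (0:(EuclideanSpace ℝ (Fin n))) 1 := by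
    intro x hx
    simp [norm_smul, hx]
  let F : (EuclideanSpace ℝ (Fin n)) → (EuclideanSpace ℝ (Fin n)) := fun x => if x = 0 then c else (max 1 ‖x‖) • f (σ x, ‖x‖⁻¹ • x)
  refine aux_main n F ?_ ?_ ?_
  · rw [continuous_iff_continuousAt]
    intro x
    by_cases hx : x = 0
    · have : F =ᶠ[nhds x] fun _ => c := by
        subst hx
        filter_upwards [ball_mem_nhds (0:(EuclideanSpace ℝ (Fin n))) (show (0:ℝ) < 1/2 by norm_num)] with y hy
        by_cases hy0 : y = 0
        · simp [F, hy0]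
        · rw [mem_ball_zero_iff] at hy
          have h1 : σ y = 1 := by
            simp only [σ]
            rw [min_eq_left (by linarith)]; simp
          simp only [F, hy0, if_false, h1, hc _ (hu y hy0)]
          rw [max_eq_left (by linarith), one_smul]
      exact (continuousAt_const).congr this.symm
    · have hev : (fun x => (max 1 ‖x‖) • f (σ x, ‖x‖⁻¹ • x)) =ᶠ[nhds x] F := by
        filter_upwards [isOpen_ne.mem_nhds hx] with y hy
        simp only [F, if_neg (show y ≠ 0 from hy)]
      refine ContinuousAt.congr ?_ hev
      have hon : ContinuousOn (fun x => (max 1 ‖x‖) • f (σ x, ‖x‖⁻¹ • x)) {y : (EuclideanSpace ℝ (Fin n)) | y ≠ 0} := by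
        have hm : MapsTo (fun y : EuclideanSpace ℝ (Fin n) => (σ y, ‖y‖⁻¹ • y))
            {y | y ≠ 0} (Icc (0 : ℝ) 1 ×ˢ sphere (0 : EuclideanSpace ℝ (Fin n)) 1) :=
          fun y hy => Set.mem_prod.2 ⟨hσ y, hu y hy⟩
        have hmx : Continuous fun y : EuclideanSpace ℝ (Fin n) => max 1 ‖y‖ := by fun_prop
        refine ContinuousOn.smul hmx.continuousOn (ContinuousOn.comp hf ?_ hm)
        have hinv : ContinuousOn (fun y : EuclideanSpace ℝ (Fin n) => ‖y‖⁻¹) {y | y ≠ 0} :=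
          continuous_norm.continuousOn.inv₀ fun y hy => norm_ne_zero_iff.2 hy
        have hsm : ContinuousOn (fun y : EuclideanSpace ℝ (Fin n) => ‖y‖⁻¹ • y) {y | y ≠ 0} :=
          hinv.smul continuousOn_id
        exact hσc.continuousOn.prodMk hsm
      exact hon.continuousAt (isOpen_ne.mem_nhds hx)
  · intro x
    by_cases hx : x = 0
    · simpa [F, hx] using hc0
    · simp only [F, hx, if_false]
      exact smul_ne_zero (by positivity) (hne _ (hσ x) _ (hu x hx))
  · intro x h1
    have hx : x ≠ 0 := by rintro rfl; simp at h1; linarith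
    have h2 : σ x = 0 := by
      simp only [σ]
      exact max_eq_left ((min_le_right _ _).trans (by linarith))
    simp only [F, hx, if_false, h2, hf0 _ (hu x hx), max_eq_right h1]
    rw [smul_smul, mul_inv_cancel₀ (norm_ne_zero_iff.2 hx), one_smul]
end

section
/- Let n ≥ 2, let Bⁿ = { a ∈ ℝⁿ : |a| ≤ 1 } be the closed unit ball and S^{n−1} = { a ∈ ℝⁿ : |a| = 1 } its boundary sphere. Let g : Bⁿ → ℝⁿ be a continuous map such that g(a) = a for every a ∈ S^{n−1}. Then there exists a ∈ Bⁿ such that g(a) = 0. -/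
open Set Metric

set_option linter.unusedSectionVars false

namespace NoRetr

open MeasureTheory Filter Topology

variable {E : Type*} [NormedAddCommGroup E] [InnerProductSpace ℝ E] [FiniteDimensional ℝ E]

/-- radial projection onto the closed unit ball -/
noncomputable def P (x : E) : E := (max 1 ‖x‖)⁻¹ • x

lemma P_of_mem {x : E} (hx : ‖x‖ ≤ 1) : P x = x := by
  simp [P, max_eq_left hx]

lemma norm_P_le (x : E) : ‖P x‖ ≤ 1 := by
  have h : 0 < max 1 ‖x‖ := lt_max_of_lt_left one_pos
  rw [P, norm_smul, norm_inv, Real.norm_of_nonneg h.le, inv_mul_le_iff₀ h]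
  simp

lemma norm_P_of_le {x : E} (hx : 1 ≤ ‖x‖) : ‖P x‖ = 1 := by
  have h : 0 < ‖x‖ := by linarith
  rw [P, max_eq_right hx, norm_smul, norm_inv, norm_norm, inv_mul_cancel₀ h.ne']

lemma P_lip : LipschitzWith 2 (P : E → E) := by
  refine LipschitzWith.of_dist_le_mul fun x y => ?_
  rw [dist_eq_norm, dist_eq_norm]
  have ha : 1 ≤ max 1 ‖x‖ := le_max_left _ _
  have hb : 1 ≤ max 1 ‖y‖ := le_max_left _ _
  have hyb : ‖y‖ ≤ max 1 ‖y‖ := le_max_right _ _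
  have hab : |max 1 ‖y‖ - max 1 ‖x‖| ≤ ‖x - y‖ := by
    refine (abs_max_sub_max_le_max 1 ‖y‖ 1 ‖x‖).trans ?_
    simp only [sub_self, abs_zero]
    refine max_le (norm_nonneg _) ?_
    rw [norm_sub_rev]
    exact abs_norm_sub_norm_le y x
  unfold P
  set a := max 1 ‖x‖
  set b := max 1 ‖y‖
  have e : a⁻¹ • x - b⁻¹ • y = a⁻¹ • (x - y) + (a⁻¹ - b⁻¹) • y := by
    rw [smul_sub, sub_smul]; abel
  have ha1 : a⁻¹ ≤ 1 := inv_le_one_of_one_le₀ ha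
  have ha0 : 0 ≤ a⁻¹ := by positivity
  have h1 : ‖a⁻¹ • (x - y)‖ ≤ ‖x - y‖ := by
    rw [norm_smul, Real.norm_of_nonneg ha0]
    exact mul_le_of_le_one_left (norm_nonneg _) ha1
  have h2 : ‖(a⁻¹ - b⁻¹) • y‖ ≤ ‖x - y‖ := by
    have e2 : a⁻¹ - b⁻¹ = a⁻¹ * (b - a) * b⁻¹ := by
      have : a ≠ 0 := by linarith
      have : b ≠ 0 := by linarith
      field_simp
    have hb0 : 0 < b := by linarith
    rw [norm_smul, e2, Real.norm_eq_abs, abs_mul, abs_mul, abs_of_nonneg ha0,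
      abs_of_nonneg (inv_nonneg.2 hb0.le), mul_assoc]
    have h3 : b⁻¹ * ‖y‖ ≤ 1 := by rw [inv_mul_le_iff₀ hb0]; linarith
    have h4 : 0 ≤ b⁻¹ * ‖y‖ := by positivity
    calc a⁻¹ * |b - a| * (b⁻¹ * ‖y‖) ≤ 1 * ‖x - y‖ * 1 := by gcongr
      _ = _ := by ring
  rw [e]
  refine (norm_add_le _ _).trans ?_
  push_cast
  linarith

lemma det_interp (v : ℕ → ℝ) (hv : Function.Injective v) :
    ∃ c : ℕ → ℝ, ∀ A : E →L[ℝ] E, (1 + A).det =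
      ∑ i ∈ Finset.range (Module.finrank ℝ E + 1), c i * (1 + v i • A).det := by
  classical
  let s := Finset.range (Module.finrank ℝ E + 1)
  refine ⟨fun i => (Lagrange.basis s v i).eval 1, fun A => ?_⟩
  let b := Module.finBasis ℝ E
  let M := LinearMap.toMatrix b b (A : E →ₗ[ℝ] E)
  let p : Polynomial ℝ := Matrix.det ((Polynomial.X : Polynomial ℝ) • M.map Polynomial.C
    + (1 : Matrix _ _ ℝ).map Polynomial.C)
  have hp : ∀ t : ℝ, p.eval t = (1 + t • A).det := by
    intro t
    have : (1 + t • A).det = (LinearMap.toMatrix b b ((1 + t • A : E →L[ℝ] E) : E →ₗ[ℝ] E)).det := by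
      rw [LinearMap.det_toMatrix]
    rw [this]
    have h2 : LinearMap.toMatrix b b ((1 + t • A : E →L[ℝ] E) : E →ₗ[ℝ] E) = 1 + t • M := by
      have : ((1 + t • A : E →L[ℝ] E) : E →ₗ[ℝ] E) = LinearMap.id + t • (A : E →ₗ[ℝ] E) := rfl
      rw [this, map_add, map_smul, LinearMap.toMatrix_id]
    rw [h2]
    simp only [p]
    rw [← Polynomial.coe_evalRingHom, RingHom.map_det]
    congr 1
    ext i j
    by_cases hij : i = j
    · subst hij
      simp [Matrix.map_apply]
      ring
    · simp [Matrix.map_apply, hij]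
      ring
  have hdeg : p.degree < s.card := by
    refine lt_of_le_of_lt Polynomial.degree_le_natDegree ?_
    have := Polynomial.natDegree_det_X_add_C_le M (1 : Matrix _ _ ℝ)
    simp only [Fintype.card_fin] at this
    simp only [s, Finset.card_range]
    exact_mod_cast Nat.lt_succ_of_le this
  have h := congrArg (Polynomial.eval 1) (Lagrange.eq_interpolate (hv.injOn) hdeg)
  rw [hp, one_smul, Lagrange.interpolate_apply, Polynomial.eval_finsetSum] at h
  rw [h]
  refine Finset.sum_congr rfl fun i _ => ?_
  rw [Polynomial.eval_mul, Polynomial.eval_C, hp, mul_comm]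

lemma det_zero {F : E → E} (hF : ContDiff ℝ 1 F) (h1 : ∀ x, ‖F x‖ = 1) (x : E) :
    (fderiv ℝ F x).det = 0 := by
  by_contra hne
  have hd : HasFDerivAt F (fderiv ℝ F x) x :=
    (hF.differentiable (by norm_num) x).hasFDerivAt
  have hs : Function.Surjective (fderiv ℝ F x) := by
    have hu : IsUnit (fderiv ℝ F x : E →ₗ[ℝ] E) := by
      rw [LinearMap.isUnit_iff_isUnit_det]
      exact isUnit_iff_ne_zero.2 hne
    exact ((Module.End.isUnit_iff _).1 hu).2
  obtain ⟨w, hw⟩ := hs (F x)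
  have h2 := hd.norm_sq
  have h3 : HasFDerivAt (fun y => ‖F y‖ ^ 2) (0 : E →L[ℝ] ℝ) x := by
    simp only [h1]; exact hasFDerivAt_const _ _
  have h4 := congrArg (fun L : E →L[ℝ] ℝ => L w) (h2.unique h3)
  simp [hw, h1] at h4

lemma surj {h : E → E} {K : NNReal} (hK : LipschitzOnWith K h (closedBall 0 1))
    (h0 : ∀ x ∈ sphere (0 : E) 1, h x = 0) (hb : ∀ x ∈ closedBall (0 : E) 1, ‖x + h x‖ ≤ 1)
    {t : ℝ} (ht0 : 0 < t) (ht1 : t * (2 * K) < 1) (ht2 : t ≤ 1) :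
    InjOn (fun x => x + t • h x) (closedBall 0 1) ∧
      (fun x => x + t • h x) '' (closedBall 0 1) = closedBall 0 1 := by
  have hKn : (0 : ℝ) ≤ K := K.2
  constructor
  · intro x hx y hy hxy
    have e : x - y = t • (h y - h x) := by
      rw [smul_sub, sub_eq_sub_iff_add_eq_add]
      simp only at hxy
      rw [hxy, add_comm]
    have h1 := hK.dist_le_mul x hx y hy
    rw [dist_eq_norm, dist_eq_norm] at h1
    have h2 : ‖x - y‖ ≤ t * (K * ‖x - y‖) := by
      calc ‖x - y‖ = t * ‖h x - h y‖ := by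
            conv_lhs => rw [e]
            rw [norm_smul, Real.norm_of_nonneg ht0.le, norm_sub_rev]
        _ ≤ _ := by gcongr
    have h3 : ‖x - y‖ ≤ 0 := by
      by_contra hc
      push Not at hc
      nlinarith [mul_nonneg ht0.le hKn]
    exact sub_eq_zero.1 (norm_le_zero_iff.1 h3)
  · apply Subset.antisymm
    · rintro _ ⟨x, hx, rfl⟩
      have hx1 : ‖x‖ ≤ 1 := by simpa using hx
      have e : x + t • h x = (1 - t) • x + t • (x + h x) := by
        rw [sub_smul, one_smul, smul_add]; abel
      rw [mem_closedBall_zero_iff]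
      simp only
      rw [e]
      refine (norm_add_le _ _).trans ?_
      rw [norm_smul, norm_smul, Real.norm_of_nonneg ht0.le,
        Real.norm_of_nonneg (sub_nonneg.2 ht2)]
      have := hb x hx
      nlinarith
    · intro y hy
      have hy1 : ‖y‖ ≤ 1 := by simpa using hy
      let T : E → E := fun x => y - t • h (P x)
      have hT : ContractingWith (Real.toNNReal (t * (2 * K))) T := by
        refine ⟨?_, ?_⟩
        · rw [← NNReal.coe_lt_coe, Real.coe_toNNReal _ (by positivity)]
          exact_mod_cast ht1
        · refine LipschitzWith.of_dist_le_mul fun a b => ?_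
          rw [Real.coe_toNNReal _ (by positivity)]
          have q1 := hK.dist_le_mul (P a) (by simpa using norm_P_le a) (P b)
            (by simpa using norm_P_le b)
          have q2 := P_lip.dist_le_mul a b
          push_cast at q2
          simp only [T]
          rw [dist_sub_left, dist_smul₀, Real.norm_of_nonneg ht0.le]
          calc t * dist (h (P a)) (h (P b)) ≤ t * (K * (2 * dist a b)) := by
                gcongr
                exact q1.trans (by gcongr)
            _ = _ := by ring
      have hfix : T (hT.fixedPoint) = hT.fixedPoint := hT.fixedPoint_isFixedPt
      set x := hT.fixedPoint
      have hx : ‖x‖ ≤ 1 := by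
        by_contra hc
        push Not at hc
        have := h0 (P x) (by simpa using norm_P_of_le hc.le)
        simp only [T, this, smul_zero, sub_zero] at hfix
        rw [hfix] at hy1
        linarith
      refine ⟨x, by simpa using hx, ?_⟩
      simp only [T, P_of_mem hx] at hfix
      simp only
      exact (sub_eq_iff_eq_add.1 hfix).symm

theorem no_retr [Nontrivial E] {F : E → E} (hF : ContDiff ℝ 1 F) (h1 : ∀ x, ‖F x‖ = 1)
    (hid : ∀ x ∈ sphere (0 : E) 1, F x = x) : False := by
  borelize E
  let μ : Measure E := Measure.addHaar
  let B : Set E := closedBall 0 1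
  have hBc : IsCompact B := isCompact_closedBall 0 1
  let h : E → E := fun x => F x - x
  have hh : ContDiff ℝ 1 h := hF.sub contDiff_id
  have hd : ∀ x, HasFDerivAt h (fderiv ℝ h x) x := fun x =>
    (hh.differentiable (by norm_num) x).hasFDerivAt
  have hdc : Continuous (fderiv ℝ h) := hh.continuous_fderiv (by norm_num)
  have hA : ∀ x, 1 + fderiv ℝ h x = fderiv ℝ F x := by
    intro x
    have h2 : HasFDerivAt F (fderiv ℝ F x) x :=
      (hF.differentiable (by norm_num) x).hasFDerivAt
    have h3 := (hd x).unique (h2.sub (hasFDerivAt_id x))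
    rw [h3]
    exact add_sub_cancel _ _
  obtain ⟨K, hK⟩ := (hh.contDiffOn (s := B)).exists_lipschitzOnWith (by norm_num)
    (convex_closedBall 0 1) hBc
  have hdet : Continuous fun z : ℝ × E => (1 + z.1 • fderiv ℝ h z.2).det := by
    refine ContinuousLinearMap.continuous_det.comp ?_
    fun_prop
  have ev1 : ∀ᶠ t : ℝ in 𝓝 0, ∀ x ∈ B, 0 < (1 + t • fderiv ℝ h x).det := by
    refine hBc.eventually_forall_of_forall_eventually fun x _ => ?_
    refine hdet.continuousAt.eventually_const_lt ?_
    simp [ContinuousLinearMap.det]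
  have ev2 : ∀ᶠ t : ℝ in 𝓝 0, t * (2 * K) < 1 :=
    (by fun_prop : Continuous fun t : ℝ => t * (2 * (K : ℝ))).continuousAt.eventually_lt_const
      (by simp)
  have ev3 : ∀ᶠ t : ℝ in 𝓝 0, t < 1 := eventually_lt_nhds one_pos
  obtain ⟨ε, hε, hball⟩ := Metric.eventually_nhds_iff.1 (ev1.and (ev2.and ev3))
  have key : ∀ t : ℝ, 0 < t → t < ε →
      ∫ x in B, (1 + t • fderiv ℝ h x).det ∂μ = μ.real B := by
    intro t ht0 ht
    obtain ⟨p1, p2, p3⟩ := hball (y := t) (by simpa [abs_of_pos ht0] using ht)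
    obtain ⟨i1, i2⟩ := surj hK (fun x hx => by simp [h, hid x hx])
      (fun x _ => by simp [h, h1]) ht0 p2 p3.le
    have cv := lintegral_abs_det_fderiv_eq_addHaar_image μ (s := B)
      (f := fun x => x + t • h x) (f' := fun x => 1 + t • fderiv ℝ h x)
      isClosed_closedBall.measurableSet
      (fun x _ => ((hasFDerivAt_id x).add ((hd x).const_smul t)).hasFDerivWithinAt) i1
    rw [i2] at cv
    rw [integral_eq_lintegral_of_nonneg_ae, measureReal_def, ← cv]
    · congr 1
      refine setLIntegral_congr_fun isClosed_closedBall.measurableSet fun x hx => ?_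
      rw [abs_of_pos (p1 x hx)]
    · exact (ae_restrict_iff' isClosed_closedBall.measurableSet).2
        (Eventually.of_forall fun x hx => (p1 x hx).le)
    · exact (hdet.comp (by fun_prop : Continuous fun x : E => (t, x))).aestronglyMeasurable
  let v : ℕ → ℝ := fun i => ε / (i + 2)
  have hv : Function.Injective v := by
    intro i j hij
    simp only [v] at hij
    have hi : (0 : ℝ) < i + 2 := by positivity
    have hj : (0 : ℝ) < j + 2 := by positivity
    rw [div_eq_div_iff hi.ne' hj.ne'] at hij
    have := mul_left_cancel₀ hε.ne' hij
    have h5 : (j : ℝ) = i := by linarith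
    exact_mod_cast h5.symm
  have hv0 : ∀ i, 0 < v i := fun i => by positivity
  have hv1 : ∀ i, v i < ε := fun i => by
    refine div_lt_self hε ?_
    have : (0 : ℝ) ≤ i := by positivity
    linarith
  obtain ⟨c, hc⟩ := det_interp (E := E) v hv
  have hsum : ∑ i ∈ Finset.range (Module.finrank ℝ E + 1), c i = 1 := by
    have := hc 0
    simpa [ContinuousLinearMap.det] using this.symm
  have hint : ∫ x in B, (1 + fderiv ℝ h x).det ∂μ = μ.real B := by
    rw [funext fun x => hc (fderiv ℝ h x)]
    rw [integral_finsetSum]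
    · simp_rw [integral_const_mul, key _ (hv0 _) (hv1 _)]
      rw [← Finset.sum_mul, hsum, one_mul]
    · intro i _
      refine Integrable.const_mul ?_ _
      exact ((hdet.comp
        (by fun_prop : Continuous fun x : E => (v i, x))).continuousOn).integrableOn_compact hBc
  simp_rw [hA, det_zero hF h1] at hint
  have hpos : 0 < μ B := Metric.measure_closedBall_pos μ 0 one_pos
  have : 0 < μ.real B := ENNReal.toReal_pos hpos.ne' hBc.measure_lt_top.ne
  simp at hint
  linarith

end NoRetr

/-- if `g : Bⁿ → ℝⁿ` (`n ≥ 2`) is continuous on the closed unit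
ball and restricts to the identity on the boundary sphere, then `g` vanishes
somewhere on the ball. -/
theorem statement2 (n : ℕ) (hn : 2 ≤ n)
    (g : EuclideanSpace ℝ (Fin n) → EuclideanSpace ℝ (Fin n))
    (hg : ContinuousOn g (Metric.closedBall (0 : EuclideanSpace ℝ (Fin n)) 1))
    (hgid : ∀ a ∈ Metric.sphere (0 : EuclideanSpace ℝ (Fin n)) 1, g a = a) :
    ∃ a ∈ Metric.closedBall (0 : EuclideanSpace ℝ (Fin n)) 1, g a = 0 := by
  by_contra! hne
  have : Nonempty (Fin n) := ⟨⟨0, by omega⟩⟩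
  let E := EuclideanSpace ℝ (Fin n)
  let k : E → E := fun x => g (NoRetr.P x) - NoRetr.P x
  have hPc : Continuous (NoRetr.P : E → E) := NoRetr.P_lip.continuous
  have hkc : Continuous k := by
    refine Continuous.sub ?_ hPc
    exact hg.comp_continuous hPc fun x => by simpa using NoRetr.norm_P_le x
  have hk0 : ∀ x : E, 1 ≤ ‖x‖ → k x = 0 := by
    intro x hx
    simp only [k]
    rw [hgid _ (by simpa using NoRetr.norm_P_of_le hx), sub_self]
  have hGne : ∀ x : E, 0 < ‖x + k x‖ := by
    intro x
    rw [norm_pos_iff]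
    rcases le_total ‖x‖ 1 with hx | hx
    · simp only [k]
      rw [NoRetr.P_of_mem hx, add_sub_cancel]
      exact hne x (by simpa using hx)
    · rw [hk0 x hx, add_zero, ← norm_pos_iff]
      linarith
  obtain ⟨q, hq, hqk, hqs⟩ := hkc.exists_contDiff_approx 1
    (ε := fun x => ‖x + k x‖) (by fun_prop) hGne
  have hqne : ∀ x, x + q x ≠ 0 := by
    intro x hx
    have := hqk x
    rw [dist_eq_norm, ← norm_neg] at this
    have e : -(q x - k x) = x + k x := by
      rw [← sub_eq_zero]
      have : -(q x - k x) - (x + k x) = -(x + q x) := by abel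
      rw [this, hx, neg_zero]
    rw [e] at this
    exact lt_irrefl _ this
  have hc : ContDiff ℝ 1 (fun x => x + q x) := contDiff_id.add hq
  refine NoRetr.no_retr (E := E) (F := fun x => ‖x + q x‖⁻¹ • (x + q x)) ?_ ?_ ?_
  · exact ((hc.norm ℝ hqne).inv fun x => norm_ne_zero_iff.2 (hqne x)).smul hc
  · intro x
    rw [norm_smul, norm_inv, norm_norm, inv_mul_cancel₀ (norm_ne_zero_iff.2 (hqne x))]
  · intro x hx
    have hx1 : ‖x‖ = 1 := by simpa using hx
    have hq0 : q x = 0 := by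
      by_contra hh
      exact hqs hh (hk0 x hx1.ge)
    simp [hq0, hx1]
end

section
/- Let 0 < η ≤ 1, b > 1 and a > b − 1. Then the double integral of (η ∧ (t−s)^a)/(t−s)^b over the triangle {(s,t) : 0 ≤ s ≤ t ≤ 1} satisfies ∬_{0≤s≤t≤1} (η ∧ (t−s)^a)/(t−s)^b ds dt ≤ a η^{(a−b+1)/a} / ((a−b+1)(b−1)). -/
open MeasureTheory Set
open scoped ENNReal

lemma one_dim (η a b : ℝ) (hη0 : 0 < η) (hb : 1 < b) (ha : b - 1 < a) :
    ∫⁻ u in Ioi (0:ℝ), ENNReal.ofReal (min η (u ^ a) / u ^ b)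
      ≤ ENNReal.ofReal (a * η ^ ((a - b + 1) / a) / ((a - b + 1) * (b - 1))) := by
  have ha0 : 0 < a := by linarith
  have hab : 0 < a - b + 1 := by linarith
  have hb1 : 0 < b - 1 := by linarith
  set c : ℝ := η ^ (1 / a) with hc
  have hc0 : 0 < c := Real.rpow_pos_of_pos hη0 _
  have h1 : ∫⁻ u in Ioc (0:ℝ) c, ENNReal.ofReal (min η (u ^ a) / u ^ b)
      ≤ ENNReal.ofReal (c ^ (a - b + 1) / (a - b + 1)) := by
    have hi : IntegrableOn (fun u : ℝ => u ^ (a - b)) (Ioc 0 c) := by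
      rw [← intervalIntegrable_iff_integrableOn_Ioc_of_le hc0.le]
      exact intervalIntegral.intervalIntegrable_rpow' (by linarith)
    calc _ ≤ ∫⁻ u in Ioc (0:ℝ) c, ENNReal.ofReal (u ^ (a - b)) := by
          refine setLIntegral_mono' measurableSet_Ioc fun u hu => ?_
          apply ENNReal.ofReal_le_ofReal
          rw [Real.rpow_sub hu.1]
          have := Real.rpow_pos_of_pos hu.1 b
          gcongr
          exact min_le_right _ _
      _ = ENNReal.ofReal (∫ u in Ioc (0:ℝ) c, u ^ (a - b)) := by
          rw [ofReal_integral_eq_lintegral_ofReal hi]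
          filter_upwards [ae_restrict_mem measurableSet_Ioc] with u hu
          exact Real.rpow_nonneg hu.1.le _
      _ = _ := by
          rw [← intervalIntegral.integral_of_le hc0.le, integral_rpow (Or.inl (by linarith)),
            Real.zero_rpow hab.ne', sub_zero]
      _ ≤ _ := le_rfl
  have h2 : ∫⁻ u in Ioi c, ENNReal.ofReal (min η (u ^ a) / u ^ b)
      ≤ ENNReal.ofReal (η * (c ^ (1 - b) / (b - 1))) := by
    have hi : IntegrableOn (fun u : ℝ => η * u ^ (-b)) (Ioi c) :=
      (integrableOn_Ioi_rpow_of_lt (by linarith) hc0).const_mul η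
    calc _ ≤ ∫⁻ u in Ioi c, ENNReal.ofReal (η * u ^ (-b)) := by
          refine setLIntegral_mono' measurableSet_Ioi fun u hu => ?_
          have hu0 : 0 < u := hc0.trans hu
          apply ENNReal.ofReal_le_ofReal
          rw [Real.rpow_neg hu0.le, ← div_eq_mul_inv]
          have := Real.rpow_pos_of_pos hu0 b
          gcongr
          exact min_le_left _ _
      _ = ENNReal.ofReal (∫ u in Ioi c, η * u ^ (-b)) := by
          rw [ofReal_integral_eq_lintegral_ofReal hi]
          filter_upwards [ae_restrict_mem measurableSet_Ioi] with u hu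
          exact mul_nonneg hη0.le (Real.rpow_nonneg (hc0.trans hu).le _)
      _ = _ := by
          rw [integral_const_mul, integral_Ioi_rpow_of_lt (by linarith) hc0,
            show -b + 1 = -(b - 1) by ring, neg_div_neg_eq, show 1 - b = -(b-1) by ring]
  rw [← Ioc_union_Ioi_eq_Ioi hc0.le]
  refine (lintegral_union_le _ _ _).trans ((add_le_add h1 h2).trans ?_)
  rw [← ENNReal.ofReal_add (by positivity) (by positivity)]
  apply ENNReal.ofReal_le_ofReal
  have e1 : c ^ (a - b + 1) = η ^ ((a - b + 1) / a) := by
    rw [hc, ← Real.rpow_mul hη0.le]; congr 1; ring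
  have e2 : η * c ^ (1 - b) = η ^ ((a - b + 1) / a) := by
    rw [hc, ← Real.rpow_mul hη0.le]
    nth_rewrite 1 [← Real.rpow_one η]
    rw [← Real.rpow_add hη0]; congr 1; field_simp; ring
  rw [← mul_div_assoc, e2, e1]
  apply le_of_eq
  field_simp
  ring

/-- for `0 < η ≤ 1`, `b > 1` and `a > b - 1`,
`∬_{0≤s≤t≤1} (η ∧ (t-s)^a)/(t-s)^b ds dt ≤ a η^{(a-b+1)/a} / ((a-b+1)(b-1))`. -/
theorem statement3 (η a b : ℝ) (hη0 : 0 < η) (hη1 : η ≤ 1) (hb : 1 < b)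
    (ha : b - 1 < a) :
    ∫⁻ q in {q : ℝ × ℝ | 0 ≤ q.1 ∧ q.1 ≤ q.2 ∧ q.2 ≤ 1},
        ENNReal.ofReal (min η ((q.2 - q.1) ^ a) / (q.2 - q.1) ^ b)
      ≤ ENNReal.ofReal (a * η ^ ((a - b + 1) / a) / ((a - b + 1) * (b - 1))) := by
  set g : ℝ → ℝ≥0∞ := (Ioi (0:ℝ)).indicator
    fun u => ENNReal.ofReal (min η (u ^ a) / u ^ b) with hg
  have hgm : Measurable g := by
    refine Measurable.indicator ?_ measurableSet_Ioi
    fun_prop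
  have hS : MeasurableSet {q : ℝ × ℝ | 0 ≤ q.1 ∧ q.1 ≤ q.2 ∧ q.2 ≤ 1} :=
    (measurableSet_le measurable_const measurable_fst).inter
      ((measurableSet_le measurable_fst measurable_snd).inter
        (measurableSet_le measurable_snd measurable_const))
  calc _ ≤ ∫⁻ q in {q : ℝ × ℝ | 0 ≤ q.1 ∧ q.1 ≤ q.2 ∧ q.2 ≤ 1}, g (q.2 - q.1) := by
        refine setLIntegral_mono' hS fun q hq => ?_
        rcases hq.2.1.eq_or_lt with h | h
        · have : q.2 - q.1 = 0 := by linarith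
          rw [this, Real.zero_rpow (by linarith : b ≠ 0)]
          simp
        · rw [hg, indicator_of_mem (by simpa using h)]
    _ ≤ ∫⁻ q in Icc (0:ℝ) 1 ×ˢ (univ : Set ℝ), g (q.2 - q.1) := by
        refine lintegral_mono_set fun q hq => ?_
        exact ⟨⟨hq.1, hq.2.1.trans hq.2.2⟩, trivial⟩
    _ = ∫⁻ s in Icc (0:ℝ) 1, ∫⁻ t, g (t - s) := by
        rw [Measure.volume_eq_prod, setLIntegral_prod _ (by fun_prop)]
        simp
    _ = ∫⁻ u, g u := by
        simp [lintegral_sub_right_eq_self]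
    _ ≤ _ := by
        rw [hg, lintegral_indicator measurableSet_Ioi]
        exact one_dim η a b hη0 hb ha
end

section
/- Let 0 < α < α' ≤ 1, m ≥ 1 and K < ∞. Let x_n, x : [0,1] → ℝ^d be continuous paths such that x_n converges to x uniformly on [0,1] and sup_n ‖x_n‖_{α',m-B} ≤ K. Then ‖x_n − x‖_{α,m-B} → 0 as n → ∞, i.e. x_n converges to x in the (α,m)-Besov norm. -/
open MeasureTheory Filter Set
open scoped ENNReal NNReal

/-- The `(γ, p)`-Besov norm of a path `x : [0,1] → E`, as an extended real:
`‖x‖_{γ,p-B} = (∬_{0≤s<t≤1} |x_t - x_s|^p / (t-s)^{1+pγ} ds dt)^{1/p}`. -/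
noncomputable def besovNormE {E : Type*} [NormedAddCommGroup E] (γ p : ℝ) (x : ℝ → E) :
    ℝ≥0∞ :=
  (∫⁻ q in {q : ℝ × ℝ | 0 ≤ q.1 ∧ q.1 < q.2 ∧ q.2 ≤ 1},
      ENNReal.ofReal (‖x q.2 - x q.1‖ ^ p / (q.2 - q.1) ^ (1 + p * γ))) ^ (1 / p)

def simplexD : Set (ℝ × ℝ) := {q : ℝ × ℝ | 0 ≤ q.1 ∧ q.1 < q.2 ∧ q.2 ≤ 1}

lemma simplexD_meas : MeasurableSet simplexD := by
  have h1 : MeasurableSet {q : ℝ × ℝ | 0 ≤ q.1} := measurableSet_le measurable_const measurable_fst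
  have h2 : MeasurableSet {q : ℝ × ℝ | q.1 < q.2} := measurableSet_lt measurable_fst measurable_snd
  have h3 : MeasurableSet {q : ℝ × ℝ | q.2 ≤ 1} := measurableSet_le measurable_snd measurable_const
  exact h1.inter (h2.inter h3)

lemma simplexD_fst {q : ℝ × ℝ} (h : q ∈ simplexD) : q.1 ∈ Icc (0:ℝ) 1 :=
  ⟨h.1, h.2.1.le.trans h.2.2⟩

lemma simplexD_snd {q : ℝ × ℝ} (h : q ∈ simplexD) : q.2 ∈ Icc (0:ℝ) 1 :=
  ⟨h.1.trans h.2.1.le, h.2.2⟩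

lemma simplexD_vol : volume simplexD ≤ 1 := by
  calc volume simplexD ≤ volume (Icc (0:ℝ) 1 ×ˢ Icc (0:ℝ) 1) :=
        measure_mono fun q h => ⟨simplexD_fst h, simplexD_snd h⟩
    _ = 1 := by rw [Measure.volume_eq_prod, Measure.prod_prod]; simp

noncomputable def besovF {E : Type*} [NormedAddCommGroup E] (γ p : ℝ) (x : ℝ → E)
    (q : ℝ × ℝ) : ℝ := ‖x q.2 - x q.1‖ ^ p / (q.2 - q.1) ^ (1 + p * γ)

lemma besovF_ae {E : Type*} [NormedAddCommGroup E] {γ p : ℝ} (hp : 1 ≤ p) {x : ℝ → E}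
    (hx : ContinuousOn x (Icc 0 1)) :
    AEMeasurable (fun q => ENNReal.ofReal (besovF γ p x q)) (volume.restrict simplexD) := by
  have h1 : ContinuousOn (fun q : ℝ × ℝ => x q.1) simplexD :=
    hx.comp continuousOn_fst fun q h => simplexD_fst h
  have h2 : ContinuousOn (fun q : ℝ × ℝ => x q.2) simplexD :=
    hx.comp continuousOn_snd fun q h => simplexD_snd h
  have h : ContinuousOn (besovF γ p x) simplexD := by
    refine ContinuousOn.div ((h2.sub h1).norm.rpow_const fun q _ => Or.inr (by linarith))
      (ContinuousOn.rpow_const (by fun_prop) fun q hq => Or.inl ?_) fun q hq => ?_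
    · exact (sub_pos.2 hq.2.1).ne'
    · exact (Real.rpow_pos_of_pos (sub_pos.2 hq.2.1) _).ne'
  exact (h.aemeasurable simplexD_meas).ennreal_ofReal

lemma besov_add_rpow {a b c p : ℝ} (ha : 0 ≤ a) (hb : 0 ≤ b) (hc : 0 ≤ c) (hp : 1 ≤ p)
    (h : c ≤ a + b) : c ^ p ≤ 2 ^ p * a ^ p + 2 ^ p * b ^ p := by
  have hp0 : 0 ≤ p := by linarith
  rw [← Real.mul_rpow (by norm_num) ha, ← Real.mul_rpow (by norm_num) hb]
  have h1 : 0 ≤ (2 * a) ^ p := by positivity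
  have h2 : 0 ≤ (2 * b) ^ p := by positivity
  rcases le_total a b with hab | hab
  · have := Real.rpow_le_rpow hc (show c ≤ 2 * b by linarith) hp0
    linarith
  · have := Real.rpow_le_rpow hc (show c ≤ 2 * a by linarith) hp0
    linarith

lemma besovF_sub {E : Type*} [NormedAddCommGroup E] {γ p : ℝ} (hp : 1 ≤ p) {x y : ℝ → E}
    {q : ℝ × ℝ} (hq : q ∈ simplexD) :
    ENNReal.ofReal (besovF γ p (fun t => x t - y t) q) ≤
      ENNReal.ofReal (2 ^ p) * ENNReal.ofReal (besovF γ p x q) +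
      ENNReal.ofReal (2 ^ p) * ENNReal.ofReal (besovF γ p y q) := by
  have hpos := Real.rpow_pos_of_pos (sub_pos.2 hq.2.1) (1 + p * γ)
  have hF : ∀ z : ℝ → E, 0 ≤ besovF γ p z q := fun z => by unfold besovF; positivity
  rw [← ENNReal.ofReal_mul (by positivity), ← ENNReal.ofReal_mul (by positivity),
    ← ENNReal.ofReal_add (mul_nonneg (by positivity) (hF x)) (mul_nonneg (by positivity) (hF y))]
  apply ENNReal.ofReal_le_ofReal
  unfold besovF
  rw [← mul_div_assoc, ← mul_div_assoc, ← add_div]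
  refine div_le_div_of_nonneg_right ?_ hpos.le
  refine besov_add_rpow (norm_nonneg _) (norm_nonneg _) (norm_nonneg _) hp ?_
  calc ‖x q.2 - y q.2 - (x q.1 - y q.1)‖ = ‖(x q.2 - x q.1) - (y q.2 - y q.1)‖ := by
        congr 1; abel
    _ ≤ _ := norm_sub_le _ _

lemma besovF_split {E : Type*} [NormedAddCommGroup E] {α α' p δ ε : ℝ} (hp : 1 ≤ p)
    (hα : 0 < α) (hαα' : α < α') (hδ : 0 < δ)
    {y : ℝ → E} (hy : ∀ t ∈ Icc (0:ℝ) 1, ‖y t‖ ≤ ε) {q : ℝ × ℝ} (hq : q ∈ simplexD) :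
    ENNReal.ofReal (besovF α p y q) ≤
      ENNReal.ofReal (δ ^ (p * (α' - α))) * ENNReal.ofReal (besovF α' p y q) +
      ENNReal.ofReal ((2 * ε) ^ p / δ ^ (1 + p * α)) := by
  have hs : 0 < q.2 - q.1 := sub_pos.2 hq.2.1
  rcases le_total (q.2 - q.1) δ with h | h
  · refine le_trans ?_ le_self_add
    rw [← ENNReal.ofReal_mul (by positivity)]
    apply ENNReal.ofReal_le_ofReal
    unfold besovF
    have e : (q.2 - q.1) ^ (1 + p * α') =
        (q.2 - q.1) ^ (1 + p * α) * (q.2 - q.1) ^ (p * (α' - α)) := by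
      rw [← Real.rpow_add hs]; ring_nf
    have h2 : (q.2 - q.1) ^ (p * (α' - α)) ≤ δ ^ (p * (α' - α)) :=
      Real.rpow_le_rpow hs.le h (mul_nonneg (by linarith) (by linarith))
    have h3 := Real.rpow_pos_of_pos hs (p * (α' - α))
    have h4 := Real.rpow_pos_of_pos hs (1 + p * α)
    rw [e, ← mul_div_assoc, div_le_div_iff₀ h4 (by positivity)]
    have : 0 ≤ ‖y q.2 - y q.1‖ ^ p * (q.2 - q.1) ^ (1 + p * α) := by positivity
    nlinarith
  · refine le_trans ?_ le_add_self
    apply ENNReal.ofReal_le_ofReal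
    unfold besovF
    have h1 : ‖y q.2 - y q.1‖ ≤ 2 * ε := by
      have := norm_sub_le (y q.2) (y q.1)
      have := hy _ (simplexD_fst hq)
      have := hy _ (simplexD_snd hq)
      linarith
    have h0 : 0 ≤ 2 * ε := (norm_nonneg _).trans h1
    have : 0 ≤ 1 + p * α := by nlinarith
    gcongr

theorem statement5 {d : ℕ} (α α' m K : ℝ)
    (hα : 0 < α) (hαα' : α < α') (hα' : α' ≤ 1) (hm : 1 ≤ m)
    (x : ℕ → ℝ → EuclideanSpace ℝ (Fin d)) (xlim : ℝ → EuclideanSpace ℝ (Fin d))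
    (hxcont : ∀ n, ContinuousOn (x n) (Set.Icc 0 1))
    (hxlimcont : ContinuousOn xlim (Set.Icc 0 1))
    (hunif : TendstoUniformlyOn x xlim atTop (Set.Icc 0 1))
    (hbdd : ∀ n, besovNormE α' m (x n) ≤ ENNReal.ofReal K) :
    Tendsto (fun n => besovNormE α m (fun t => x n t - xlim t)) atTop (nhds 0) := by
  have hm0 : 0 < m := by linarith
  have hb : ∀ n, ∫⁻ q in simplexD, ENNReal.ofReal (besovF α' m (x n) q) ≤
      ENNReal.ofReal K ^ m := by
    intro n
    have h := ENNReal.rpow_le_rpow (hbdd n) hm0.le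
    unfold besovNormE at h
    rw [← ENNReal.rpow_mul, one_div, inv_mul_cancel₀ hm0.ne', ENNReal.rpow_one] at h
    exact h
  have hKtop : ENNReal.ofReal K ^ m ≠ ∞ := ENNReal.rpow_ne_top_of_nonneg hm0.le ENNReal.ofReal_ne_top
  have hblim : ∫⁻ q in simplexD, ENNReal.ofReal (besovF α' m xlim q) ≤ ENNReal.ofReal K ^ m := by
    have e : ∫⁻ q in simplexD, ENNReal.ofReal (besovF α' m xlim q) =
        ∫⁻ q in simplexD, liminf (fun n => ENNReal.ofReal (besovF α' m (x n) q)) atTop := by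
      refine setLIntegral_congr_fun simplexD_meas fun q hq => ?_
      refine (Tendsto.liminf_eq ?_).symm
      refine ENNReal.tendsto_ofReal ?_
      unfold besovF
      refine Tendsto.div_const ?_ _
      exact (((hunif.tendsto_at (simplexD_snd hq)).sub
        (hunif.tendsto_at (simplexD_fst hq))).norm).rpow_const (Or.inr hm0.le)
    rw [e]
    refine (lintegral_liminf_le' fun n => besovF_ae hm (hxcont n)).trans ?_
    exact liminf_le_of_frequently_le' (Frequently.of_forall hb)
  set M : ℝ≥0∞ := ENNReal.ofReal (2 ^ m) * ENNReal.ofReal K ^ m +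
    ENNReal.ofReal (2 ^ m) * ENNReal.ofReal K ^ m with hM
  have hMtop : M ≠ ∞ := by
    have := ENNReal.mul_ne_top (ENNReal.ofReal_ne_top (r := 2 ^ m)) hKtop
    exact ENNReal.add_ne_top.2 ⟨this, this⟩
  have hg : ∀ n, ∫⁻ q in simplexD, ENNReal.ofReal (besovF α' m (fun t => x n t - xlim t) q) ≤ M := by
    intro n
    refine (setLIntegral_mono' simplexD_meas fun q hq => besovF_sub hm hq).trans ?_
    rw [lintegral_add_left' ((besovF_ae hm (hxcont n)).const_mul _),
      lintegral_const_mul' _ _ ENNReal.ofReal_ne_top, lintegral_const_mul' _ _ ENNReal.ofReal_ne_top]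
    rw [hM]
    gcongr
    exact hb n
  have hf : ∀ n δ ε, 0 < δ → (∀ t ∈ Icc (0:ℝ) 1, ‖x n t - xlim t‖ ≤ ε) →
      ∫⁻ q in simplexD, ENNReal.ofReal (besovF α m (fun t => x n t - xlim t) q) ≤
      ENNReal.ofReal (δ ^ (m * (α' - α))) * M + ENNReal.ofReal ((2 * ε) ^ m / δ ^ (1 + m * α)) := by
    intro n δ ε hδ hy
    refine (setLIntegral_mono' simplexD_meas fun q hq => besovF_split hm hα hαα' hδ hy hq).trans ?_
    rw [lintegral_add_right _ measurable_const, lintegral_const_mul' _ _ ENNReal.ofReal_ne_top,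
      setLIntegral_const]
    refine add_le_add (mul_le_mul_right (hg n) _) ?_
    exact (mul_le_mul_right simplexD_vol _).trans (mul_one _).le
  have key : Tendsto (fun n => ∫⁻ q in simplexD,
      ENNReal.ofReal (besovF α m (fun t => x n t - xlim t) q)) atTop (nhds 0) := by
    rw [ENNReal.tendsto_nhds_zero]
    intro e he
    have he2 : 0 < e / 2 := ENNReal.half_pos he.ne'
    have hexp : 0 < m * (α' - α) := mul_pos hm0 (by linarith)
    have t1 : Tendsto (fun δ : ℝ => ENNReal.ofReal (δ ^ (m * (α' - α))) * M)
        (nhdsWithin 0 (Ioi 0)) (nhds 0) := by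
      have h1 : Tendsto (fun δ : ℝ => δ ^ (m * (α' - α))) (nhds 0) (nhds 0) := by
        have := (Real.continuous_rpow_const hexp.le).tendsto (0:ℝ)
        rwa [Real.zero_rpow hexp.ne'] at this
      have h2 := ENNReal.Tendsto.mul_const (b := M) (ENNReal.tendsto_ofReal h1) (Or.inr hMtop)
      rw [ENNReal.ofReal_zero, zero_mul] at h2
      exact h2.mono_left nhdsWithin_le_nhds
    obtain ⟨δ, hδ1, hδ⟩ := ((ENNReal.tendsto_nhds_zero.1 t1 _ he2).and self_mem_nhdsWithin).exists
    have t2 : Tendsto (fun ε : ℝ => ENNReal.ofReal ((2 * ε) ^ m / δ ^ (1 + m * α)))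
        (nhdsWithin 0 (Ioi 0)) (nhds 0) := by
      have h1 : Continuous (fun ε : ℝ => (2 * ε) ^ m / δ ^ (1 + m * α)) :=
        (Continuous.rpow_const (by fun_prop) fun _ => Or.inr hm0.le).div_const _
      have h2 := ENNReal.tendsto_ofReal (h1.tendsto 0)
      rw [mul_zero, Real.zero_rpow hm0.ne', zero_div, ENNReal.ofReal_zero] at h2
      exact h2.mono_left nhdsWithin_le_nhds
    obtain ⟨ε, hε1, hε⟩ := ((ENNReal.tendsto_nhds_zero.1 t2 _ he2).and self_mem_nhdsWithin).exists
    filter_upwards [Metric.tendstoUniformlyOn_iff.1 hunif ε hε] with n hn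
    refine (hf n δ ε hδ fun t ht => ?_).trans ?_
    · rw [← dist_eq_norm, dist_comm]; exact (hn t ht).le
    · exact (add_le_add hδ1 hε1).trans (ENNReal.add_halves e).le
  have h := (ENNReal.continuous_rpow_const (y := 1 / m)).tendsto 0 |>.comp key
  rw [ENNReal.zero_rpow_of_pos (by positivity)] at h
  exact h
end

section
/- Let (w_t)_{t∈[0,1]} be a d-dimensional Brownian motion, z(k) = w(k+1) − w(k) the difference of consecutive dyadic polygonal approximations, and let m ∈ ℕ₊ and 1/3 < α < 1/2 satisfy 4m − 8mα − 1 > 0. Then there exists a constant C > 0, depending only on α, m, d, such that for all k ∈ ℕ, E[ ( ∬_{0≤s<t≤1} |z(k)_t − z(k)_s|^{4m} / (t−s)^{1+4mα} ds dt )² ] ≤ C · 2^{−k(4m−8mα−1)}. -/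
open MeasureTheory ProbabilityTheory Filter Set

/-- The `k`-th dyadic polygonal approximation of a path `w : ℝ → E`:
the piecewise linear path agreeing with `w` at the dyadic points `l / 2^k`
and affine in between. -/
noncomputable def dyadicApprox {E : Type*} [AddCommGroup E] [Module ℝ E]
    (w : ℝ → E) (k : ℕ) (t : ℝ) : E :=
  w ((⌊t * 2 ^ k⌋ : ℝ) / 2 ^ k)
    + ((2 : ℝ) ^ k * (t - (⌊t * 2 ^ k⌋ : ℝ) / 2 ^ k)) •
      (w (((⌊t * 2 ^ k⌋ : ℝ) + 1) / 2 ^ k) - w ((⌊t * 2 ^ k⌋ : ℝ) / 2 ^ k))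

/-- `w` is a `d`-dimensional Brownian motion on `[0,1]` under the probability
measure `P`: continuous sample paths, `w 0 = 0`, independent increments, and
`w t - w s` is a centered Gaussian vector with covariance `(t - s) • Id`
(formulated as: the `d` coordinates of the increment are independent, each with
law `gaussianReal 0 (t - s)`). -/
def IsBrownianMotion {Ω : Type*} [MeasurableSpace Ω] (P : Measure Ω) (d : ℕ)
    (w : ℝ → Ω → EuclideanSpace ℝ (Fin d)) : Prop :=
  IsProbabilityMeasure P ∧
  (∀ t : ℝ, Measurable (w t)) ∧
  (∀ ω, Continuous fun t => w t ω) ∧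
  (∀ ω, w 0 ω = 0) ∧
  (∀ (n : ℕ) (t : Fin (n + 1) → ℝ), Monotone t → (∀ i, t i ∈ Set.Icc (0 : ℝ) 1) →
    iIndepFun
      (fun (i : Fin n) ω => w (t i.succ) ω - w (t i.castSucc) ω) P) ∧
  (∀ s t : ℝ, 0 ≤ s → s ≤ t → t ≤ 1 →
    (iIndepFun (fun (i : Fin d) ω => (w t ω - w s ω) i) P ∧
     ∀ i : Fin d,
       P.map (fun ω => (w t ω - w s ω) i) = gaussianReal 0 (Real.toNNReal (t - s))))

noncomputable def zMid {E : Type*} [AddCommGroup E] [Module ℝ E]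
    (w : ℝ → E) (k : ℕ) (j : ℤ) : E :=
  w ((2 * (j : ℝ) + 1) / 2 ^ (k + 1)) - (1 / 2 : ℝ) • (w ((j : ℝ) / 2 ^ k) + w (((j : ℝ) + 1) / 2 ^ k))

lemma z_eq {E : Type*} [AddCommGroup E] [Module ℝ E] (w : ℝ → E) (k : ℕ) (t : ℝ) :
    dyadicApprox w (k + 1) t - dyadicApprox w k t =
      (min (2 * (t * 2 ^ k - ⌊t * 2 ^ k⌋)) (2 - 2 * (t * 2 ^ k - ⌊t * 2 ^ k⌋))) •
        zMid w k ⌊t * 2 ^ k⌋ := by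
  have h2 : (0 : ℝ) < 2 ^ k := by positivity
  set j := ⌊t * 2 ^ k⌋ with hj
  have h1 : (j : ℝ) ≤ t * 2 ^ k := Int.floor_le _
  have h3 : t * 2 ^ k < j + 1 := Int.lt_floor_add_one _
  have e1 : (2 : ℝ) ^ k * (t - (j : ℝ) / 2 ^ k) = t * 2 ^ k - j := by field_simp
  rcases lt_or_ge (t * 2 ^ k - j) (1 / 2) with hx | hx
  · have hf : ⌊t * 2 ^ (k + 1)⌋ = 2 * j := by
      rw [Int.floor_eq_iff]; push_cast; rw [pow_succ]; constructor <;> linarith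
    have e2 : (((2 * j : ℤ) : ℝ)) / 2 ^ (k + 1) = j / 2 ^ k := by
      push_cast; rw [pow_succ]; field_simp
    have e3 : (2 : ℝ) ^ (k + 1) * (t - (j : ℝ) / 2 ^ k) = 2 * (t * 2 ^ k - j) := by
      rw [pow_succ]; field_simp
    rw [min_eq_left (by linarith)]
    unfold dyadicApprox zMid
    rw [hf, e2, ← hj, e1, e3]
    push_cast
    module
  · have hf : ⌊t * 2 ^ (k + 1)⌋ = 2 * j + 1 := by
      rw [Int.floor_eq_iff]; push_cast; rw [pow_succ]; constructor <;> linarith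
    have e2 : (((2 * j + 1 : ℤ) : ℝ) + 1) / 2 ^ (k + 1) = (j + 1) / 2 ^ k := by
      push_cast; rw [pow_succ]; field_simp; ring
    have e3 : (2 : ℝ) ^ (k + 1) * (t - (2 * (j : ℝ) + 1) / 2 ^ (k + 1))
        = 2 * (t * 2 ^ k - j) - 1 := by
      rw [pow_succ]; field_simp; ring
    rw [min_eq_right (by linarith)]
    unfold dyadicApprox zMid
    rw [hf, e2, ← hj, e1]
    push_cast
    rw [e3]
    module

lemma z_bound {E : Type*} [NormedAddCommGroup E] [NormedSpace ℝ E] (w : ℝ → E) (k : ℕ) (M : ℝ)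
    (hM0 : 0 ≤ M) (hM : ∀ l ∈ Finset.range (2 ^ k), ‖zMid w k (l : ℤ)‖ ≤ M)
    (s t : ℝ) (hs : 0 ≤ s) (hst : s < t) (ht : t ≤ 1) :
    ‖(dyadicApprox w (k + 1) t - dyadicApprox w k t)
      - (dyadicApprox w (k + 1) s - dyadicApprox w k s)‖ ≤ M * (2 * min 1 (2 ^ k * (t - s))) := by
  have h2 : (0 : ℝ) < 2 ^ k := by positivity
  rw [z_eq, z_eq]
  have key : ∀ u : ℝ, 0 ≤ u → u ≤ 1 → ∀ c : ℝ, (u = 1 → c = 0) →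
      ‖c • zMid w k ⌊u * 2 ^ k⌋‖ ≤ |c| * M := by
    intro u hu0 hu1 c hc
    rw [norm_smul, Real.norm_eq_abs]
    rcases eq_or_lt_of_le hu1 with h | h
    · rw [hc h]; simp
    · apply mul_le_mul_of_nonneg_left _ (abs_nonneg _)
      have h0 : 0 ≤ ⌊u * 2 ^ k⌋ := Int.floor_nonneg.2 (by positivity)
      obtain ⟨l, hl⟩ := Int.eq_ofNat_of_zero_le h0
      rw [hl]
      apply hM
      rw [Finset.mem_range]
      have : ⌊u * 2 ^ k⌋ < ((2 ^ k : ℕ) : ℤ) := by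
        rw [Int.floor_lt]; push_cast; nlinarith
      omega
  have one : ∀ u : ℝ, u = 1 → min (2 * (u * 2 ^ k - ⌊u * 2 ^ k⌋)) (2 - 2 * (u * 2 ^ k - ⌊u * 2 ^ k⌋)) = 0 := by
    rintro u rfl
    have : ⌊(1 : ℝ) * 2 ^ k⌋ = ((2 ^ k : ℕ) : ℤ) := by
      rw [Int.floor_eq_iff]; push_cast; constructor <;> linarith
    rw [this]; push_cast; norm_num
  have a1 := Int.floor_le (s * 2 ^ k)
  have a2 := Int.lt_floor_add_one (s * 2 ^ k)
  have b1 := Int.floor_le (t * 2 ^ k)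
  have b2 := Int.lt_floor_add_one (t * 2 ^ k)
  have kt := key t (by linarith) ht _ (one t)
  have ks := key s hs (by linarith) _ (one s)
  have hab : (2 : ℝ) ^ k * (t - s) = t * 2 ^ k - s * 2 ^ k := by ring
  have hlt : s * 2 ^ k < t * 2 ^ k := by nlinarith
  have hmono : ⌊s * 2 ^ k⌋ ≤ ⌊t * 2 ^ k⌋ := Int.floor_mono hlt.le
  rw [abs_of_nonneg (le_min (by linarith) (by linarith))] at kt ks
  rw [hab]
  rcases le_total 1 (t * 2 ^ k - s * 2 ^ k) with h | h
  · rw [min_eq_left h]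
    refine (norm_sub_le _ _).trans ?_
    have m1 : min (2 * (t * 2 ^ k - ⌊t * 2 ^ k⌋)) (2 - 2 * (t * 2 ^ k - (⌊t * 2 ^ k⌋ : ℝ))) ≤ 1 := by
      rw [min_le_iff]; by_contra! hh; linarith [hh.1, hh.2]
    have m2 : min (2 * (s * 2 ^ k - ⌊s * 2 ^ k⌋)) (2 - 2 * (s * 2 ^ k - (⌊s * 2 ^ k⌋ : ℝ))) ≤ 1 := by
      rw [min_le_iff]; by_contra! hh; linarith [hh.1, hh.2]
    nlinarith
  · rw [min_eq_right h]
    rcases eq_or_lt_of_le hmono with he | he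
    · rw [← he, ← sub_smul]
      have := key s hs (by linarith) (min (2 * (t * 2 ^ k - ⌊s * 2 ^ k⌋)) (2 - 2 * (t * 2 ^ k - ⌊s * 2 ^ k⌋)) - min (2 * (s * 2 ^ k - ⌊s * 2 ^ k⌋)) (2 - 2 * (s * 2 ^ k - (⌊s * 2 ^ k⌋ : ℝ)))) (by intro h1; linarith)
      refine this.trans ?_
      rw [mul_comm]
      apply mul_le_mul_of_nonneg_left _ hM0
      refine (abs_min_sub_min_le_max _ _ _ _).trans ?_
      apply max_le <;> rw [abs_le] <;> constructor <;> linarith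
    · refine (norm_sub_le _ _).trans ?_
      have he' : (⌊s * 2 ^ k⌋ : ℝ) + 1 ≤ ⌊t * 2 ^ k⌋ := by exact_mod_cast he
      have m1 := min_le_left (2 * (t * 2 ^ k - ⌊t * 2 ^ k⌋)) (2 - 2 * (t * 2 ^ k - (⌊t * 2 ^ k⌋ : ℝ)))
      have m2 := min_le_right (2 * (s * 2 ^ k - ⌊s * 2 ^ k⌋)) (2 - 2 * (s * 2 ^ k - (⌊s * 2 ^ k⌋ : ℝ)))
      nlinarith

open scoped ENNReal in
lemma gauss_moment (n : ℕ) : ∃ G : ℝ≥0∞, G ≠ ⊤ ∧ ∀ v : NNReal,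
    ∫⁻ x, ‖x‖ₑ ^ (2 * n) ∂(gaussianReal 0 v) ≤ G * (v : ℝ≥0∞) ^ n := by
  refine ⟨∫⁻ x, ‖x‖ₑ ^ (2 * n) ∂(gaussianReal 0 1), ?_, ?_⟩
  · rcases Nat.eq_zero_or_pos n with rfl | hn
    · simp
    have h := (memLp_id_gaussianReal' (μ := 0) (v := 1) ((2 * n : ℕ) : ℝ≥0∞) (ENNReal.natCast_ne_top _)).eLpNorm_lt_top
    have h2 := lintegral_rpow_enorm_lt_top_of_eLpNorm_lt_top (by simp; omega) (ENNReal.natCast_ne_top _) h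
    simp only [ENNReal.toReal_natCast, ENNReal.rpow_natCast, id] at h2
    exact h2.ne
  · intro v
    have h := gaussianReal_map_const_mul (μ := 0) (v := 1) (Real.sqrt v)
    have e : (NNReal.mk ((Real.sqrt v) ^ 2) (sq_nonneg _) * 1 : NNReal) = v := by
      ext; simp
    rw [mul_zero, e] at h
    rw [← h, lintegral_map (by fun_prop) (by fun_prop)]
    simp only [enorm_mul, mul_pow]
    rw [lintegral_const_mul _ (by fun_prop), mul_comm]
    apply mul_le_mul_right
    rw [pow_mul]
    apply pow_le_pow_left'
    rw [Real.enorm_eq_ofReal (Real.sqrt_nonneg _), ← ENNReal.ofReal_pow (Real.sqrt_nonneg _)]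
    simp

open scoped ENNReal in
lemma bm_moment {Ω : Type*} [MeasurableSpace Ω] (P : Measure Ω) (d : ℕ)
    (w : ℝ → Ω → EuclideanSpace ℝ (Fin d)) (hw : IsBrownianMotion P d w) (n : ℕ) (hn : 1 ≤ n) :
    ∃ K : ℝ≥0∞, K ≠ ⊤ ∧ ∀ s t : ℝ, 0 ≤ s → s ≤ t → t ≤ 1 →
      ∫⁻ ω, ‖w t ω - w s ω‖ₑ ^ (2 * n) ∂P ≤ K * ENNReal.ofReal (t - s) ^ n := by
  obtain ⟨G, hG, hGb⟩ := gauss_moment n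
  obtain ⟨-, hmeas, -, -, -, hgauss⟩ := hw
  refine ⟨(d : ℝ≥0∞) ^ (((2 * n : ℕ) : ℝ) - 1) * (d * G), ?_, ?_⟩
  · refine ENNReal.mul_ne_top ?_ (ENNReal.mul_ne_top (by simp) hG)
    apply ENNReal.rpow_ne_top_of_nonneg _ (by simp)
    have : (1 : ℝ) ≤ ((2 * n : ℕ) : ℝ) := by exact_mod_cast (by omega)
    linarith
  · intro s t hs hst ht
    have hpt : ∀ v : EuclideanSpace ℝ (Fin d), ‖v‖ₑ ^ (2 * n) ≤
        (d : ℝ≥0∞) ^ (((2 * n : ℕ) : ℝ) - 1) * ∑ i, ‖v i‖ₑ ^ (2 * n) := by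
      intro v
      have h1 : ‖v‖ₑ ≤ ∑ i, ‖v i‖ₑ := by
        have : v = ∑ i, EuclideanSpace.single i (v i) := by
          ext j; simp [Pi.single_apply]
        conv_lhs => rw [this]
        refine (enorm_sum_le _ _).trans (le_of_eq ?_)
        apply Finset.sum_congr rfl
        intro i _
        rw [← ofReal_norm, ← ofReal_norm]; simp
      have h2 := ENNReal.rpow_sum_le_const_mul_sum_rpow (Finset.univ) (fun i => ‖v i‖ₑ)
        (p := ((2 * n : ℕ) : ℝ)) (by exact_mod_cast (by omega))
      simp only [ENNReal.rpow_natCast, Finset.card_univ, Fintype.card_fin] at h2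
      exact (pow_le_pow_left' h1 _).trans h2
    have hm : ∀ i, Measurable fun ω => (w t ω - w s ω) i := by
      intro i
      have := (hmeas t).sub (hmeas s)
      fun_prop
    calc _ ≤ ∫⁻ ω, (d : ℝ≥0∞) ^ (((2 * n : ℕ) : ℝ) - 1) * ∑ i, ‖(w t ω - w s ω) i‖ₑ ^ (2 * n) ∂P :=
          lintegral_mono fun ω => hpt _
      _ = (d : ℝ≥0∞) ^ (((2 * n : ℕ) : ℝ) - 1) * ∑ i, ∫⁻ ω, ‖(w t ω - w s ω) i‖ₑ ^ (2 * n) ∂P := by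
          rw [lintegral_const_mul, lintegral_finsetSum]
          · intro i _; exact (hm i).enorm.pow_const _
          · exact Finset.measurable_sum _ fun i _ => (hm i).enorm.pow_const _
      _ ≤ (d : ℝ≥0∞) ^ (((2 * n : ℕ) : ℝ) - 1) * ∑ i : Fin d, G * ENNReal.ofReal (t - s) ^ n := by
          gcongr with i
          have h := (hgauss s t hs hst ht).2 i
          have h3 := hGb (Real.toNNReal (t - s))
          rw [← h, lintegral_map (by fun_prop) (hm i)] at h3
          exact h3
      _ = _ := by
          simp [mul_assoc]

lemma U_bound (p β : ℝ) (hβ : 0 < β) (hp : β < p) : ∃ A : ℝ, 0 < A ∧ ∀ D : ℝ, 0 < D →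
    ∫⁻ q in {q : ℝ × ℝ | 0 ≤ q.1 ∧ q.1 < q.2 ∧ q.2 ≤ 1},
      ENNReal.ofReal ((2 * min 1 (D * (q.2 - q.1))) ^ p / (q.2 - q.1) ^ (1 + β))
      ≤ ENNReal.ofReal (A * D ^ β) := by
  have hpb : 0 < p - β := by linarith
  refine ⟨2 ^ p * (1 / (p - β) + 1 / β), by positivity, fun D hD => ?_⟩
  set u : ℝ → ENNReal := fun h => ENNReal.ofReal ((2 * min 1 (D * h)) ^ p / h ^ (1 + β)) with hu
  have hum : Measurable u := by
    apply Measurable.ennreal_ofReal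
    fun_prop
  set g : ℝ → ENNReal := (Ioi 0).indicator u with hg
  have hgm : Measurable g := hum.indicator measurableSet_Ioi
  have hS : MeasurableSet {q : ℝ × ℝ | 0 ≤ q.1 ∧ q.1 < q.2 ∧ q.2 ≤ 1} := by
    apply MeasurableSet.inter (measurableSet_le measurable_const measurable_fst)
    apply MeasurableSet.inter (measurableSet_lt measurable_fst measurable_snd)
    exact measurableSet_le measurable_snd measurable_const
  have hDi : 0 < 1 / D := by positivity
  calc _ = ∫⁻ q in {q : ℝ × ℝ | 0 ≤ q.1 ∧ q.1 < q.2 ∧ q.2 ≤ 1}, g (q.2 - q.1) := by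
        apply setLIntegral_congr_fun hS
        intro q hq
        have : q.2 - q.1 ∈ Ioi (0 : ℝ) := by simpa using hq.2.1
        simp only [hg, indicator_of_mem this, hu]
    _ ≤ ∫⁻ q in (Icc (0 : ℝ) 1) ×ˢ (univ : Set ℝ), g (q.2 - q.1) := by
        apply lintegral_mono_set
        rintro q ⟨h1, h2, h3⟩
        exact ⟨⟨h1, by linarith⟩, trivial⟩
    _ = ∫⁻ s in Icc (0 : ℝ) 1, ∫⁻ t, g (t - s) := by
        rw [Measure.volume_eq_prod, setLIntegral_prod]
        · simp
        · exact (hgm.comp (by fun_prop)).aemeasurable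
    _ = ∫⁻ h, g h := by
        simp_rw [lintegral_sub_right_eq_self]
        simp
    _ = ∫⁻ h in Ioi 0, u h := by rw [hg, lintegral_indicator measurableSet_Ioi]
    _ ≤ (∫⁻ h in Ioc 0 (1 / D), u h) + ∫⁻ h in Ioi (1 / D), u h := by
        rw [← Ioc_union_Ioi_eq_Ioi hDi.le]
        exact lintegral_union_le _ _ _
    _ ≤ ENNReal.ofReal (2 ^ p * D ^ p * ((1 / D) ^ (p - β) / (p - β)))
        + ENNReal.ofReal (2 ^ p * ((1 / D) ^ (-β) / β)) := by
        gcongr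
        · have e : ∫ h in Ioc 0 (1 / D), 2 ^ p * D ^ p * h ^ (p - β - 1) =
              2 ^ p * D ^ p * ((1 / D) ^ (p - β) / (p - β)) := by
            rw [integral_const_mul, ← intervalIntegral.integral_of_le hDi.le,
              integral_rpow (Or.inl (by linarith))]
            simp [Real.zero_rpow hpb.ne']
          rw [← e, ofReal_integral_eq_lintegral_ofReal]
          · apply setLIntegral_mono' measurableSet_Ioc
            intro h hh
            apply ENNReal.ofReal_le_ofReal
            have h0 : 0 < h := hh.1
            have : (2 * min 1 (D * h)) ^ p ≤ 2 ^ p * D ^ p * h ^ p := by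
              rw [← Real.mul_rpow (by norm_num) hD.le, ← Real.mul_rpow (by positivity) h0.le]
              apply Real.rpow_le_rpow (by positivity) _ (by linarith)
              nlinarith [min_le_right 1 (D * h)]
            rw [show p - β - 1 = p - (1 + β) by ring, Real.rpow_sub h0, ← mul_div_assoc]
            gcongr
          · apply Integrable.const_mul
            have := (intervalIntegral.intervalIntegrable_rpow' (a := 0) (b := 1 / D) (r := p - β - 1) (by linarith)).1
            exact this
          · filter_upwards [ae_restrict_mem measurableSet_Ioc] with h hh
            have h0 : 0 < h := hh.1
            simp only [Pi.zero_apply]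
            positivity
        · have e : ∫ h in Ioi (1 / D), 2 ^ p * h ^ (-(1 + β)) =
              2 ^ p * ((1 / D) ^ (-β) / β) := by
            rw [integral_const_mul, integral_Ioi_rpow_of_lt (by linarith) hDi]
            rw [show -(1 + β) + 1 = -β by ring, neg_div_neg_eq]
          rw [← e, ofReal_integral_eq_lintegral_ofReal]
          · apply setLIntegral_mono' measurableSet_Ioi
            intro h hh
            apply ENNReal.ofReal_le_ofReal
            have h0 : 0 < h := hDi.trans hh
            rw [Real.rpow_neg h0.le, ← div_eq_mul_inv]
            gcongr
            · linarith
            · nlinarith [min_le_left 1 (D * h)]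
          · apply Integrable.const_mul
            exact integrableOn_Ioi_rpow_of_lt (by linarith) hDi
          · filter_upwards [ae_restrict_mem measurableSet_Ioi] with h hh
            have h0 : 0 < h := hDi.trans hh
            simp only [Pi.zero_apply]
            positivity
    _ = _ := by
        rw [← ENNReal.ofReal_add (by positivity) (by positivity)]
        congr 1
        rw [one_div, Real.inv_rpow hD.le, Real.inv_rpow hD.le, ← Real.rpow_neg hD.le,
          ← Real.rpow_neg hD.le, neg_neg]
        have : D ^ β = D ^ p * D ^ (-(p - β)) := by
          rw [← Real.rpow_add hD]; congr 1; ring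
        rw [this]
        ring

open scoped ENNReal in
lemma zMid_moment {Ω : Type*} [MeasurableSpace Ω] (P : Measure Ω) (d : ℕ)
    (w : ℝ → Ω → EuclideanSpace ℝ (Fin d)) (hw : IsBrownianMotion P d w) (n : ℕ) (hn : 1 ≤ n) :
    ∃ K : ℝ≥0∞, K ≠ ⊤ ∧ ∀ k : ℕ, ∀ l ∈ Finset.range (2 ^ k),
      ∫⁻ ω, ‖zMid (fun u => w u ω) k (l : ℤ)‖ₑ ^ (2 * n) ∂P
        ≤ K * ENNReal.ofReal (1 / 2 ^ k) ^ n := by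
  obtain ⟨K, hK, hKb⟩ := bm_moment P d w hw n hn
  have hmeas := hw.2.1
  refine ⟨2 ^ (2 * n) * (K + K), ENNReal.mul_ne_top (by simp) (by simp [hK]), ?_⟩
  intro k l hl
  have h2 : (0 : ℝ) < 2 ^ k := by positivity
  have hl' : (l : ℝ) + 1 ≤ 2 ^ k := by
    have := Finset.mem_range.1 hl
    exact_mod_cast this
  set a : ℝ := (((l : ℤ) : ℝ)) / 2 ^ k with ha
  set b : ℝ := (((l : ℤ) : ℝ) + 1) / 2 ^ k with hb
  set c : ℝ := (2 * (((l : ℤ) : ℝ)) + 1) / 2 ^ (k + 1) with hc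
  have hca : c - a = (1 / 2) * (1 / 2 ^ k) := by
    rw [hc, ha, pow_succ]; field_simp; ring
  have hbc : b - c = (1 / 2) * (1 / 2 ^ k) := by
    rw [hc, hb, pow_succ]; field_simp; ring
  have hpos : (0 : ℝ) < 1 / 2 ^ k := by positivity
  have ha0 : 0 ≤ a := by rw [ha]; positivity
  have hb1 : b ≤ 1 := by
    rw [hb, div_le_one h2]; simpa using hl'
  have i1 := hKb a c ha0 (by linarith) (by linarith)
  have i2 := hKb c b (by linarith) (by linarith) hb1
  rw [hca] at i1
  rw [hbc] at i2
  have hle : ENNReal.ofReal (1 / 2 * (1 / 2 ^ k)) ^ n ≤ ENNReal.ofReal (1 / 2 ^ k) ^ n :=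
    pow_le_pow_left' (ENNReal.ofReal_le_ofReal (by linarith)) _
  have hpt : ∀ ω, ‖zMid (fun u => w u ω) k (l : ℤ)‖ₑ ^ (2 * n) ≤
      2 ^ (2 * n) * (‖w c ω - w a ω‖ₑ ^ (2 * n) + ‖w b ω - w c ω‖ₑ ^ (2 * n)) := by
    intro ω
    have e : zMid (fun u => w u ω) k (l : ℤ) =
        (1 / 2 : ℝ) • (w c ω - w a ω) - (1 / 2 : ℝ) • (w b ω - w c ω) := by
      unfold zMid
      rw [← ha, ← hb, ← hc]
      module
    have half : ∀ v : EuclideanSpace ℝ (Fin d), ‖(1 / 2 : ℝ) • v‖ₑ ≤ ‖v‖ₑ := by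
      intro v
      rw [← ofReal_norm, ← ofReal_norm]
      apply ENNReal.ofReal_le_ofReal
      rw [norm_smul]
      norm_num
      linarith [norm_nonneg v]
    have h1 : ‖zMid (fun u => w u ω) k (l : ℤ)‖ₑ ≤ ‖w c ω - w a ω‖ₑ + ‖w b ω - w c ω‖ₑ := by
      rw [e]
      exact (enorm_sub_le).trans (add_le_add (half _) (half _))
    rcases le_total ‖w c ω - w a ω‖ₑ ‖w b ω - w c ω‖ₑ with h | h
    · calc _ ≤ (2 * ‖w b ω - w c ω‖ₑ) ^ (2 * n) :=
            pow_le_pow_left' (h1.trans (by rw [two_mul]; exact add_le_add h le_rfl)) _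
        _ = 2 ^ (2 * n) * ‖w b ω - w c ω‖ₑ ^ (2 * n) := mul_pow _ _ _
        _ ≤ _ := mul_le_mul_right le_add_self _
    · calc _ ≤ (2 * ‖w c ω - w a ω‖ₑ) ^ (2 * n) :=
            pow_le_pow_left' (h1.trans (by rw [two_mul]; exact add_le_add le_rfl h)) _
        _ = 2 ^ (2 * n) * ‖w c ω - w a ω‖ₑ ^ (2 * n) := mul_pow _ _ _
        _ ≤ _ := mul_le_mul_right le_self_add _
  have m1 : Measurable fun ω => ‖w c ω - w a ω‖ₑ ^ (2 * n) :=
    ((hmeas c).sub (hmeas a)).enorm.pow_const _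
  have m2 : Measurable fun ω => ‖w b ω - w c ω‖ₑ ^ (2 * n) :=
    ((hmeas b).sub (hmeas c)).enorm.pow_const _
  refine (lintegral_mono hpt).trans ?_
  rw [lintegral_const_mul _ (by fun_prop), lintegral_add_left m1, mul_assoc, add_mul]
  apply mul_le_mul_right
  exact add_le_add (i1.trans (mul_le_mul_right hle _)) (i2.trans (mul_le_mul_right hle _))

/-- second moment of the `(α, 4m)`-Besov integral of
`z(k) = w(k+1) - w(k)`:
`E[ (∬_{0≤s<t≤1} |z(k)_t - z(k)_s|^{4m}/(t-s)^{1+4mα} ds dt)² ]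
  ≤ C · 2^{-k(4m - 8mα - 1)}`. -/
theorem statement11 {Ω : Type*} [MeasurableSpace Ω] (P : Measure Ω) (d : ℕ)
    (w : ℝ → Ω → EuclideanSpace ℝ (Fin d))
    (hw : IsBrownianMotion P d w)
    (m : ℕ) (hm : 1 ≤ m) (α : ℝ) (hα₁ : 1 / 3 < α) (hα₂ : α < 1 / 2)
    (hcond : 0 < 4 * (m : ℝ) - 8 * m * α - 1) :
    ∃ C : ℝ, 0 < C ∧ ∀ k : ℕ,
      ∫⁻ ω,
          (∫⁻ q in {q : ℝ × ℝ | 0 ≤ q.1 ∧ q.1 < q.2 ∧ q.2 ≤ 1},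
            ENNReal.ofReal
              (‖(dyadicApprox (fun u => w u ω) (k + 1) q.2
                    - dyadicApprox (fun u => w u ω) k q.2)
                  - (dyadicApprox (fun u => w u ω) (k + 1) q.1
                    - dyadicApprox (fun u => w u ω) k q.1)‖ ^ (4 * (m : ℝ))
                / (q.2 - q.1) ^ (1 + 4 * (m : ℝ) * α))) ^ 2
          ∂P
        ≤ ENNReal.ofReal (C * (2 : ℝ) ^ (-(k : ℝ) * (4 * (m : ℝ) - 8 * m * α - 1))) := by
  have hm' : (1 : ℝ) ≤ m := by exact_mod_cast hm
  obtain ⟨K, hK, hKb⟩ := zMid_moment P d w hw (4 * m) (by omega)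
  obtain ⟨A, hA, hAb⟩ := U_bound (4 * (m : ℝ)) (4 * m * α) (by nlinarith) (by nlinarith)
  have hmeas := hw.2.1
  refine ⟨A ^ 2 * (K.toReal + 1), by positivity, fun k => ?_⟩
  have h2 : (0 : ℝ) < 2 ^ k := by positivity
  have hU := hAb (2 ^ k) h2
  have hzm : ∀ l : ℤ, Measurable fun ω => ‖zMid (fun u => w u ω) k l‖ₑ ^ (2 * (4 * m)) := by
    intro l
    apply Measurable.pow_const
    apply Measurable.enorm
    unfold zMid
    refine (hmeas _).sub (?_)
    have h1 := hmeas ((l : ℝ) / 2 ^ k)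
    have h2 := hmeas (((l : ℝ) + 1) / 2 ^ k)
    exact (h1.add h2).const_smul (1 / 2 : ℝ)
  calc _ ≤ ∫⁻ ω, ENNReal.ofReal (A * (2 ^ k) ^ (4 * m * α)) ^ 2 *
          ∑ l ∈ Finset.range (2 ^ k), ‖zMid (fun u => w u ω) k (l : ℤ)‖ₑ ^ (2 * (4 * m)) ∂P := by
        apply lintegral_mono
        intro ω
        obtain ⟨l0, hl0, hmax⟩ := Finset.exists_max_image (Finset.range (2 ^ k))
          (fun l : ℕ => ‖zMid (fun u => w u ω) k (l : ℤ)‖) ⟨0, by simp⟩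
        set M := ‖zMid (fun u => w u ω) k (l0 : ℤ)‖ with hM
        have hM0 : 0 ≤ M := norm_nonneg _
        have hI : (∫⁻ q in {q : ℝ × ℝ | 0 ≤ q.1 ∧ q.1 < q.2 ∧ q.2 ≤ 1},
            ENNReal.ofReal
              (‖(dyadicApprox (fun u => w u ω) (k + 1) q.2
                    - dyadicApprox (fun u => w u ω) k q.2)
                  - (dyadicApprox (fun u => w u ω) (k + 1) q.1
                    - dyadicApprox (fun u => w u ω) k q.1)‖ ^ (4 * (m : ℝ))
                / (q.2 - q.1) ^ (1 + 4 * (m : ℝ) * α))) ≤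
            ENNReal.ofReal (M ^ (4 * (m : ℝ))) * ENNReal.ofReal (A * (2 ^ k) ^ (4 * m * α)) := by
          refine le_trans ?_ (mul_le_mul_right hU _)
          rw [← lintegral_const_mul' _ _ ENNReal.ofReal_ne_top]
          apply setLIntegral_mono'
          · apply MeasurableSet.inter (measurableSet_le measurable_const measurable_fst)
            apply MeasurableSet.inter (measurableSet_lt measurable_fst measurable_snd)
            exact measurableSet_le measurable_snd measurable_const
          · rintro q ⟨q1, q2, q3⟩
            have q4 : 0 < q.2 - q.1 := by linarith
            rw [← ENNReal.ofReal_mul (by positivity)]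
            apply ENNReal.ofReal_le_ofReal
            rw [← mul_div_assoc, ← Real.mul_rpow hM0 (by positivity)]
            have := z_bound (fun u => w u ω) k M hM0 hmax q.1 q.2 q1 q2 q3
            gcongr
        have hMe : ENNReal.ofReal (M ^ (4 * (m : ℝ))) ^ 2
            = ‖zMid (fun u => w u ω) k (l0 : ℤ)‖ₑ ^ (2 * (4 * m)) := by
          rw [← ofReal_norm, ← hM, show (4 * (m : ℝ)) = ((4 * m : ℕ) : ℝ) by push_cast; ring,
            Real.rpow_natCast, ENNReal.ofReal_pow hM0, ← pow_mul, mul_comm 2]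
        refine (pow_le_pow_left' hI 2).trans ?_
        rw [mul_pow, mul_comm, hMe]
        apply mul_le_mul_right
        exact Finset.single_le_sum (f := fun l : ℕ => ‖zMid (fun u => w u ω) k (l : ℤ)‖ₑ ^ (2 * (4 * m)))
          (fun _ _ => zero_le) hl0
    _ = ENNReal.ofReal (A * (2 ^ k) ^ (4 * m * α)) ^ 2 *
          ∑ l ∈ Finset.range (2 ^ k), ∫⁻ ω, ‖zMid (fun u => w u ω) k (l : ℤ)‖ₑ ^ (2 * (4 * m)) ∂P := by
        rw [lintegral_const_mul _ (Finset.measurable_sum _ fun (l : ℕ) _ => hzm (l : ℤ)),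
          lintegral_finsetSum _ fun (l : ℕ) _ => hzm (l : ℤ)]
    _ ≤ ENNReal.ofReal (A * (2 ^ k) ^ (4 * m * α)) ^ 2 *
          ∑ l ∈ Finset.range (2 ^ k), K * ENNReal.ofReal (1 / 2 ^ k) ^ (4 * m) :=
        mul_le_mul_right (Finset.sum_le_sum fun l hl => hKb k l hl) _
    _ = ENNReal.ofReal ((A * (2 ^ k) ^ (4 * m * α)) ^ 2 *
          (2 ^ k * (K.toReal * (1 / 2 ^ k) ^ (4 * m)))) := by
        rw [ENNReal.ofReal_mul (p := (A * (2 ^ k) ^ (4 * m * α)) ^ 2) (by positivity),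
          ENNReal.ofReal_mul (p := 2 ^ k) (by positivity),
          ENNReal.ofReal_mul (p := K.toReal) (by positivity), ENNReal.ofReal_toReal hK,
          ENNReal.ofReal_pow (by positivity) 2, ENNReal.ofReal_pow (by positivity) (4 * m)]
        rw [Finset.sum_const, Finset.card_range, nsmul_eq_mul]
        congr 2
        rw [ENNReal.ofReal_pow (by norm_num)]
        simp
    _ ≤ _ := by
        apply ENNReal.ofReal_le_ofReal
        have e : (2 : ℝ) ^ (-(k : ℝ) * (4 * (m : ℝ) - 8 * m * α - 1)) =
            ((2 ^ k) ^ (4 * m * α)) ^ 2 * (2 ^ k * (1 / 2 ^ k) ^ (4 * m)) := by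
          rw [one_div, inv_pow, ← Real.rpow_natCast 2 k, ← Real.rpow_mul (by norm_num),
            ← Real.rpow_natCast _ 2, ← Real.rpow_mul (by norm_num),
            ← Real.rpow_natCast _ (4 * m), ← Real.rpow_mul (by norm_num), ← Real.rpow_neg (by norm_num),
            ← Real.rpow_add (by norm_num), ← Real.rpow_add (by norm_num)]
          congr 1
          push_cast
          ring
        rw [e]
        have hpos : 0 ≤ A ^ 2 * (((2 ^ k) ^ (4 * m * α)) ^ 2 * (2 ^ k * (1 / 2 ^ k) ^ (4 * m))) := by
          positivity
        nlinarith
end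

section
/- Let (w_t)_{t∈[0,1]} be a d-dimensional Brownian motion and let m ∈ ℕ₊ and 1/3 < α < 1/2 satisfy α − 1/(4m) > 1/3 and 4m − 8mα − 1 > 0. Then, almost surely, the sequence (w(k))_{k∈ℕ} of dyadic polygonal approximations of w is a Cauchy sequence with respect to the (α,4m)-Besov norm, i.e. almost surely ‖w(k+1) − w(k)‖_{α,4m-B} is summable over k and (w(k))_k converges in (α,4m)-Besov norm. -/
open MeasureTheory ProbabilityTheory Filter Set
open scoped ENNReal NNReal

theorem da_sub {E : Type*} [NormedAddCommGroup E] [NormedSpace ℝ E] (w : ℝ → E) (k : ℕ) (t : ℝ) :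
    dyadicApprox w k t = w ((⌊t * 2 ^ k⌋ : ℝ) / 2 ^ k)
    + (Int.fract (t * 2 ^ k)) •
      (w (((⌊t * 2 ^ k⌋ : ℝ) + 1) / 2 ^ k) - w ((⌊t * 2 ^ k⌋ : ℝ) / 2 ^ k)) := by
  have h : (2 : ℝ) ^ k * (t - (⌊t * 2 ^ k⌋ : ℝ) / 2 ^ k) = Int.fract (t * 2 ^ k) := by
    rw [Int.fract]; field_simp
  rw [dyadicApprox, h]

theorem fl_bd (k : ℕ) (t : ℝ) (h0 : 0 ≤ t) (h1 : t < 1) :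
    0 ≤ ⌊t * 2 ^ k⌋ ∧ ⌊t * 2 ^ k⌋ < 2 ^ k := by
  have hp : (0 : ℝ) < 2 ^ k := by positivity
  constructor
  · exact Int.floor_nonneg.2 (by positivity)
  · rw [Int.floor_lt]; push_cast; nlinarith

theorem da_bd {E : Type*} [NormedAddCommGroup E] [NormedSpace ℝ E] (w : ℝ → E) (k : ℕ) (D : ℝ)
    (h : ∀ l : ℤ, 0 ≤ l → l < 2 ^ k → ‖w (((l : ℝ) + 1) / 2 ^ k) - w ((l : ℝ) / 2 ^ k)‖ ≤ D)
    (t : ℝ) (h0 : 0 ≤ t) (h1 : t ≤ 1) :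
    ‖dyadicApprox w k t - w ((⌊t * 2 ^ k⌋ : ℝ) / 2 ^ k)‖ ≤ Int.fract (t * 2 ^ k) * D := by
  rw [da_sub, add_sub_cancel_left, norm_smul, Real.norm_of_nonneg (Int.fract_nonneg _)]
  rcases h1.lt_or_eq with h1 | h1
  · obtain ⟨a, b⟩ := fl_bd k t h0 h1
    exact mul_le_mul_of_nonneg_left (h _ a b) (Int.fract_nonneg _)
  · subst h1
    have : Int.fract ((1 : ℝ) * 2 ^ k) = 0 := by
      have := Int.fract_natCast (R := ℝ) (2 ^ k)
      push_cast at this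
      simpa using this
    rw [this]; simp

theorem da_lip {E : Type*} [NormedAddCommGroup E] [NormedSpace ℝ E] (w : ℝ → E) (k : ℕ) (D : ℝ)
    (h : ∀ l : ℤ, 0 ≤ l → l < 2 ^ k → ‖w (((l : ℝ) + 1) / 2 ^ k) - w ((l : ℝ) / 2 ^ k)‖ ≤ D)
    (s t : ℝ) (h0 : 0 ≤ s) (hst : s < t) (h1 : t ≤ 1) (hk : 2 ^ k * (t - s) ≤ 1) :
    ‖dyadicApprox w k t - dyadicApprox w k s‖ ≤ 2 ^ k * (t - s) * D := by
  have hp : (0 : ℝ) < 2 ^ k := by positivity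
  obtain ⟨a, b⟩ := fl_bd k s h0 (by linarith)
  have hD := h _ a b
  have hle : ⌊s * 2 ^ k⌋ ≤ ⌊t * 2 ^ k⌋ := Int.floor_le_floor (by nlinarith)
  have hle2 : ⌊t * 2 ^ k⌋ ≤ ⌊s * 2 ^ k⌋ + 1 := by
    rw [← Int.floor_add_one]; exact Int.floor_le_floor (by nlinarith)
  have e1 := Int.floor_add_fract (s * 2 ^ k)
  have e2 := Int.floor_add_fract (t * 2 ^ k)
  rcases hle.lt_or_eq with hl | hl
  · have hl : ⌊t * 2 ^ k⌋ = ⌊s * 2 ^ k⌋ + 1 := by omega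
    have hb := da_bd w k D h t (by linarith) h1
    have hc : ‖w ((⌊t * 2 ^ k⌋ : ℝ) / 2 ^ k) - dyadicApprox w k s‖
        ≤ (1 - Int.fract (s * 2 ^ k)) * D := by
      have : w ((⌊t * 2 ^ k⌋ : ℝ) / 2 ^ k) - dyadicApprox w k s =
        (1 - Int.fract (s * 2 ^ k)) • (w (((⌊s * 2 ^ k⌋ : ℝ) + 1) / 2 ^ k)
          - w ((⌊s * 2 ^ k⌋ : ℝ) / 2 ^ k)) := by
        rw [da_sub, hl]; push_cast; rw [sub_smul, one_smul]; abel
      have hf : 0 ≤ 1 - Int.fract (s * 2 ^ k) := by linarith [Int.fract_lt_one (s * 2 ^ k)]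
      rw [this, norm_smul, Real.norm_of_nonneg hf]
      exact mul_le_mul_of_nonneg_left hD hf
    have hl' : (⌊t * 2 ^ k⌋ : ℝ) = ⌊s * 2 ^ k⌋ + 1 := by exact_mod_cast hl
    calc _ ≤ _ := norm_sub_le_norm_sub_add_norm_sub _ (w ((⌊t * 2 ^ k⌋ : ℝ) / 2 ^ k)) _
      _ ≤ _ := add_le_add hb hc
      _ = (Int.fract (t * 2 ^ k) + (1 - Int.fract (s * 2 ^ k))) * D := by ring
      _ = _ := by congr 1; linarith
  · have : dyadicApprox w k t - dyadicApprox w k s = (2 ^ k * (t - s)) • 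
        (w (((⌊s * 2 ^ k⌋ : ℝ) + 1) / 2 ^ k) - w ((⌊s * 2 ^ k⌋ : ℝ) / 2 ^ k)) := by
      have h' : 2 ^ k * (t - s) = Int.fract (t * 2 ^ k) - Int.fract (s * 2 ^ k) := by
        rw [Int.fract, Int.fract, hl]; ring
      rw [h', da_sub, da_sub, ← hl, sub_smul]; abel
    have hf : 0 ≤ 2 ^ k * (t - s) := mul_nonneg hp.le (by linarith)
    rw [this, norm_smul, Real.norm_of_nonneg hf]
    exact mul_le_mul_of_nonneg_left hD hf

theorem da_sup {E : Type*} [NormedAddCommGroup E] [NormedSpace ℝ E] (w : ℝ → E) (k : ℕ) (D : ℝ)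
    (hD : 0 ≤ D)
    (h : ∀ l : ℤ, 0 ≤ l → l < 2 ^ k → ‖w (((l : ℝ) + 1) / 2 ^ k) - w ((l : ℝ) / 2 ^ k)‖ ≤ D)
    (h' : ∀ l : ℤ, 0 ≤ l → l < 2 ^ (k + 1) →
      ‖w (((l : ℝ) + 1) / 2 ^ (k + 1)) - w ((l : ℝ) / 2 ^ (k + 1))‖ ≤ D)
    (t : ℝ) (h0 : 0 ≤ t) (h1 : t ≤ 1) :
    ‖dyadicApprox w (k + 1) t - dyadicApprox w k t‖ ≤ 3 * D := by
  have b1 := da_bd w k D h t h0 h1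
  have b2 := da_bd w (k + 1) D h' t h0 h1
  have f1 := (Int.fract_lt_one (t * 2 ^ k)).le
  have f2 := (Int.fract_lt_one (t * 2 ^ (k + 1))).le
  have b1' := b1.trans (mul_le_of_le_one_left hD f1)
  have b2' := b2.trans (mul_le_of_le_one_left hD f2)
  have hp : (0 : ℝ) < 2 ^ k := by positivity
  have g1 : 2 * ⌊t * 2 ^ k⌋ ≤ ⌊t * 2 ^ (k + 1)⌋ := by
    rw [Int.le_floor]; push_cast; rw [pow_succ]; linarith [Int.floor_le (t * 2 ^ k)]
  have g2 : ⌊t * 2 ^ (k + 1)⌋ < 2 * ⌊t * 2 ^ k⌋ + 2 := by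
    rw [Int.floor_lt]; push_cast; rw [pow_succ]; linarith [Int.lt_floor_add_one (t * 2 ^ k)]
  have g3 : ⌊t * 2 ^ (k + 1)⌋ ≤ 2 ^ (k + 1) := by
    have : (⌊t * 2 ^ (k + 1)⌋ : ℝ) ≤ 2 ^ (k + 1) := by
      refine (Int.floor_le _).trans ?_
      have : (0 : ℝ) < 2 ^ (k + 1) := by positivity
      nlinarith
    exact_mod_cast this
  have g4 : 0 ≤ ⌊t * 2 ^ k⌋ := Int.floor_nonneg.2 (by positivity)
  have e : (⌊t * 2 ^ k⌋ : ℝ) / 2 ^ k = ((2 * ⌊t * 2 ^ k⌋ : ℤ) : ℝ) / 2 ^ (k + 1) := by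
    push_cast; rw [pow_succ]; field_simp
  have b3 : ‖w ((⌊t * 2 ^ (k + 1)⌋ : ℝ) / 2 ^ (k + 1)) - w ((⌊t * 2 ^ k⌋ : ℝ) / 2 ^ k)‖ ≤ D := by
    rw [e]
    rcases g1.lt_or_eq with hl | hl
    · have hl : ⌊t * 2 ^ (k + 1)⌋ = 2 * ⌊t * 2 ^ k⌋ + 1 := by omega
      have := h' (2 * ⌊t * 2 ^ k⌋) (by omega) (by omega)
      rw [hl]; push_cast at this ⊢; exact this
    · rw [hl]; simpa using hD
  rw [norm_sub_rev] at b1'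
  calc _ = ‖(dyadicApprox w (k + 1) t - w ((⌊t * 2 ^ (k + 1)⌋ : ℝ) / 2 ^ (k + 1)))
      + (w ((⌊t * 2 ^ (k + 1)⌋ : ℝ) / 2 ^ (k + 1)) - w ((⌊t * 2 ^ k⌋ : ℝ) / 2 ^ k))
      + (w ((⌊t * 2 ^ k⌋ : ℝ) / 2 ^ k) - dyadicApprox w k t)‖ := by congr 1; abel
    _ ≤ _ := norm_add₃_le
    _ ≤ 3 * D := by linarith

theorem da_hol {E : Type*} [NormedAddCommGroup E] [NormedSpace ℝ E] (w : ℝ → E) (k : ℕ) (D : ℝ)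
    (hD : 0 ≤ D)
    (h : ∀ l : ℤ, 0 ≤ l → l < 2 ^ k → ‖w (((l : ℝ) + 1) / 2 ^ k) - w ((l : ℝ) / 2 ^ k)‖ ≤ D)
    (h' : ∀ l : ℤ, 0 ≤ l → l < 2 ^ (k + 1) →
      ‖w (((l : ℝ) + 1) / 2 ^ (k + 1)) - w ((l : ℝ) / 2 ^ (k + 1))‖ ≤ D)
    (θ : ℝ) (hθ : 0 < θ) (hθ1 : θ < 1)
    (s t : ℝ) (h0 : 0 ≤ s) (hst : s < t) (h1 : t ≤ 1) :
    ‖(dyadicApprox w (k + 1) t - dyadicApprox w k t) -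
      (dyadicApprox w (k + 1) s - dyadicApprox w k s)‖ ≤ 6 * D * (2 ^ (k + 1) * (t - s)) ^ θ := by
  have hp : (0 : ℝ) < 2 ^ k := by positivity
  have hu : 0 < 2 ^ (k + 1) * (t - s) := mul_pos (by positivity) (by linarith)
  rcases le_total (2 ^ (k + 1) * (t - s)) 1 with hc | hc
  · have l1 := da_lip w (k + 1) D h' s t h0 hst h1 hc
    have l2 := da_lip w k D h s t h0 hst h1 (by rw [pow_succ] at hc; nlinarith)
    have hr : 2 ^ (k + 1) * (t - s) ≤ (2 ^ (k + 1) * (t - s)) ^ θ := by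
      conv_lhs => rw [← Real.rpow_one (2 ^ (k + 1) * (t - s))]
      exact Real.rpow_le_rpow_of_exponent_ge hu hc hθ1.le
    rw [sub_sub_sub_comm]
    refine (norm_sub_le _ _).trans ((add_le_add l1 l2).trans ?_)
    have : 2 ^ k * (t - s) * D ≤ 2 ^ (k + 1) * (t - s) * D := by
      rw [pow_succ]
      have : 0 ≤ 2 ^ k * (t - s) * D := mul_nonneg (mul_nonneg hp.le (by linarith)) hD
      linarith
    have h3 := mul_le_mul_of_nonneg_left hr hD
    have h4 : 0 ≤ D * (2 ^ (k + 1) * (t - s)) := mul_nonneg hD hu.le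
    nlinarith
  · have l1 := da_sup w k D hD h h' t (by linarith) h1
    have l2 := da_sup w k D hD h h' s h0 (by linarith)
    have hr : 1 ≤ (2 ^ (k + 1) * (t - s)) ^ θ := Real.one_le_rpow hc hθ.le
    refine (norm_sub_le _ _).trans ((add_le_add l1 l2).trans ?_)
    nlinarith

theorem besov_lem (α p θ : ℝ) (hp : 0 < p) (hθ : α < θ) :
    ∃ J : ℝ≥0∞, J ≠ ∞ ∧ ∀ {E : Type} [NormedAddCommGroup E] (x : ℝ → E) (K : ℝ), 0 ≤ K →
      (∀ s t, 0 ≤ s → s < t → t ≤ 1 → ‖x t - x s‖ ≤ K * (t - s) ^ θ) →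
      besovNormE α p x ≤ ENNReal.ofReal K * J := by
  set T : Set (ℝ × ℝ) := {q : ℝ × ℝ | 0 ≤ q.1 ∧ q.1 < q.2 ∧ q.2 ≤ 1} with hT
  have hTm : MeasurableSet T := by
    apply MeasurableSet.inter
    · exact measurableSet_le measurable_const measurable_fst
    apply MeasurableSet.inter
    · exact measurableSet_lt measurable_fst measurable_snd
    · exact measurableSet_le measurable_snd measurable_const
  set γ := p * (θ - α) with hγ
  have hγ0 : 0 < γ := mul_pos hp (by linarith)
  set I := ∫⁻ q in T, ENNReal.ofReal ((q.2 - q.1) ^ (γ - 1)) with hI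
  have hfin : ∫⁻ u in Ioc (0 : ℝ) 1, ENNReal.ofReal (u ^ (γ - 1)) ≠ ∞ := by
    have := (intervalIntegral.intervalIntegrable_rpow' (a := 0) (b := 1) (r := γ - 1) (by linarith))
    rw [intervalIntegrable_iff_integrableOn_Ioc_of_le zero_le_one] at this
    exact (Integrable.lintegral_lt_top this).ne
  have hIf : I ≠ ∞ := by
    have hle : I ≤ ∫⁻ s in Icc (0 : ℝ) 1, ∫⁻ u in Ioc (0 : ℝ) 1, ENNReal.ofReal (u ^ (γ - 1)) := by
      rw [hI, ← lintegral_indicator hTm, Measure.volume_eq_prod, lintegral_prod,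
        ← lintegral_indicator measurableSet_Icc]
      · apply lintegral_mono
        intro s
        by_cases hs : s ∈ Icc (0 : ℝ) 1
        · rw [Set.indicator_of_mem hs, ← lintegral_indicator measurableSet_Ioc]
          dsimp only
          rw [← lintegral_sub_right_eq_self (μ := volume) (fun u => (Ioc (0 : ℝ) 1).indicator
            (fun u => ENNReal.ofReal (u ^ (γ - 1))) u) s]
          apply lintegral_mono
          intro t
          by_cases ht : (s, t) ∈ T
          · have : t - s ∈ Ioc (0 : ℝ) 1 := by
              simp only [hT, mem_ofPred_eq] at ht
              constructor <;> linarith [ht.1, ht.2.1, ht.2.2]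
            dsimp only
            rw [Set.indicator_of_mem ht, Set.indicator_of_mem this]
          · dsimp only
            rw [Set.indicator_of_notMem ht]; exact zero_le
        · rw [Set.indicator_of_notMem hs]
          have : ∀ t, (s, t) ∉ T := by
            intro t ht
            simp only [hT, mem_ofPred_eq] at ht
            exact hs ⟨ht.1, by linarith [ht.2.1, ht.2.2]⟩
          simp [Set.indicator_of_notMem, this]
      · apply Measurable.aemeasurable
        exact Measurable.indicator (by fun_prop) hTm
    refine ne_top_of_le_ne_top ?_ hle
    rw [lintegral_const]
    simp [hfin]
  refine ⟨I ^ (1 / p), ENNReal.rpow_ne_top_of_nonneg (by positivity) hIf, ?_⟩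
  intro E _ x K hK hx
  have : ∫⁻ q in T, ENNReal.ofReal (‖x q.2 - x q.1‖ ^ p / (q.2 - q.1) ^ (1 + p * α))
      ≤ ENNReal.ofReal K ^ p * I := by
    rw [hI, ← lintegral_const_mul' _ _ (ENNReal.rpow_ne_top_of_nonneg hp.le ENNReal.ofReal_ne_top)]
    apply setLIntegral_mono' hTm
    intro q hq
    obtain ⟨q1, q2, q3⟩ := hq
    have hd : 0 < q.2 - q.1 := by linarith
    rw [ENNReal.ofReal_rpow_of_nonneg hK hp.le, ← ENNReal.ofReal_mul (by positivity)]
    apply ENNReal.ofReal_le_ofReal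
    rw [div_le_iff₀ (by positivity), mul_assoc, ← Real.rpow_add hd]
    calc _ ≤ (K * (q.2 - q.1) ^ θ) ^ p := by
          apply Real.rpow_le_rpow (norm_nonneg _) (hx _ _ q1 q2 q3) hp.le
      _ = _ := by
          rw [Real.mul_rpow hK (by positivity), ← Real.rpow_mul hd.le]
          congr 2; rw [hγ]; ring
  rw [besovNormE]
  refine (ENNReal.rpow_le_rpow this (by positivity)).trans ?_
  rw [ENNReal.mul_rpow_of_nonneg _ _ (by positivity), ← ENNReal.rpow_mul, mul_one_div_cancel hp.ne',
    ENNReal.rpow_one]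

theorem gauss_mom {Ω : Type*} [MeasurableSpace Ω] (P : Measure Ω) (X : Ω → ℝ) (hX : Measurable X)
    (σ : ℝ) (v : ℝ≥0) (hv : (v : ℝ) = σ ^ 2) (h : P.map X = gaussianReal 0 v) (c : ℝ) (q : ℕ) :
    ∫⁻ ω, ‖c * X ω‖ₑ ^ q ∂P = ‖c * σ‖ₑ ^ q * ∫⁻ x, ‖x‖ₑ ^ q ∂(gaussianReal 0 1) := by
  have e : gaussianReal 0 v = (gaussianReal 0 1).map (fun x => σ * x) := by
    rw [gaussianReal_map_const_mul]
    congr 1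
    · simp
    · ext; simp [hv]
  have e1 : ∫⁻ ω, ‖c * X ω‖ₑ ^ q ∂P = ∫⁻ x, ‖c * x‖ₑ ^ q ∂(P.map X) := by
    rw [lintegral_map (by fun_prop) hX]
  rw [e1, h, e, lintegral_map (by fun_prop) (by fun_prop),
    ← lintegral_const_mul _ (by fun_prop)]
  congr 1
  ext x
  rw [← mul_assoc, enorm_mul, mul_pow]

theorem gauss_fin (q : ℕ) : ∫⁻ x, ‖x‖ₑ ^ q ∂(gaussianReal 0 1) ≠ ∞ := by
  by_cases hq : q = 0
  · subst hq; simp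
  have := (memLp_id_gaussianReal (μ := 0) (v := 1) (q : ℝ≥0)).eLpNorm_lt_top
  have h2 := lintegral_rpow_enorm_lt_top_of_eLpNorm_lt_top (by simpa using hq) (by simp) this
  simpa using h2.ne

theorem bm_bound {Ω : Type*} [MeasurableSpace Ω] (P : Measure Ω) (d : ℕ)
    (w : ℝ → Ω → EuclideanSpace ℝ (Fin d))
    (hw : IsBrownianMotion P d w) (β : ℝ) (hβ : β < 1 / 2) :
    ∀ᵐ ω ∂P, ∃ C : ℝ, 0 ≤ C ∧ ∀ (k : ℕ) (l : ℤ), 0 ≤ l → l < 2 ^ k →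
      ‖w (((l : ℝ) + 1) / 2 ^ k) ω - w ((l : ℝ) / 2 ^ k) ω‖ ≤ C * ((2 : ℝ) ^ (-β)) ^ k := by
  obtain ⟨hP, hmeas, -, -, -, hg⟩ := hw
  obtain ⟨q, hq⟩ := exists_nat_gt (1 / (1 / 2 - β))
  have hq1 : 1 < q * (1 / 2 - β) := by
    rwa [div_lt_iff₀ (by linarith)] at hq
  have hq0 : q ≠ 0 := by
    rintro rfl; norm_num at hq1
  have hmi : ∀ t (i : Fin d), Measurable fun ω => w t ω i := fun t i => by
    have := hmeas t
    fun_prop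
  have key : ∀ i : Fin d, ∀ᵐ ω ∂P, ∃ C : ℝ, 0 ≤ C ∧ ∀ (k : ℕ) (l : ℕ), l < 2 ^ k →
      |(w (((l : ℝ) + 1) / 2 ^ k) ω - w ((l : ℝ) / 2 ^ k) ω) i| ≤ C * ((2 : ℝ) ^ (-β)) ^ k := by
    intro i
    set b : ℝ := 2 ^ β with hb
    have hb0 : 0 < b := by positivity
    set F : ℕ → ℕ → Ω → ℝ≥0∞ := fun k l ω =>
      ‖b ^ k * (w (((l : ℝ) + 1) / 2 ^ k) ω - w ((l : ℝ) / 2 ^ k) ω) i‖ₑ ^ q with hF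
    have hFm : ∀ k l, Measurable (F k l) := by
      intro k l
      have := hmi (((l : ℝ) + 1) / 2 ^ k) i
      have := hmi ((l : ℝ) / 2 ^ k) i
      simp only [hF, PiLp.sub_apply]
      fun_prop
    set S : Ω → ℝ≥0∞ := fun ω => ∑' k, ∑ l ∈ Finset.range (2 ^ k), F k l ω with hS
    have hSm : Measurable S := by
      apply Measurable.ennreal_tsum
      intro k
      exact Finset.measurable_sum _ (fun l _ => hFm k l)
    set c := ∫⁻ x, ‖x‖ₑ ^ q ∂(gaussianReal 0 1) with hc
    have hcf : c ≠ ∞ := gauss_fin q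
    set σ : ℝ := 2 ^ (-(1 / 2) : ℝ) with hσ
    have hσ0 : 0 < σ := by positivity
    have hσ2 : σ ^ 2 = 1 / 2 := by
      rw [hσ, ← Real.rpow_natCast, ← Real.rpow_mul (by norm_num)]
      norm_num [Real.rpow_neg_one]
    have hFi : ∀ k, ∀ l ∈ Finset.range (2 ^ k), ∫⁻ ω, F k l ω ∂P = ‖b ^ k * σ ^ k‖ₑ ^ q * c := by
      intro k l hl
      have hl : l + 1 ≤ 2 ^ k := Finset.mem_range.1 hl
      have hl' : (l : ℝ) + 1 ≤ 2 ^ k := by exact_mod_cast hl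
      have hg' := (hg ((l : ℝ) / 2 ^ k) (((l : ℝ) + 1) / 2 ^ k) (by positivity)
        (by gcongr; linarith) (by rw [div_le_one (by positivity)]; exact hl')).2 i
      refine gauss_mom P _ ?_ (σ ^ k) _ ?_ hg' _ q
      · have := hmi (((l : ℝ) + 1) / 2 ^ k) i
        have := hmi ((l : ℝ) / 2 ^ k) i
        simp only [PiLp.sub_apply]
        fun_prop
      · rw [← pow_mul, mul_comm k 2, pow_mul, hσ2, Real.coe_toNNReal]
        · rw [one_div_pow]; ring
        · rw [← sub_div]; simp
    set r : ℝ≥0∞ := 2 * ‖b * σ‖ₑ ^ q with hr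
    have hr1 : r < 1 := by
      have hx : ((2 : ℝ) * (b * σ) ^ q) < 1 := by
        rw [hb, hσ, ← Real.rpow_add (by norm_num), ← Real.rpow_mul_natCast (by norm_num)]
        nth_rewrite 1 [← Real.rpow_one 2]
        rw [← Real.rpow_add (by norm_num)]
        apply Real.rpow_lt_one_of_one_lt_of_neg (by norm_num)
        nlinarith
      have : r = ENNReal.ofReal (2 * (b * σ) ^ q) := by
        rw [hr, ENNReal.ofReal_mul (by norm_num), ENNReal.ofReal_pow (by positivity),
          Real.enorm_of_nonneg (by positivity)]
        norm_num
      rw [this]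
      exact ENNReal.ofReal_lt_one.2 hx
    have hSi : ∫⁻ ω, S ω ∂P ≠ ∞ := by
      have : ∫⁻ ω, S ω ∂P = ∑' k, r ^ k * c := by
        rw [hS, lintegral_tsum]
        · congr 1; ext k
          rw [lintegral_finsetSum _ (fun l _ => hFm k l), Finset.sum_congr rfl (hFi k)]
          rw [Finset.sum_const, Finset.card_range, hr, ← mul_pow, enorm_pow, nsmul_eq_mul, mul_pow]
          push_cast
          ring
        · intro k
          exact (Finset.measurable_sum _ (fun l _ => hFm k l)).aemeasurable
      rw [this, ENNReal.tsum_mul_right, ENNReal.tsum_geometric]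
      refine ENNReal.mul_ne_top ?_ hcf
      rw [ENNReal.inv_ne_top]
      exact (tsub_pos_of_lt hr1).ne'
    filter_upwards [ae_lt_top hSm hSi] with ω hω
    refine ⟨((S ω).toReal) ^ (1 / (q : ℝ)), by positivity, ?_⟩
    intro k l hl
    have h1 : F k l ω ≤ S ω :=
      (Finset.single_le_sum (f := fun l => F k l ω) (fun _ _ => zero_le)
        (Finset.mem_range.2 hl)).trans
        (ENNReal.le_tsum (f := fun k => ∑ l ∈ Finset.range (2 ^ k), F k l ω) k)
    have h2 := ENNReal.toReal_mono hω.ne h1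
    simp only [hF, ENNReal.toReal_pow, toReal_enorm] at h2
    set x := (w (((l : ℝ) + 1) / 2 ^ k) ω - w ((l : ℝ) / 2 ^ k) ω) i with hx
    have h3 : ‖b ^ k * x‖ ≤ (S ω).toReal ^ (1 / (q : ℝ)) := by
      have := Real.rpow_le_rpow (by positivity) h2 (by positivity : 0 ≤ 1 / (q : ℝ))
      rwa [one_div, Real.pow_rpow_inv_natCast (norm_nonneg _) hq0, ← one_div] at this
    rw [norm_mul, Real.norm_of_nonneg (by positivity : 0 ≤ b ^ k), Real.norm_eq_abs] at h3
    rw [Real.rpow_neg (by norm_num), ← hb, inv_pow, ← div_eq_mul_inv, le_div_iff₀ (by positivity)]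
    linarith
  filter_upwards [ae_all_iff.2 key] with ω hω
  choose C hC0 hC using hω
  refine ⟨∑ i, C i, Finset.sum_nonneg (fun i _ => hC0 i), ?_⟩
  intro k l hl0 hl
  lift l to ℕ using hl0
  have hl : l < 2 ^ k := by exact_mod_cast hl
  rw [Finset.sum_mul]
  refine le_trans ?_ (Finset.sum_le_sum (fun i _ => hC i k l hl))
  set x := w (((l : ℝ) + 1) / 2 ^ k) ω - w ((l : ℝ) / 2 ^ k) ω
  have : ‖x‖ ≤ ∑ i, |x i| := by
    rw [EuclideanSpace.norm_eq]
    apply Real.sqrt_le_left (by positivity) |>.2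
    simp only [Real.norm_eq_abs]
    exact Finset.sum_sq_le_sq_sum_of_nonneg (fun i _ => abs_nonneg _)
  simpa only [Int.cast_natCast] using this

/-- almost surely, the dyadic polygonal approximations `(w(k))_k`
of a `d`-dimensional Brownian motion form a Cauchy sequence in the
`(α, 4m)`-Besov norm: a.s. the Besov norms of the increments `w(k+1) - w(k)`
are summable over `k` and the sequence converges (is Cauchy) in Besov norm. -/
theorem statement15 {Ω : Type*} [MeasurableSpace Ω] (P : Measure Ω) (d : ℕ)
    (w : ℝ → Ω → EuclideanSpace ℝ (Fin d))
    (hw : IsBrownianMotion P d w)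
    (m : ℕ) (hm : 1 ≤ m) (α : ℝ) (hα₁ : 1 / 3 < α) (hα₂ : α < 1 / 2)
    (hαm : 1 / 3 < α - 1 / (4 * (m : ℝ)))
    (hcond : 0 < 4 * (m : ℝ) - 8 * m * α - 1) :
    ∀ᵐ ω ∂P,
      (Summable fun k : ℕ =>
        (besovNormE α (4 * (m : ℝ))
          (fun t => dyadicApprox (fun u => w u ω) (k + 1) t
            - dyadicApprox (fun u => w u ω) k t)).toReal) ∧
      ∀ ε : ℝ, 0 < ε → ∃ N : ℕ, ∀ k ≥ N, ∀ l ≥ N,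
        besovNormE α (4 * (m : ℝ))
            (fun t => dyadicApprox (fun u => w u ω) k t
              - dyadicApprox (fun u => w u ω) l t)
          < ENNReal.ofReal ε := by
  set p : ℝ := 4 * (m : ℝ) with hp
  have hm' : (1 : ℝ) ≤ m := by exact_mod_cast hm
  have hp0 : 0 < p := by rw [hp]; linarith
  obtain ⟨θ, hθ1, hθ2⟩ := exists_between hα₂
  obtain ⟨β, hβ1, hβ2⟩ := exists_between hθ2
  obtain ⟨J, hJ, hB⟩ := besov_lem α p θ hp0 hθ1
  filter_upwards [bm_bound P d w hw β hβ2] with ω ⟨C, hC0, hC⟩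
  set x : ℝ → EuclideanSpace ℝ (Fin d) := fun u => w u ω with hx
  set ρ : ℝ := 2 ^ (θ - β) with hρ
  have hρ0 : 0 < ρ := by positivity
  have hρ1 : ρ < 1 := Real.rpow_lt_one_of_one_lt_of_neg (by norm_num) (by linarith)
  have hb1 : (2 : ℝ) ^ (-β) ≤ 1 := Real.rpow_le_one_of_one_le_of_nonpos (by norm_num) (by linarith)
  set A : ℝ := 6 * C * 2 ^ θ with hA
  have hA0 : 0 ≤ A := by positivity
  have hol : ∀ (k : ℕ) (s t : ℝ), 0 ≤ s → s < t → t ≤ 1 →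
      ‖(dyadicApprox x (k + 1) t - dyadicApprox x k t) -
      (dyadicApprox x (k + 1) s - dyadicApprox x k s)‖ ≤ A * ρ ^ k * (t - s) ^ θ := by
    intro k s t h0 hst h1
    have := da_hol x k (C * ((2 : ℝ) ^ (-β)) ^ k) (by positivity) (hC k)
      (fun l a b => (hC (k + 1) l a b).trans (by
        apply mul_le_mul_of_nonneg_left _ hC0
        exact pow_le_pow_of_le_one (by positivity) hb1 (by omega))) θ (by linarith) (by linarith)
        s t h0 hst h1
    refine this.trans (le_of_eq ?_)
    rw [Real.mul_rpow (by positivity) (by linarith), hA, hρ, ← Real.rpow_natCast (2 ^ (θ - β)),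
      ← Real.rpow_natCast (2 ^ (-β)), ← Real.rpow_natCast 2, ← Real.rpow_mul (by norm_num),
      ← Real.rpow_mul (by norm_num), ← Real.rpow_mul (by norm_num)]
    have e : (2 : ℝ) ^ (-β * k) * 2 ^ (((k + 1 : ℕ) : ℝ) * θ) = 2 ^ θ * 2 ^ ((θ - β) * k) := by
      rw [← Real.rpow_add (by norm_num), ← Real.rpow_add (by norm_num)]
      congr 1; push_cast; ring
    linear_combination 6 * C * (t - s) ^ θ * e
  have hol2 : ∀ (n k : ℕ) (s t : ℝ), 0 ≤ s → s < t → t ≤ 1 →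
      ‖(dyadicApprox x (k + n) t - dyadicApprox x k t) -
      (dyadicApprox x (k + n) s - dyadicApprox x k s)‖
        ≤ A * (∑ j ∈ Finset.range n, ρ ^ (k + j)) * (t - s) ^ θ := by
    intro n k s t h0 hst h1
    induction n with
    | zero => simp
    | succ n ih =>
      rw [Finset.sum_range_succ, mul_add, add_mul]
      have := hol (k + n) s t h0 hst h1
      refine le_trans (le_of_eq ?_) ((norm_add_le _ _).trans (add_le_add ih this))
      congr 1
      rw [← add_assoc]
      abel
  have hsum : ∀ n k, ∑ j ∈ Finset.range n, ρ ^ (k + j) ≤ ρ ^ k * (1 - ρ)⁻¹ := by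
    intro n k
    simp only [pow_add, ← Finset.mul_sum]
    apply mul_le_mul_of_nonneg_left _ (by positivity)
    rw [← tsum_geometric_of_lt_one hρ0.le hρ1]
    exact (summable_geometric_of_lt_one hρ0.le hρ1).sum_le_tsum _ (fun _ _ => by positivity)
  set A' := A * (1 - ρ)⁻¹ with hA'
  have hinv : 0 < (1 - ρ)⁻¹ := inv_pos.2 (by linarith)
  have hA'0 : 0 ≤ A' := by positivity
  have hol3 : ∀ (n k : ℕ) (s t : ℝ), 0 ≤ s → s < t → t ≤ 1 →
      ‖(dyadicApprox x (k + n) t - dyadicApprox x k t) -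
      (dyadicApprox x (k + n) s - dyadicApprox x k s)‖ ≤ A' * ρ ^ k * (t - s) ^ θ := by
    intro n k s t h0 hst h1
    refine (hol2 n k s t h0 hst h1).trans ?_
    have : 0 ≤ (t - s) ^ θ := Real.rpow_nonneg (by linarith) _
    apply mul_le_mul_of_nonneg_right _ this
    refine (mul_le_mul_of_nonneg_left (hsum n k) hA0).trans (le_of_eq ?_)
    rw [hA']; ring
  constructor
  · refine Summable.of_nonneg_of_le (fun _ => ENNReal.toReal_nonneg) (fun k => ?_)
      (((summable_geometric_of_lt_one hρ0.le hρ1).mul_left A).mul_right J.toReal)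
    have h := hB (fun t => dyadicApprox x (k + 1) t - dyadicApprox x k t) (A * ρ ^ k)
      (by positivity) (hol k)
    have h2 := ENNReal.toReal_mono (ENNReal.mul_ne_top ENNReal.ofReal_ne_top hJ) h
    rwa [ENNReal.toReal_mul, ENNReal.toReal_ofReal (by positivity)] at h2
  · intro ε hε
    have hlim : Tendsto (fun k : ℕ => A' * ρ ^ k * J.toReal) atTop (nhds 0) := by
      have := ((tendsto_pow_atTop_nhds_zero_of_lt_one hρ0.le hρ1).const_mul A').mul_const J.toReal
      simpa using this
    obtain ⟨N, hN⟩ := eventually_atTop.1 (hlim.eventually (gt_mem_nhds hε))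
    have fin : ∀ k ≥ N, ENNReal.ofReal (A' * ρ ^ k) * J < ENNReal.ofReal ε := by
      intro k hk
      have := hN k hk
      rw [← ENNReal.ofReal_toReal hJ, ← ENNReal.ofReal_mul (by positivity)]
      exact (ENNReal.ofReal_lt_ofReal_iff hε).2 this
    refine ⟨N, fun k hk l hl => ?_⟩
    rcases le_total k l with hkl | hkl
    · obtain ⟨n, rfl⟩ := Nat.exists_eq_add_of_le hkl
      refine (hB _ (A' * ρ ^ k) (by positivity) ?_).trans_lt (fin k hk)
      intro s t h0 hst h1
      refine le_trans (le_of_eq ?_) (hol3 n k s t h0 hst h1)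
      rw [← norm_neg]
      congr 1; abel
    · obtain ⟨n, rfl⟩ := Nat.exists_eq_add_of_le hkl
      exact (hB _ (A' * ρ ^ l) (by positivity) (hol3 n l)).trans_lt (fin l hl)
end

section
/- Let (w_t)_{t∈[0,1]} be a d-dimensional Brownian motion and let m ∈ ℕ₊ and 1/3 < α < 1/2 satisfy α − 1/(4m) > 1/3 and 4m − 8mα − 1 > 0. For each k ∈ ℕ let W(k)²_{s,t} = J[w(k), w(k)]_{s,t} be the second-level iterated integral of the k-th dyadic polygonal approximation w(k). Then, almost surely, the sequence of two-parameter functions (W(k)²)_{k∈ℕ} is a Cauchy sequence with respect to the (2α, 2m)-Besov norm ‖Y‖_{2α,2m-B} = (∬_{0≤s<t≤1} |Y_{s,t}|^{2m}/(t−s)^{1+4mα} ds dt)^{1/(2m)}. -/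
open MeasureTheory ProbabilityTheory Filter Set
open scoped ENNReal NNReal

/-- Tensor product `ξ ⊗ η` of two vectors of `ℝ^d`, realized as the element
`(i, j) ↦ ξ i * η j` of `EuclideanSpace ℝ (Fin d × Fin d)`, whose norm is the
Hilbert–Schmidt norm (so `|ξ ⊗ η| = |ξ| |η|`). -/
noncomputable def tensor {d : ℕ} (ξ η : EuclideanSpace ℝ (Fin d)) :
    EuclideanSpace ℝ (Fin d × Fin d) :=
  (WithLp.equiv 2 (Fin d × Fin d → ℝ)).symm fun p => ξ p.1 * η p.2

/-- The iterated integral `J[x,y]_{s,t} = ∫_s^t (x_u - x_s) ⊗ y'(u) du`, where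
`y'` is the (almost-everywhere defined) derivative of `y`. -/
noncomputable def Jint {d : ℕ} (x y : ℝ → EuclideanSpace ℝ (Fin d)) (s t : ℝ) :
    EuclideanSpace ℝ (Fin d × Fin d) :=
  ∫ u in s..t, tensor (x u - x s) (deriv y u)
/-- The `(2α, 2m)`-Besov norm of a two-parameter function `Y` on the triangle
`{0 ≤ s ≤ t ≤ 1}`:
`‖Y‖_{2α,2m-B} = (∬_{0≤s<t≤1} |Y_{s,t}|^{2m}/(t-s)^{1+4mα} ds dt)^{1/(2m)}`. -/
noncomputable def besov2NormE {F : Type*} [NormedAddCommGroup F] (α m : ℝ)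
    (Y : ℝ → ℝ → F) : ℝ≥0∞ :=
  (∫⁻ q in {q : ℝ × ℝ | 0 ≤ q.1 ∧ q.1 < q.2 ∧ q.2 ≤ 1},
      ENNReal.ofReal (‖Y q.1 q.2‖ ^ (2 * m) / (q.2 - q.1) ^ (1 + 4 * m * α)))
    ^ (1 / (2 * m))


namespace BM16

/-- lattice interpolation -/
noncomputable def FF (a : ℤ → ℝ) (v : ℝ) : ℝ := a ⌊v⌋ + (v - ⌊v⌋) * (a (⌊v⌋ + 1) - a ⌊v⌋)
/-- lattice slope -/
noncomputable def GG (a : ℤ → ℝ) (v : ℝ) : ℝ := a (⌊v⌋ + 1) - a ⌊v⌋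
/-- lattice iterated integral -/
noncomputable def TT (a b : ℤ → ℝ) (σ τ : ℝ) : ℝ := ∫ v in σ..τ, (FF a v - FF a σ) * GG b v

lemma FF_int (a : ℤ → ℝ) (n : ℤ) : FF a n = a n := by simp [FF]

lemma FF_cont (a : ℤ → ℝ) : Continuous (FF a) := by
  rw [continuous_iff_continuousAt]
  intro v0
  set n := ⌊v0⌋ with hn
  have h1 : (n : ℝ) ≤ v0 := Int.floor_le v0
  have h2 : v0 < n + 1 := Int.lt_floor_add_one v0
  have he : (fun v : ℝ => a n + min (v - n) 0 * (a n - a (n-1)) + max (v - n) 0 * (a (n+1) - a n))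
      =ᶠ[nhds v0] FF a := by
    filter_upwards [Ioo_mem_nhds (show (n : ℝ) - 1 < v0 by linarith) h2] with v hv
    by_cases h : (n : ℝ) ≤ v
    · have : ⌊v⌋ = n := by rw [Int.floor_eq_iff]; exact ⟨h, hv.2⟩
      rw [FF, this, min_eq_right (by linarith), max_eq_left (by linarith)]; ring
    · push Not at h
      have : ⌊v⌋ = n - 1 := by
        rw [Int.floor_eq_iff]; push_cast; exact ⟨hv.1.le, by linarith⟩
      rw [FF, this, min_eq_left (by linarith), max_eq_right (by linarith)]
      simp only [sub_add_cancel]; push_cast; ring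
  refine ContinuousAt.congr ?_ he
  fun_prop

lemma GG_meas (a : ℤ → ℝ) : Measurable (GG a) := by
  have : Measurable (fun n : ℤ => a (n+1) - a n) := measurable_of_countable _
  exact this.comp Int.measurable_floor

lemma GG_int (a : ℤ → ℝ) (σ τ : ℝ) : IntervalIntegrable (GG a) volume σ τ := by
  have hfin : (Set.Icc ⌊min σ τ⌋ ⌊max σ τ⌋).Finite := Set.finite_Icc _ _
  obtain ⟨M, hM⟩ := (hfin.image (fun n => ‖a (n+1) - a n‖)).bddAbove
  refine IntervalIntegrable.mono_fun' (g := fun _ => M) (by simp) (GG_meas a).aestronglyMeasurable ?_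
  refine (ae_restrict_iff' measurableSet_uIoc).2 (ae_of_all _ fun v hv => ?_)
  apply hM
  refine ⟨⌊v⌋, ⟨Int.floor_mono hv.1.le, Int.floor_mono hv.2⟩, rfl⟩

lemma prod_int (a b : ℤ → ℝ) (c σ τ : ℝ) :
    IntervalIntegrable (fun v => (FF a v - c) * GG b v) volume σ τ :=
  (GG_int b σ τ).continuousOn_mul ((FF_cont a).sub continuous_const).continuousOn

lemma FF_deriv (a : ℤ → ℝ) (v : ℝ) (hv : v ∉ Set.range ((↑) : ℤ → ℝ)) :
    HasDerivAt (FF a) (GG a v) v := by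
  set n := ⌊v⌋ with hn
  have h1 : (n : ℝ) < v := lt_of_le_of_ne (Int.floor_le v) (fun h => hv ⟨n, h⟩)
  have h2 : v < n + 1 := Int.lt_floor_add_one v
  have : HasDerivAt (fun u : ℝ => a n + (u - n) * (a (n+1) - a n)) (GG a v) v := by
    have := (((hasDerivAt_id v).sub_const (n:ℝ)).mul_const (a (n+1) - a n)).const_add (a n)
    simpa [GG, ← hn] using this
  refine this.congr_of_eventuallyEq ?_
  filter_upwards [Ioo_mem_nhds h1 h2] with u hu
  have : ⌊u⌋ = n := by rw [Int.floor_eq_iff]; exact ⟨hu.1.le, hu.2⟩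
  rw [FF, this]

lemma FF_sub (a : ℤ → ℝ) (σ τ : ℝ) : ∫ v in σ..τ, GG a v = FF a τ - FF a σ :=
  MeasureTheory.integral_eq_of_hasDerivAt_off_countable _ _ (countable_range _)
    (FF_cont a).continuousOn (fun v hv => FF_deriv a v hv.2) (GG_int a σ τ)

lemma TT_chen (a b : ℤ → ℝ) (σ τ ρ : ℝ) :
    TT a b σ ρ = TT a b σ τ + TT a b τ ρ + (FF a τ - FF a σ) * (FF b ρ - FF b τ) := by
  unfold TT
  rw [← intervalIntegral.integral_add_adjacent_intervals (prod_int a b _ σ τ) (prod_int a b _ τ ρ),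
    ← FF_sub b τ ρ, ← intervalIntegral.integral_const_mul, add_assoc,
    ← intervalIntegral.integral_add (prod_int a b _ τ ρ) ((GG_int b τ ρ).const_mul _)]
  congr 1
  apply intervalIntegral.integral_congr
  intro v _
  simp only
  ring

lemma TT_unit (a b : ℤ → ℝ) (n : ℤ) :
    TT a b n (n+1) = (a (n+1) - a n) * (b (n+1) - b n) / 2 := by
  have h : TT a b n (n+1) =
      ∫ v in (n:ℝ)..(n+1), (v - n) * ((a (n+1) - a n) * (b (n+1) - b n)) := by
    unfold TT
    rw [intervalIntegral.integral_of_le (by linarith), intervalIntegral.integral_of_le (by linarith),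
      integral_Ioc_eq_integral_Ioo, integral_Ioc_eq_integral_Ioo]
    refine setIntegral_congr_fun measurableSet_Ioo fun v hv => ?_
    have : ⌊v⌋ = n := by rw [Int.floor_eq_iff]; exact ⟨hv.1.le, hv.2⟩
    rw [FF_int, FF, GG, this]; ring
  rw [h, intervalIntegral.integral_mul_const, intervalIntegral.integral_sub (by simp) (by simp)]
  simp
  ring

lemma FF_lip (a : ℤ → ℝ) (σ τ M : ℝ) (h : σ ≤ τ) (hM : ∀ v ∈ Ioo σ τ, |GG a v| ≤ M) :
    |FF a τ - FF a σ| ≤ M * (τ - σ) := by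
  rw [← FF_sub, intervalIntegral.integral_of_le h, integral_Ioc_eq_integral_Ioo]
  have := norm_setIntegral_le_of_norm_le_const (μ := volume) (s := Ioo σ τ) (f := GG a) (C := M)
    (by simp) hM
  simpa [Measure.real, h] using this

lemma TT_bound (a b : ℤ → ℝ) (σ τ M : ℝ) (h : σ ≤ τ) (hM0 : 0 ≤ M)
    (hM : ∀ v ∈ Ioo σ τ, |GG a v| ≤ M) (hM' : ∀ v ∈ Ioo σ τ, |GG b v| ≤ M) :
    |TT a b σ τ| ≤ M ^ 2 * (τ - σ) ^ 2 := by
  rw [TT, intervalIntegral.integral_of_le h, integral_Ioc_eq_integral_Ioo]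
  have := norm_setIntegral_le_of_norm_le_const (μ := volume) (s := Ioo σ τ)
    (f := fun v => (FF a v - FF a σ) * GG b v) (C := M * (τ - σ) * M)
    (by simp) (by
      intro v hv
      rw [norm_mul]
      refine mul_le_mul ?_ (hM' v hv) (norm_nonneg _) (mul_nonneg hM0 (by linarith))
      refine (FF_lip a σ v M hv.1.le (fun u hu => hM u ⟨hu.1, hu.2.trans hv.2⟩)).trans ?_
      exact mul_le_mul_of_nonneg_left (by linarith [hv.2]) hM0)
  simp only [Measure.real, Real.volume_Ioo, Real.norm_eq_abs] at this
  rw [ENNReal.toReal_ofReal (by linarith)] at this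
  calc _ ≤ _ := this
    _ = _ := by ring

/-- area on one block -/
def areaL (a b : ℤ → ℝ) (l : ℤ) : ℝ := (a (2*l+1) - a (2*l)) * (b (2*l+2) - b (2*l+1))

lemma D_dyadic (a b a' b' : ℤ → ℝ) (ha : ∀ n, a n = a' (2*n)) (hb : ∀ n, b n = b' (2*n))
    (p : ℤ) (j : ℕ) :
    TT a' b' (2*p) (2*(p+j)) - TT a b p (p+j) =
      (∑ i ∈ Finset.range j, areaL a' b' (p+i) - ∑ i ∈ Finset.range j, areaL b' a' (p+i)) / 2 := by
  induction j with
  | zero => simp [TT]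
  | succ j ih =>
    rw [Finset.sum_range_succ, Finset.sum_range_succ]
    set q : ℤ := p + j with hq
    have hqr : (p : ℝ) + (j : ℝ) = (q : ℝ) := by simp [hq]
    have e1 : (p : ℝ) + ((j + 1 : ℕ) : ℝ) = (q : ℝ) + 1 := by rw [← hqr]; push_cast; ring
    rw [e1]
    rw [hqr] at ih
    have t1 := TT_unit a b q
    have t2 := TT_unit a' b' (2*q)
    have t3 := TT_unit a' b' (2*q+1)
    have c1 := TT_chen a b p q (q+1)
    have c2 := TT_chen a' b' (2*p) (2*q) (2*(q+1))
    have c3 := TT_chen a' b' (2*q) (2*q+1) (2*(q+1))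
    have f0 := FF_int a p
    have f1 := FF_int a q
    have f2 := FF_int b q
    have f3 := FF_int b (q+1)
    have g0 := FF_int a' (2*p)
    have g1 := FF_int a' (2*q)
    have g2 := FF_int b' (2*q)
    have g3 := FF_int b' (2*(q+1))
    have g4 := FF_int a' (2*q+1)
    have g5 := FF_int b' (2*q+1)
    push_cast at *
    have e2 : (2:ℝ)*q+1+1 = 2*(q+1) := by ring
    have e3 : (2:ℤ)*q+1+1 = 2*(q+1) := by ring
    have e4 : (2:ℤ)*q+2 = 2*(q+1) := by ring
    rw [e2, e3] at t3
    have ua : areaL a' b' q = (a' (2*q+1) - a' (2*q)) * (b' (2*(q+1)) - b' (2*q+1)) := by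
      rw [areaL, e4]
    have ub : areaL b' a' q = (b' (2*q+1) - b' (2*q)) * (a' (2*(q+1)) - a' (2*q+1)) := by
      rw [areaL, e4]
    rw [f0, f1, f2, f3] at c1
    rw [g0, g1, g2, g3] at c2
    rw [g1, g3, g4, g5] at c3
    simp only [ha, hb] at t1 c1
    rw [c1, c2, c3, ua, ub]
    linear_combination ih - t1 + t2 + t3

def QQ (a : ℤ → ℝ) (N : ℕ) (R : ℝ) : Prop :=
  ∀ p q : ℕ, p ≤ q → q ≤ N → |a q - a p| ≤ R * √((q:ℝ) - p)

lemma QQ_half (a a' : ℤ → ℝ) (ha : ∀ n, a n = a' (2*n)) (N : ℕ) (R : ℝ) (hR : 0 ≤ R)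
    (h : QQ a' (2*N) R) : QQ a N (2*R) := by
  intro p q hpq hq
  have := h (2*p) (2*q) (by omega) (by omega)
  push_cast at this
  rw [ha, ha]
  refine this.trans ?_
  have e : √(2 * (q:ℝ) - 2 * p) ≤ 2 * √((q:ℝ) - p) := by
    have hpq' : (p:ℝ) ≤ q := by exact_mod_cast hpq
    rw [Real.sqrt_le_iff]
    refine ⟨by positivity, ?_⟩
    rw [mul_pow, Real.sq_sqrt (by linarith)]; linarith
  nlinarith

lemma GGb (a : ℤ → ℝ) (N : ℕ) (R σ τ : ℝ) (h : QQ a N R) (hσ : 0 ≤ σ) (hτ : τ ≤ N) :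
    ∀ v ∈ Ioo σ τ, |GG a v| ≤ R := by
  intro v hv
  have h0 : 0 ≤ v := by linarith [hv.1]
  have h1 : v < N := by linarith [hv.2]
  have hn : ((⌊v⌋₊ : ℕ) : ℤ) = ⌊v⌋ := Int.natCast_floor_eq_floor h0
  have h2 : ⌊v⌋₊ < N := (Nat.floor_lt h0).2 h1
  have := h ⌊v⌋₊ (⌊v⌋₊+1) (by omega) (by omega)
  push_cast at this
  rw [hn] at this
  simpa [GG] using this

lemma FFb (a : ℤ → ℝ) (N : ℕ) (R σ τ : ℝ) (h : QQ a N R) (hR : 0 ≤ R) (hσ : 0 ≤ σ) (hστ : σ ≤ τ)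
    (hτ : τ ≤ N) (h1 : τ - σ ≤ 2) : |FF a τ - FF a σ| ≤ R * 2 :=
  (FF_lip a σ τ R hστ (GGb a N R σ τ h hσ hτ)).trans (mul_le_mul_of_nonneg_left h1 hR)

lemma TTb (a b : ℤ → ℝ) (N : ℕ) (R σ τ : ℝ) (h : QQ a N R) (h' : QQ b N R) (hR : 0 ≤ R)
    (hσ : 0 ≤ σ) (hστ : σ ≤ τ) (hτ : τ ≤ N) : |TT a b σ τ| ≤ R ^ 2 * (τ - σ) ^ 2 :=
  TT_bound a b σ τ R hστ hR (GGb a N R σ τ h hσ hτ) (GGb b N R σ τ h' hσ hτ)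

lemma corr (a b : ℤ → ℝ) (N : ℕ) (R σ τ : ℝ) (h : QQ a N R) (h' : QQ b N R) (hR : 0 ≤ R)
    (hσ : 0 ≤ σ) (hτ : τ ≤ N) (p q : ℕ) (hpq : p ≤ q) (hp : σ ≤ p) (hq : (q:ℝ) ≤ τ)
    (hp2 : p - σ ≤ 2) (hq2 : τ - q ≤ 2) (h1 : 1 ≤ τ - σ) :
    |TT a b σ τ - TT a b p q| ≤ 16 * R ^ 2 * √(τ - σ) := by
  have hpq' : (p:ℝ) ≤ q := by exact_mod_cast hpq
  have hqN : q ≤ N := by exact_mod_cast hq.trans hτ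
  have hqN' : (q:ℝ) ≤ N := hq.trans hτ
  have p0 : (0:ℝ) ≤ p := by positivity
  have q0 : (0:ℝ) ≤ q := by positivity
  have c1 := TT_chen a b σ p τ
  have c2 := TT_chen a b p q τ
  have t1 := TTb a b N R σ p h h' hR hσ hp (by linarith)
  have t2 := TTb a b N R q τ h h' hR q0 hq hτ
  have t1' : |TT a b σ p| ≤ R^2 * 4 := t1.trans (by
    apply mul_le_mul_of_nonneg_left _ (sq_nonneg R); nlinarith)
  have t2' : |TT a b q τ| ≤ R^2 * 4 := t2.trans (by
    apply mul_le_mul_of_nonneg_left _ (sq_nonneg R); nlinarith)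
  have f1 := FFb a N R σ p h hR hσ hp (by linarith) hp2
  have f2 := FFb b N R q τ h' hR q0 hq hτ hq2
  have i1 := h p q hpq hqN
  have i2 := h' p q hpq hqN
  have fa : FF a p = a p := FF_int a p
  have fa' : FF a q = a q := FF_int a q
  have fb : FF b p = b p := FF_int b p
  have fb' : FF b q = b q := FF_int b q
  set r := √(τ - σ) with hr
  have r1 : 1 ≤ r := by rw [hr, Real.one_le_sqrt]; exact h1
  have hle : √((q:ℝ) - p) ≤ r := Real.sqrt_le_sqrt (by linarith)
  have i1' : |a q - a p| ≤ R * r := i1.trans (mul_le_mul_of_nonneg_left hle hR)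
  have i2' : |b q - b p| ≤ R * r := i2.trans (mul_le_mul_of_nonneg_left hle hR)
  rw [fa] at f1
  rw [fb'] at f2
  have e : TT a b σ τ - TT a b p q = TT a b σ p + TT a b q τ + (a p - FF a σ) * (b q - b p)
      + (a p - FF a σ) * (FF b τ - b q) + (a q - a p) * (FF b τ - b q) := by
    rw [c1, c2, fa, fa', fb, fb']; ring
  have m1 : |(a p - FF a σ) * (b q - b p)| ≤ (R*2) * (R * r) := by
    rw [abs_mul]; exact mul_le_mul f1 i2' (abs_nonneg _) (by positivity)
  have m2 : |(a p - FF a σ) * (FF b τ - b q)| ≤ (R*2) * (R * 2) := by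
    rw [abs_mul]; exact mul_le_mul f1 f2 (abs_nonneg _) (by positivity)
  have m3 : |(a q - a p) * (FF b τ - b q)| ≤ (R*r) * (R * 2) := by
    rw [abs_mul]; exact mul_le_mul i1' f2 (abs_nonneg _) (by positivity)
  rw [e]
  rw [abs_le] at *
  have : R^2 ≤ R^2 * r := le_mul_of_one_le_right (sq_nonneg R) r1
  constructor <;> linarith

lemma D_bound (a b a' b' : ℤ → ℝ) (ha : ∀ n, a n = a' (2*n)) (hb : ∀ n, b n = b' (2*n))
    (N : ℕ) (R : ℝ) (hR : 0 ≤ R) (h1 : QQ a' (2*N) R) (h1' : QQ b' (2*N) R)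
    (h2 : ∀ p j : ℕ, p + j ≤ N → |∑ i ∈ Finset.range j, areaL a' b' (p+i)| ≤ R^2 * √j)
    (h2' : ∀ p j : ℕ, p + j ≤ N → |∑ i ∈ Finset.range j, areaL b' a' (p+i)| ≤ R^2 * √j)
    (σ τ γ : ℝ) (hσ : 0 ≤ σ) (hστ : σ < τ) (hτ : τ ≤ N) (hγ : 1/2 ≤ γ) (hγ2 : γ ≤ 2) :
    |TT a' b' (2*σ) (2*τ) - TT a b σ τ| ≤ 100 * R^2 * (τ - σ)^γ := by
  have g1 := QQ_half a a' ha N R hR h1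
  have g1' := QQ_half b b' hb N R hR h1'
  have hp : 0 < τ - σ := by linarith
  by_cases hc : τ - σ ≤ 1
  · have t1 := TTb a b N (2*R) σ τ g1 g1' (by linarith) hσ hστ.le hτ
    have t2 := TTb a' b' (2*N) R (2*σ) (2*τ) h1 h1' hR (by linarith) (by linarith)
      (by push_cast; linarith)
    have : (τ - σ)^2 ≤ (τ - σ)^γ := by
      rw [← Real.rpow_two]; exact Real.rpow_le_rpow_of_exponent_ge hp hc hγ2
    have := mul_le_mul_of_nonneg_left this (sq_nonneg R)
    have n1 : 0 ≤ R^2 * (τ-σ)^2 := by positivity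
    rw [abs_le] at *
    constructor <;> linarith
  · push Not at hc
    have hτ0 : 0 ≤ τ := by linarith
    have p1 : σ ≤ ⌈σ⌉₊ := Nat.le_ceil σ
    have p2 : (⌈σ⌉₊:ℝ) < σ + 1 := Nat.ceil_lt_add_one hσ
    have q1 : (⌊τ⌋₊:ℝ) ≤ τ := Nat.floor_le hτ0
    have q2 : τ < ⌊τ⌋₊ + 1 := Nat.lt_floor_add_one τ
    have hpq : ⌈σ⌉₊ ≤ ⌊τ⌋₊ := Nat.le_floor (by linarith)
    obtain ⟨j, hj⟩ := Nat.exists_eq_add_of_le hpq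
    set p := ⌈σ⌉₊ with hpd
    set q := ⌊τ⌋₊ with hqd
    have hqN : q ≤ N := by exact_mod_cast q1.trans hτ
    have k1 := corr a b N (2*R) σ τ g1 g1' (by linarith) hσ hτ p q hpq p1 q1 (by linarith)
      (by linarith) hc.le
    have k2 := corr a' b' (2*N) R (2*σ) (2*τ) h1 h1' hR (by linarith) (by push_cast; linarith)
      (2*p) (2*q) (by omega) (by push_cast; linarith) (by push_cast; linarith)
      (by push_cast; linarith) (by push_cast; linarith) (by linarith)
    have k3 := D_dyadic a b a' b' ha hb p j
    have k4 := h2 p j (by omega)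
    have k5 := h2' p j (by omega)
    have hqr : (q:ℝ) = p + j := by rw [hj]; push_cast; ring
    push_cast at k2 k3
    rw [← hqr] at k3
    have s1 : √j ≤ √(τ - σ) := Real.sqrt_le_sqrt (by linarith)
    have s2 : √(2*τ - 2*σ) ≤ 2 * √(τ - σ) := by
      rw [Real.sqrt_le_iff]
      refine ⟨by positivity, ?_⟩
      rw [mul_pow, Real.sq_sqrt (by linarith)]; linarith
    have s3 : √(τ - σ) ≤ (τ - σ)^γ := by
      rw [Real.sqrt_eq_rpow]; exact Real.rpow_le_rpow_of_exponent_le hc.le hγ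
    have s1' := mul_le_mul_of_nonneg_left s1 (sq_nonneg R)
    have s2' := mul_le_mul_of_nonneg_left s2 (sq_nonneg R)
    have s3' := mul_le_mul_of_nonneg_left s3 (sq_nonneg R)
    have n1 : 0 ≤ R^2 * √(τ-σ) := by positivity
    rw [abs_le] at *
    constructor <;> linarith

end BM16

namespace BM16

/-- coordinate samples -/
noncomputable def smp {d : ℕ} (w : ℝ → EuclideanSpace ℝ (Fin d)) (k : ℕ) (i : Fin d) (n : ℤ) : ℝ :=
  w ((n : ℝ) / 2 ^ k) i

lemma dA_coord {d : ℕ} (w : ℝ → EuclideanSpace ℝ (Fin d)) (k : ℕ) (i : Fin d) (t : ℝ) :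
    dyadicApprox w k t i = FF (smp w k i) (t * 2^k) := by
  simp only [dyadicApprox, FF, smp, PiLp.add_apply, PiLp.smul_apply, PiLp.sub_apply, smul_eq_mul]
  push_cast
  have : (2:ℝ)^k ≠ 0 := by positivity
  field_simp

lemma dA_deriv {d : ℕ} (w : ℝ → EuclideanSpace ℝ (Fin d)) (k : ℕ) (u : ℝ)
    (hv : u * 2^k ∉ Set.range ((↑) : ℤ → ℝ)) (j : Fin d) :
    deriv (fun v => dyadicApprox w k v) u j = 2^k * GG (smp w k j) (u * 2^k) := by
  set n := ⌊u * 2^k⌋ with hn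
  have h1 : (n : ℝ) < u * 2^k := lt_of_le_of_ne (Int.floor_le _) (fun h => hv ⟨n, h⟩)
  have h2 : u * 2^k < n + 1 := Int.lt_floor_add_one _
  have : HasDerivAt (fun u : ℝ => w ((n : ℝ) / 2 ^ k)
      + ((2 : ℝ) ^ k * (u - (n : ℝ) / 2 ^ k)) • (w (((n : ℝ) + 1) / 2 ^ k) - w ((n : ℝ) / 2 ^ k)))
      (((2:ℝ)^k * 1) • (w (((n : ℝ) + 1) / 2 ^ k) - w ((n : ℝ) / 2 ^ k))) u := by
    exact ((((hasDerivAt_id u).sub_const _).const_mul _).smul_const _).const_add _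
  have h3 : HasDerivAt (fun v => dyadicApprox w k v)
      (((2:ℝ)^k * 1) • (w (((n : ℝ) + 1) / 2 ^ k) - w ((n : ℝ) / 2 ^ k))) u := by
    refine this.congr_of_eventuallyEq ?_
    have hc : Continuous (fun v : ℝ => v * 2^k) := by fun_prop
    filter_upwards [hc.continuousAt.preimage_mem_nhds (Ioo_mem_nhds h1 h2)] with v hv
    have : ⌊v * 2^k⌋ = n := by rw [Int.floor_eq_iff]; exact ⟨hv.1.le, hv.2⟩
    rw [dyadicApprox, this]
  rw [h3.deriv]
  simp [GG, smp, ← hn]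

lemma Jint_coord {d : ℕ} (w : ℝ → EuclideanSpace ℝ (Fin d)) (k : ℕ) (i j : Fin d) (s t : ℝ)
    (hst : s ≤ t) :
    Jint (fun v => dyadicApprox w k v) (fun v => dyadicApprox w k v) s t (i, j)
      = TT (smp w k i) (smp w k j) (s * 2^k) (t * 2^k) := by
  have hk : (0:ℝ) < 2^k := by positivity
  have hae : ∀ i j : Fin d, (fun u => tensor (dyadicApprox w k u - dyadicApprox w k s)
        (deriv (fun v => dyadicApprox w k v) u) (i, j)) =ᵐ[volume.restrict (Ioc s t)]
      fun u => 2^k * ((FF (smp w k i) (u * 2^k) - FF (smp w k i) (s * 2^k)) *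
        GG (smp w k j) (u * 2^k)) := by
    intro i j
    apply ae_restrict_of_ae
    have hcount : ((fun u : ℝ => u * 2^k) ⁻¹' (Set.range ((↑) : ℤ → ℝ))).Countable :=
      (countable_range _).preimage (mul_left_injective₀ hk.ne')
    filter_upwards [hcount.ae_notMem volume] with u hu
    have : tensor (dyadicApprox w k u - dyadicApprox w k s)
        (deriv (fun v => dyadicApprox w k v) u) (i, j) =
        (dyadicApprox w k u - dyadicApprox w k s) i * deriv (fun v => dyadicApprox w k v) u j := rfl
    rw [this, dA_deriv w k u hu, PiLp.sub_apply, dA_coord, dA_coord]; ring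
  have hint : ∀ i j : Fin d, IntegrableOn (fun u => (2:ℝ)^k *
        ((FF (smp w k i) (u * 2^k) - FF (smp w k i) (s * 2^k)) *
        GG (smp w k j) (u * 2^k))) (Ioc s t) volume := by
    intro i j
    have h := prod_int (smp w k i) (smp w k j) (FF (smp w k i) (s * 2^k)) (s * 2^k) (t * 2^k)
    have h2 := (h.comp_mul_right (c := 2^k)).const_mul ((2:ℝ)^k)
    rw [mul_div_cancel_right₀ _ hk.ne', mul_div_cancel_right₀ _ hk.ne',
      intervalIntegrable_iff_integrableOn_Ioc_of_le hst] at h2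
    exact h2
  rw [Jint, intervalIntegral.integral_of_le hst, eval_integral_piLp, integral_congr_ae (hae i j),
    ← intervalIntegral.integral_of_le hst, intervalIntegral.integral_const_mul, TT]
  · have := intervalIntegral.integral_comp_mul_right (a := s) (b := t)
      (fun v => (FF (smp w k i) v - FF (smp w k i) (s * 2^k)) * GG (smp w k j) v) hk.ne'
    rw [this, smul_eq_mul, mul_inv_cancel_left₀ hk.ne']
  · rintro ⟨i, j⟩
    exact (integrable_congr (hae i j)).2 (hint i j)

lemma smp_half {d : ℕ} (w : ℝ → EuclideanSpace ℝ (Fin d)) (k : ℕ) (i : Fin d) (n : ℤ) :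
    smp w k i n = smp w (k+1) i (2*n) := by
  have h : (n:ℝ) / 2^k = ((2*n : ℤ) : ℝ) / 2^(k+1) := by
    push_cast
    rw [pow_succ]; field_simp
  rw [smp, smp, h]

/-- good event at level `k` with parameter `R` -/
def Good {d : ℕ} (w : ℝ → EuclideanSpace ℝ (Fin d)) (k : ℕ) (R : ℝ) : Prop :=
  (∀ i, QQ (smp w (k+1) i) (2*2^k) R) ∧
  ∀ i j, ∀ p n : ℕ, p + n ≤ 2^k →
    |∑ l ∈ Finset.range n, areaL (smp w (k+1) i) (smp w (k+1) j) (p+l)| ≤ R^2 * √n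

lemma euc_bound {ι : Type*} [Fintype ι] (x : EuclideanSpace ℝ ι) (c : ℝ) (h : ∀ i, |x i| ≤ c) :
    ‖x‖ ≤ Fintype.card ι * c := by
  classical
  have h1 : ‖x‖ ≤ ∑ i, |x i| := by
    rw [EuclideanSpace.norm_eq, Real.sqrt_le_iff]
    refine ⟨Finset.sum_nonneg fun i _ => abs_nonneg _, ?_⟩
    exact Finset.sum_sq_le_sq_sum_of_nonneg fun i _ => abs_nonneg _
  refine h1.trans ((Finset.sum_le_sum fun i _ => h i).trans ?_)
  simp

lemma step_bound {d : ℕ} (w : ℝ → EuclideanSpace ℝ (Fin d)) (k : ℕ) (R : ℝ) (hR : 0 ≤ R)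
    (hg : Good w k R) (s t γ : ℝ) (hs : 0 ≤ s) (hst : s < t) (ht : t ≤ 1)
    (hγ : 1/2 ≤ γ) (hγ2 : γ ≤ 2) :
    ‖Jint (fun v => dyadicApprox w (k+1) v) (fun v => dyadicApprox w (k+1) v) s t
      - Jint (fun v => dyadicApprox w k v) (fun v => dyadicApprox w k v) s t‖
      ≤ (d * d) * (100 * R^2 * (2^k : ℝ)^γ) * (t - s)^γ := by
  have hk : (0:ℝ) < 2^k := by positivity
  have := euc_bound (Jint (fun v => dyadicApprox w (k+1) v) (fun v => dyadicApprox w (k+1) v) s t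
      - Jint (fun v => dyadicApprox w k v) (fun v => dyadicApprox w k v) s t)
      (100 * R^2 * (t * 2^k - s * 2^k)^γ) (by
    rintro ⟨i, j⟩
    rw [PiLp.sub_apply, Jint_coord _ _ _ _ _ _ hst.le, Jint_coord _ _ _ _ _ _ hst.le]
    have := D_bound (smp w k i) (smp w k j) (smp w (k+1) i) (smp w (k+1) j)
      (smp_half w k i) (smp_half w k j) (2^k) R hR (hg.1 i) (hg.1 j) (hg.2 i j) (hg.2 j i)
      (s * 2^k) (t * 2^k) γ (by positivity) (by gcongr) (by push_cast; nlinarith) hγ hγ2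
    convert this using 4 <;> ring)
  refine this.trans (le_of_eq ?_)
  rw [← sub_mul, Real.mul_rpow (by linarith) hk.le]
  simp
  ring

end BM16

namespace BM16

lemma tri_int (e : ℝ) (he : -1 < e) :
    ∫⁻ q in {q : ℝ × ℝ | 0 ≤ q.1 ∧ q.1 < q.2 ∧ q.2 ≤ 1}, ENNReal.ofReal ((q.2 - q.1) ^ e) < ∞ := by
  have h1 : IntervalIntegrable (fun x : ℝ => x ^ e) volume 0 1 :=
    intervalIntegral.intervalIntegrable_rpow' he
  rw [intervalIntegrable_iff_integrableOn_Ioc_of_le zero_le_one] at h1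
  have h2 : ∫⁻ x in Ioc (0:ℝ) 1, ENNReal.ofReal (x^e) < ∞ := by
    exact (h1.lintegral_lt_top)
  have hm : MeasurableSet {q : ℝ × ℝ | 0 ≤ q.1 ∧ q.1 < q.2 ∧ q.2 ≤ 1} := by
    refine (measurableSet_le measurable_const measurable_fst).inter
      ((measurableSet_lt measurable_fst measurable_snd).inter
        (measurableSet_le measurable_snd measurable_const))
  have hmf : Measurable (fun x : ℝ => (Ioc (0:ℝ) 1).indicator (fun x => ENNReal.ofReal (x^e)) x) :=
    Measurable.indicator (by fun_prop) measurableSet_Ioc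
  have hle : ∫⁻ q in {q : ℝ × ℝ | 0 ≤ q.1 ∧ q.1 < q.2 ∧ q.2 ≤ 1}, ENNReal.ofReal ((q.2 - q.1) ^ e)
      ≤ ∫⁻ q : ℝ × ℝ, (Icc (0:ℝ) 1).indicator 1 q.1 *
        (Ioc (0:ℝ) 1).indicator (fun x => ENNReal.ofReal (x^e)) (q.2 - q.1) := by
    rw [← lintegral_indicator hm]
    apply lintegral_mono
    intro q
    by_cases hq : q ∈ {q : ℝ × ℝ | 0 ≤ q.1 ∧ q.1 < q.2 ∧ q.2 ≤ 1}
    · rw [indicator_of_mem hq]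
      obtain ⟨a, b, c⟩ := hq
      have m1 : q.1 ∈ Icc (0:ℝ) 1 := ⟨a, by linarith⟩
      have m2 : q.2 - q.1 ∈ Ioc (0:ℝ) 1 := ⟨by linarith, by linarith⟩
      simp only []
      rw [indicator_of_mem m1, indicator_of_mem m2]
      simp
    · rw [indicator_of_notMem hq]; exact zero_le
  refine hle.trans_lt ?_
  have hm1 : Measurable (fun x : ℝ => (Icc (0:ℝ) 1).indicator (1 : ℝ → ℝ≥0∞) x) :=
    Measurable.indicator measurable_one measurableSet_Icc
  have hmm : Measurable (fun q : ℝ × ℝ => (Icc (0:ℝ) 1).indicator (1 : ℝ → ℝ≥0∞) q.1 *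
        (Ioc (0:ℝ) 1).indicator (fun x => ENNReal.ofReal (x^e)) (q.2 - q.1)) :=
    (hm1.comp measurable_fst).mul (hmf.comp (measurable_snd.sub measurable_fst))
  rw [Measure.volume_eq_prod, lintegral_prod _ hmm.aemeasurable]
  have : ∀ x : ℝ, ∫⁻ y : ℝ, (Icc (0:ℝ) 1).indicator (1 : ℝ → ℝ≥0∞) x *
        (Ioc (0:ℝ) 1).indicator (fun x => ENNReal.ofReal (x^e)) (y - x)
        = (Icc (0:ℝ) 1).indicator (1 : ℝ → ℝ≥0∞) x *
          ∫⁻ x in Ioc (0:ℝ) 1, ENNReal.ofReal (x^e) := by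
    intro x
    have hmx : Measurable (fun y : ℝ => (Ioc (0:ℝ) 1).indicator
        (fun x => ENNReal.ofReal (x^e)) (y - x)) := hmf.comp (measurable_id.sub measurable_const)
    rw [lintegral_const_mul _ hmx,
      lintegral_sub_right_eq_self (fun y => (Ioc (0:ℝ) 1).indicator
        (fun x => ENNReal.ofReal (x^e)) y) x, lintegral_indicator measurableSet_Ioc]
  simp only [this]
  rw [lintegral_mul_const _ hm1, lintegral_indicator measurableSet_Icc]
  simpa using h2

lemma besov_le {F : Type*} [NormedAddCommGroup F] (α γ : ℝ) (m : ℕ) (hm : 1 ≤ m)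
    (Y : ℝ → ℝ → F) (c : ℝ) (hc : 0 ≤ c)
    (hY : ∀ s t : ℝ, 0 ≤ s → s < t → t ≤ 1 → ‖Y s t‖ ≤ c * (t - s)^γ) :
    besov2NormE α (m:ℝ) Y ≤ ENNReal.ofReal c *
      (∫⁻ q in {q : ℝ × ℝ | 0 ≤ q.1 ∧ q.1 < q.2 ∧ q.2 ≤ 1},
        ENNReal.ofReal ((q.2 - q.1) ^ (γ * (2 * m) - (1 + 4 * m * α)))) ^ (1 / (2 * (m:ℝ))) := by
  have hm0 : (0:ℝ) < 2 * m := by have : (1:ℝ) ≤ m := by exact_mod_cast hm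
                                 linarith
  have hms : MeasurableSet {q : ℝ × ℝ | 0 ≤ q.1 ∧ q.1 < q.2 ∧ q.2 ≤ 1} := by
    refine (measurableSet_le measurable_const measurable_fst).inter
      ((measurableSet_lt measurable_fst measurable_snd).inter
        (measurableSet_le measurable_snd measurable_const))
  have e : ENNReal.ofReal c = (ENNReal.ofReal (c ^ (2 * (m:ℝ)))) ^ (1 / (2 * (m:ℝ))) := by
    rw [ENNReal.ofReal_rpow_of_nonneg (by positivity) (by positivity), ← Real.rpow_mul hc,
      mul_one_div_cancel hm0.ne', Real.rpow_one]
  rw [e, ← ENNReal.mul_rpow_of_nonneg _ _ (by positivity), besov2NormE]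
  apply ENNReal.rpow_le_rpow _ (by positivity)
  rw [← lintegral_const_mul _ (by fun_prop)]
  apply setLIntegral_mono' hms
  rintro ⟨s, t⟩ ⟨h0, h1, h2⟩
  simp only at h0 h1 h2 ⊢
  have hp : 0 < t - s := by linarith
  rw [← ENNReal.ofReal_mul (by positivity)]
  apply ENNReal.ofReal_le_ofReal
  rw [Real.rpow_sub hp, ← mul_div_assoc]
  apply div_le_div_of_nonneg_right _ (by positivity)
  rw [Real.rpow_mul hp.le, ← Real.mul_rpow hc (by positivity)]
  exact Real.rpow_le_rpow (norm_nonneg _) (hY s t h0 h1 h2) (by positivity)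

lemma determ {d : ℕ} (w : ℝ → EuclideanSpace ℝ (Fin d)) (R : ℕ → ℝ) (hR : ∀ k, 0 ≤ R k)
    (hg : ∀ᶠ k in atTop, Good w k (R k)) (γ : ℝ) (hγ : 1/2 ≤ γ) (hγ2 : γ ≤ 2)
    (hsum : Summable fun k => R k ^ 2 * (2^k : ℝ)^γ)
    (m : ℕ) (hm : 1 ≤ m) (α : ℝ) (he : -1 < γ * (2 * m) - (1 + 4 * m * α)) :
    ∀ ε : ℝ, 0 < ε → ∃ N : ℕ, ∀ k ≥ N, ∀ l ≥ N,
        besov2NormE α (m : ℝ)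
            (fun s t =>
              Jint (fun v => dyadicApprox w k v) (fun v => dyadicApprox w k v) s t
                - Jint (fun v => dyadicApprox w l v) (fun v => dyadicApprox w l v) s t)
          < ENNReal.ofReal ε := by
  intro ε hε
  have hI := tri_int _ he
  have hm0 : (0:ℝ) < 2 * m := by have : (1:ℝ) ≤ m := by exact_mod_cast hm
                                 linarith
  have hI' : (∫⁻ q in {q : ℝ × ℝ | 0 ≤ q.1 ∧ q.1 < q.2 ∧ q.2 ≤ 1},
        ENNReal.ofReal ((q.2 - q.1) ^ (γ * (2 * m) - (1 + 4 * m * α)))) ^ (1 / (2 * (m:ℝ))) ≠ ∞ :=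
    ENNReal.rpow_ne_top_of_nonneg (by positivity) hI.ne
  set I := (∫⁻ q in {q : ℝ × ℝ | 0 ≤ q.1 ∧ q.1 < q.2 ∧ q.2 ≤ 1},
        ENNReal.ofReal ((q.2 - q.1) ^ (γ * (2 * m) - (1 + 4 * m * α)))) ^ (1 / (2 * (m:ℝ))) with hId
  obtain ⟨N0, hN0⟩ := eventually_atTop.1 hg
  set c : ℕ → ℝ := fun k => (d * d) * (100 * R k ^2 * (2^k : ℝ)^γ) with hc
  have hcs : Summable c := by
    have := hsum.mul_left ((d * d : ℝ) * 100)
    refine this.congr fun k => ?_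
    simp only [hc]; ring
  set η := ε / (I.toReal + 1) with hη
  have hI0 : 0 ≤ I.toReal := ENNReal.toReal_nonneg
  have hη0 : 0 < η := by positivity
  obtain ⟨N1, hN1⟩ := Metric.cauchySeq_iff.1 hcs.hasSum.tendsto_sum_nat.cauchySeq η hη0
  -- ordered version
  have key : ∀ k ≥ max N0 N1, ∀ l ≥ k, ∀ s t : ℝ, 0 ≤ s → s < t → t ≤ 1 →
      ‖Jint (fun v => dyadicApprox w l v) (fun v => dyadicApprox w l v) s t
        - Jint (fun v => dyadicApprox w k v) (fun v => dyadicApprox w k v) s t‖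
        ≤ (∑ i ∈ Finset.range l, c i - ∑ i ∈ Finset.range k, c i) * (t - s)^γ := by
    intro k hk l hl s t h0 h1 h2
    induction l, hl using Nat.le_induction with
    | base => simp
    | succ l hl ih =>
      have := step_bound w l (R l) (hR l) (hN0 l (by omega)) s t γ h0 h1 h2 hγ hγ2
      rw [Finset.sum_range_succ]
      refine (norm_sub_le_norm_sub_add_norm_sub _
        (Jint (fun v => dyadicApprox w l v) (fun v => dyadicApprox w l v) s t) _).trans ?_
      have e : (∑ i ∈ Finset.range l, c i + c l - ∑ i ∈ Finset.range k, c i) * (t - s)^γ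
        = c l * (t-s)^γ + (∑ i ∈ Finset.range l, c i - ∑ i ∈ Finset.range k, c i) * (t - s)^γ := by
        ring
      rw [e]
      exact add_le_add this ih
  refine ⟨max N0 N1, fun k hk l hl => ?_⟩
  have hb : ∀ s t : ℝ, 0 ≤ s → s < t → t ≤ 1 →
      ‖Jint (fun v => dyadicApprox w k v) (fun v => dyadicApprox w k v) s t
        - Jint (fun v => dyadicApprox w l v) (fun v => dyadicApprox w l v) s t‖ ≤ η * (t-s)^γ := by
    intro s t h0 h1 h2
    have hp : 0 ≤ (t - s)^γ := Real.rpow_nonneg (by linarith) _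
    have hd := hN1 k (by omega) l (by omega)
    rw [Real.dist_eq, abs_lt] at hd
    rcases le_total k l with h | h
    · rw [norm_sub_rev]
      exact (key k hk l h s t h0 h1 h2).trans
        (mul_le_mul_of_nonneg_right (by linarith [hd.1]) hp)
    · exact (key l hl k h s t h0 h1 h2).trans
        (mul_le_mul_of_nonneg_right (by linarith [hd.2]) hp)
  refine (besov_le α γ m hm _ η hη0.le hb).trans_lt ?_
  rw [← hId, ← ENNReal.ofReal_toReal hI', ← ENNReal.ofReal_mul hη0.le]
  rw [ENNReal.ofReal_lt_ofReal_iff hε, hη, div_mul_eq_mul_div, div_lt_iff₀ (by positivity)]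
  nlinarith

end BM16

namespace BM16

lemma gauss_exp (v : ℝ≥0) (θ : ℝ) :
    ∫⁻ x, ENNReal.ofReal (Real.exp (θ * x)) ∂(gaussianReal 0 v)
      = ENNReal.ofReal (Real.exp (v * θ^2 / 2)) := by
  rw [← ofReal_integral_eq_lintegral_ofReal (integrable_exp_mul_gaussianReal θ)
    (ae_of_all _ fun x => (Real.exp_pos _).le)]
  have := mgf_gaussianReal (p := gaussianReal 0 v) (X := id) (μ := 0) (v := v) (by simp) θ
  simp only [mgf, id] at this
  rw [this]; simp

lemma gauss_sq (v : ℝ≥0) (hv : v ≠ 0) (c : ℝ) (hc : 4 * c * v ≤ 1) (hc0 : 0 ≤ c) :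
    ∫⁻ x, ENNReal.ofReal (Real.exp (c * x^2)) ∂(gaussianReal 0 v)
      ≤ ENNReal.ofReal (Real.exp (2 * c * v)) := by
  have hv' : (0:ℝ) < v := by positivity
  rw [gaussianReal_of_var_ne_zero 0 hv, lintegral_withDensity_eq_lintegral_mul _
    (measurable_gaussianPDF 0 v) (by fun_prop)]
  set b : ℝ := 1 / (2 * v) - c with hb
  have hbv : 1 - 2 * c * v = 2 * v * b := by rw [hb]; field_simp
  have hb0 : 0 < b := by
    by_contra h
    push Not at h
    have : 2 * (v:ℝ) * b ≤ 0 := mul_nonpos_of_nonneg_of_nonpos (by positivity) h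
    linarith
  have e : ∀ x : ℝ, ((gaussianPDF 0 v) * fun x => ENNReal.ofReal (Real.exp (c * x^2))) x
      = ENNReal.ofReal ((√(2 * Real.pi * v))⁻¹ * Real.exp (-b * x^2)) := by
    intro x
    rw [Pi.mul_apply, gaussianPDF, ← ENNReal.ofReal_mul (gaussianPDFReal_nonneg _ _ _),
      gaussianPDFReal, mul_assoc, ← Real.exp_add]
    congr 3
    rw [hb]
    field_simp
    ring
  simp_rw [e]
  rw [← ofReal_integral_eq_lintegral_ofReal ((integrable_exp_neg_mul_sq hb0).const_mul _)
    (ae_of_all _ fun x => by positivity), integral_const_mul, integral_gaussian]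
  apply ENNReal.ofReal_le_ofReal
  have hpi := Real.pi_pos
  rw [inv_mul_eq_div, ← Real.sqrt_div (by positivity), Real.sqrt_le_iff]
  refine ⟨(Real.exp_pos _).le, ?_⟩
  have e2 : Real.pi / b / (2 * Real.pi * v) = 1 / (1 - 2 * c * v) := by
    rw [hbv]; field_simp
  rw [e2, ← Real.exp_nat_mul, div_le_iff₀ (by linarith)]
  have := Real.add_one_le_exp ((2:ℕ) * (2 * c * v))
  push_cast at *
  have hx : 0 ≤ 2 * c * v := by positivity
  nlinarith

variable {Ω : Type*} [MeasurableSpace Ω] {P : Measure Ω}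

lemma prod_exp (ξ η : Ω → ℝ) (hξ : Measurable ξ) (hη : Measurable η) (hi : IndepFun ξ η P)
    [IsProbabilityMeasure P] (v : ℝ≥0) (hv : v ≠ 0)
    (h1 : P.map ξ = gaussianReal 0 v) (h2 : P.map η = gaussianReal 0 v)
    (θ : ℝ) (hθ : θ^2 * v^2 ≤ 1/2) :
    ∫⁻ ω, ENNReal.ofReal (Real.exp (θ * (ξ ω * η ω))) ∂P ≤ ENNReal.ofReal (Real.exp (θ^2 * v^2)) := by
  have hp := (indepFun_iff_map_prod_eq_prod_map_map hξ.aemeasurable hη.aemeasurable).1 hi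
  have hm : Measurable (fun z : ℝ × ℝ => ENNReal.ofReal (Real.exp (θ * (z.1 * z.2)))) := by fun_prop
  have := lintegral_map (μ := P) hm (hξ.prodMk hη)
  rw [← this, hp, h1, h2, lintegral_prod _ hm.aemeasurable]
  have e : ∀ x : ℝ, ∫⁻ y, ENNReal.ofReal (Real.exp (θ * (x * y))) ∂(gaussianReal 0 v)
      = ENNReal.ofReal (Real.exp ((v * θ^2/2) * x^2)) := by
    intro x
    have := gauss_exp v (θ * x)
    simp_rw [mul_assoc] at this
    rw [this]
    congr 2; ring
  simp only [e]
  refine (gauss_sq v hv _ (by nlinarith) (by positivity)).trans (le_of_eq ?_)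
  congr 2; ring

lemma chernoff (Z : Ω → ℝ) (hZ : Measurable Z) (C : ℝ≥0∞)
    (h1 : ∫⁻ ω, ENNReal.ofReal (Real.exp (Z ω)) ∂P ≤ C)
    (h2 : ∫⁻ ω, ENNReal.ofReal (Real.exp (-Z ω)) ∂P ≤ C) (lam : ℝ) :
    P {ω | lam < |Z ω|} ≤ 2 * C * ENNReal.ofReal (Real.exp (-lam)) := by
  have aux : ∀ Z : Ω → ℝ, Measurable Z → ∫⁻ ω, ENNReal.ofReal (Real.exp (Z ω)) ∂P ≤ C →
      P {ω | lam < Z ω} ≤ C * ENNReal.ofReal (Real.exp (-lam)) := by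
    intro Z hZ h
    have hm := mul_meas_ge_le_lintegral (μ := P)
      (f := fun ω => ENNReal.ofReal (Real.exp (Z ω))) (by fun_prop) (ENNReal.ofReal (Real.exp lam))
    have hs : P {ω | lam < Z ω} ≤
        P {ω | ENNReal.ofReal (Real.exp lam) ≤ ENNReal.ofReal (Real.exp (Z ω))} := by
      apply measure_mono
      intro ω hω
      exact ENNReal.ofReal_le_ofReal (Real.exp_le_exp.2 (le_of_lt hω))
    rw [Real.exp_neg, ENNReal.ofReal_inv_of_pos (Real.exp_pos _), ← div_eq_mul_inv]
    rw [ENNReal.le_div_iff_mul_le (by simp [Real.exp_pos]) (by simp), mul_comm]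
    exact (mul_le_mul_right hs _).trans (hm.trans h)
  have a1 := aux Z hZ h1
  have a2 := aux (fun ω => - Z ω) hZ.neg h2
  have : {ω | lam < |Z ω|} ⊆ {ω | lam < Z ω} ∪ {ω | lam < - Z ω} := by
    intro ω hω
    have hω' : lam < |Z ω| := hω
    exact lt_abs.1 hω'
  refine (measure_mono this).trans ((measure_union_le _ _).trans ((add_le_add a1 a2).trans ?_))
  rw [mul_assoc, two_mul]

lemma chain {d : ℕ} (Y : ℕ → Ω → EuclideanSpace ℝ (Fin d)) (hY : ∀ n, Measurable (Y n)) (n : ℕ)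
    [IsProbabilityMeasure P]
    (hind : iIndepFun (fun (i : Fin (2*n)) => Y i) P) (v : ℝ≥0) (hv : v ≠ 0)
    (hl : ∀ r < 2*n, ∀ i, P.map (fun ω => Y r ω i) = gaussianReal 0 v)
    (θ : ℝ) (hθ : θ^2 * v^2 ≤ 1/2) (i j : Fin d) (r : ℕ) (hr : r ≤ n) :
    ∫⁻ ω, ∏ l ∈ Finset.range r, ENNReal.ofReal (Real.exp (θ * (Y (2*l) ω i * Y (2*l+1) ω j))) ∂P
      ≤ (ENNReal.ofReal (Real.exp (θ^2 * v^2)))^r := by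
  have hc : ∀ i : Fin d, Measurable (fun x : EuclideanSpace ℝ (Fin d) => x i) := by
    intro i; fun_prop
  induction r with
  | zero => simp
  | succ r ih =>
    have ih := ih (by omega)
    simp_rw [Finset.prod_range_succ]
    set S : Finset (Fin (2*n)) := Finset.univ.filter (fun i => i.val < 2*r) with hS
    set T : Finset (Fin (2*n)) := Finset.univ.filter (fun i => 2*r ≤ i.val) with hT
    have hST : Disjoint S T := by
      rw [Finset.disjoint_left]
      intro a ha hb
      simp only [hS, hT, Finset.mem_filter] at ha hb
      omega
    have hI := hind.indepFun_finset S T hST (fun i => hY i)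
    have mS : ∀ m (hm : m < 2*r), (⟨m, by omega⟩ : Fin (2*n)) ∈ S := by
      intro m hm; simp [hS, hm]
    have mT : ∀ m (hm : 2*r ≤ m) (hm' : m < 2*n), (⟨m, hm'⟩ : Fin (2*n)) ∈ T := by
      intro m hm hm'; simp [hT, hm]
    let φ : (S → EuclideanSpace ℝ (Fin d)) → ℝ≥0∞ := fun x =>
      ∏ l : Fin r, ENNReal.ofReal (Real.exp (θ *
        ((x ⟨⟨2*l.1, by omega⟩, mS _ (by omega)⟩) i * (x ⟨⟨2*l.1+1, by omega⟩, mS _ (by omega)⟩) j)))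
    let ψ : (T → EuclideanSpace ℝ (Fin d)) → ℝ≥0∞ := fun x =>
      ENNReal.ofReal (Real.exp (θ *
        ((x ⟨⟨2*r, by omega⟩, mT _ (by omega) _⟩) i
          * (x ⟨⟨2*r+1, by omega⟩, mT _ (by omega) _⟩) j)))
    have hφ : Measurable φ := by
      refine Finset.measurable_prod _ fun l _ => ?_
      fun_prop
    have hψ : Measurable ψ := by
      unfold ψ
      fun_prop
    have hI2 := hI.comp hφ hψ
    have m1 : ∀ r, Measurable (fun ω => ENNReal.ofReal (Real.exp (θ * (Y (2*r) ω i * Y (2*r+1) ω j))))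
      := fun r => ENNReal.measurable_ofReal.comp (Real.measurable_exp.comp (measurable_const.mul
        (((hc i).comp (hY _)).mul ((hc j).comp (hY _)))))
    have e1 : (φ ∘ fun a (i : S) => Y i a) = fun ω => ∏ l ∈ Finset.range r,
        ENNReal.ofReal (Real.exp (θ * (Y (2*l) ω i * Y (2*l+1) ω j))) := by
      funext ω
      rw [Finset.prod_range]
      rfl
    have e2 : (ψ ∘ fun a (i : T) => Y i a) = fun ω =>
        ENNReal.ofReal (Real.exp (θ * (Y (2*r) ω i * Y (2*r+1) ω j))) := rfl
    have hI3 : IndepFun (fun ω => ∏ l ∈ Finset.range r,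
        ENNReal.ofReal (Real.exp (θ * (Y (2*l) ω i * Y (2*l+1) ω j))))
        (fun ω => ENNReal.ofReal (Real.exp (θ * (Y (2*r) ω i * Y (2*r+1) ω j)))) P := by
      rw [← e1, ← e2]; exact hI2
    rw [lintegral_mul_eq_lintegral_mul_lintegral_of_indepFun''
      (Finset.measurable_prod _ fun l _ => m1 l).aemeasurable (m1 r).aemeasurable hI3, pow_succ]
    refine mul_le_mul' ih ?_
    have hne : (⟨2*r, by omega⟩ : Fin (2*n)) ≠ ⟨2*r+1, by omega⟩ := by
      intro h; simp at h
    have hp := hind.indepFun hne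
    exact prod_exp (fun ω => Y (2*r) ω i) (fun ω => Y (2*r+1) ω j) ((hc i).comp (hY _))
      ((hc j).comp (hY _)) (hp.comp (hc i) (hc j)) v hv (hl _ (by omega) i) (hl _ (by omega) j) θ hθ

end BM16

namespace BM16

variable {Ω : Type*} [MeasurableSpace Ω] {P : Measure Ω}

/-- the common tail constant -/
noncomputable def tailC (lam : ℝ) : ℝ≥0∞ :=
  2 * ENNReal.ofReal (Real.exp (1/2)) * ENNReal.ofReal (Real.exp (-lam))

lemma coordm {d : ℕ} (i : Fin d) : Measurable (fun x : EuclideanSpace ℝ (Fin d) => x i) := by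
  fun_prop

lemma tail1 {d : ℕ} {w : ℝ → Ω → EuclideanSpace ℝ (Fin d)} (hw : IsBrownianMotion P d w)
    (k : ℕ) (lam : ℝ) (i : Fin d) (p q : ℕ) (hpq : p ≤ q) (hq : q ≤ 2^(k+1)) :
    P {ω | ¬ |smp (fun u => w u ω) (k+1) i q - smp (fun u => w u ω) (k+1) i p|
      ≤ (lam / √(2^(k+1))) * √((q:ℝ) - p)} ≤ tailC lam := by
  obtain ⟨hP, hmeas, -, -, -, hg⟩ := hw
  rcases hpq.eq_or_lt with h | h
  · subst h; simp
  have hK : (0:ℝ) < 2^(k+1) := by positivity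
  have hlt : (p:ℝ) < q := by exact_mod_cast h
  set K : ℝ := 2^(k+1) with hKd
  have hqK : (q:ℝ) ≤ K := by rw [hKd]; exact_mod_cast hq
  have hgi := (hg (p/K) (q/K) (by positivity) (by gcongr)
    ((div_le_one hK).2 hqK)).2 i
  set v : ℝ := q / K - p / K with hv
  have hvv : v = ((q:ℝ) - p) / K := by rw [hv]; ring
  have hv0 : 0 < v := by rw [hvv]; exact div_pos (by linarith) hK
  set X : Ω → ℝ := fun ω => (w (q/K) ω - w (p/K) ω) i with hX
  have hXm : Measurable X := (coordm i).comp ((hmeas _).sub (hmeas _))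
  have hs : 0 < √v := Real.sqrt_pos.2 hv0
  have hexp : ∀ θ : ℝ, θ^2 = 1 / v →
      ∫⁻ ω, ENNReal.ofReal (Real.exp (θ * X ω)) ∂P ≤ ENNReal.ofReal (Real.exp (1/2)) := by
    intro θ hθ
    have hm : Measurable (fun x : ℝ => ENNReal.ofReal (Real.exp (θ * x))) := by fun_prop
    rw [← lintegral_map (μ := P) hm hXm, hgi, gauss_exp, hθ, Real.coe_toNNReal _ hv0.le]
    apply le_of_eq
    congr 2
    field_simp
  have h1 := hexp (1/√v) (by rw [div_pow, Real.sq_sqrt hv0.le]; simp)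
  have h2 := hexp (-(1/√v)) (by rw [neg_sq, div_pow, Real.sq_sqrt hv0.le]; simp)
  have hc := chernoff (P := P) (fun ω => 1/√v * X ω) (hXm.const_mul _) _ h1
    (by simpa only [neg_mul] using h2) lam
  refine le_trans (measure_mono ?_) hc
  intro ω hω
  simp only [mem_ofPred_eq, not_le, smp] at hω ⊢
  push_cast at hω
  have : lam / √K * √((q:ℝ) - p) = lam * √v := by
    rw [hvv, Real.sqrt_div (by linarith)]; ring
  rw [← hKd, this] at hω
  rw [abs_mul, abs_of_pos (by positivity), one_div, inv_mul_eq_div, lt_div_iff₀ hs]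
  exact hω

lemma tail2 {d : ℕ} {w : ℝ → Ω → EuclideanSpace ℝ (Fin d)} (hw : IsBrownianMotion P d w)
    (k : ℕ) (lam : ℝ) (hlam : 2 ≤ lam) (i j : Fin d) (p n : ℕ) (hpn : p + n ≤ 2^k) :
    P {ω | ¬ |∑ l ∈ Finset.range n, areaL (smp (fun u => w u ω) (k+1) i)
        (smp (fun u => w u ω) (k+1) j) (p+l)| ≤ (lam / √(2^(k+1)))^2 * √n} ≤ tailC lam := by
  obtain ⟨hP, hmeas, -, -, hind, hg⟩ := hw
  rcases Nat.eq_zero_or_pos n with h | hn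
  · subst h; simp
  have hK : (0:ℝ) < 2^(k+1) := by positivity
  set K : ℝ := 2^(k+1) with hKd
  have hpnK : 2 * ((p:ℝ) + n) ≤ K := by
    rw [hKd, pow_succ]
    have : ((p:ℝ) + n) ≤ 2^k := by exact_mod_cast hpn
    linarith
  set tt : ℕ → ℝ := fun m => (2 * p + m) / K with htt
  have htm : Monotone tt := by
    intro a b hab
    have : (a:ℝ) ≤ b := by exact_mod_cast hab
    simp only [htt]; gcongr
  have ht1 : ∀ m ≤ 2*n, tt m ∈ Icc (0:ℝ) 1 := by
    intro m hm
    have : (m:ℝ) ≤ 2 * n := by exact_mod_cast hm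
    refine ⟨by positivity, ?_⟩
    simp only [htt]
    rw [div_le_one hK]; linarith
  set Y : ℕ → Ω → EuclideanSpace ℝ (Fin d) := fun m ω => w (tt (m+1)) ω - w (tt m) ω with hYd
  have hYm : ∀ m, Measurable (Y m) := fun m => (hmeas _).sub (hmeas _)
  have hYi : iIndepFun (fun (i : Fin (2*n)) => Y i) P := by
    have := hind (2*n) (fun i => tt i) (fun a b hab => htm hab) (fun i => ht1 _ (by omega))
    exact this
  set v : ℝ≥0 := Real.toNNReal (1/K) with hv
  have hvK : (v:ℝ) = 1/K := Real.coe_toNNReal _ (by positivity)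
  have hv0 : v ≠ 0 := by
    rw [hv]; exact (Real.toNNReal_pos.2 (by positivity)).ne'
  have hl : ∀ r < 2*n, ∀ i, P.map (fun ω => Y r ω i) = gaussianReal 0 v := by
    intro r hr i
    have := (hg (tt r) (tt (r+1)) (ht1 r (by omega)).1 (htm (by omega)) (ht1 (r+1) (by omega)).2).2 i
    rw [this]
    congr 2
    simp only [htt]; push_cast; ring
  have hnr : (1:ℝ) ≤ n := by exact_mod_cast hn
  have hs : 0 < √(2*(n:ℝ)) := Real.sqrt_pos.2 (by linarith)
  have hexp : ∀ θ : ℝ, θ^2 = K^2 / (2*n) →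
      ∫⁻ ω, ENNReal.ofReal (Real.exp (θ * ∑ l ∈ Finset.range n, Y (2*l) ω i * Y (2*l+1) ω j)) ∂P
        ≤ ENNReal.ofReal (Real.exp (1/2)) := by
    intro θ hθ
    have e1 : θ^2 * (v:ℝ)^2 = 1 / (2*n) := by
      rw [hθ, hvK]; field_simp
    have := chain Y hYm n hYi v hv0 hl θ (by
      rw [e1]; rw [div_le_div_iff₀ (by positivity) (by norm_num)]; linarith) i j n le_rfl
    rw [e1, ← ENNReal.ofReal_pow (Real.exp_pos _).le, ← Real.exp_nat_mul] at this
    have e2 : (n:ℝ) * (1 / (2*n)) = 1/2 := by field_simp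
    rw [e2] at this
    refine le_trans (le_of_eq ?_) this
    apply lintegral_congr
    intro ω
    rw [← ENNReal.ofReal_prod_of_nonneg (fun _ _ => (Real.exp_pos _).le), ← Real.exp_sum,
      Finset.mul_sum]
  have hsq : (K / √(2*(n:ℝ)))^2 = K^2 / (2*n) := by
    rw [div_pow, Real.sq_sqrt (by linarith)]
  have h1 := hexp (K / √(2*(n:ℝ))) hsq
  have h2 := hexp (-(K / √(2*(n:ℝ)))) (by rw [neg_sq, hsq])
  have hSm : Measurable (fun ω => ∑ l ∈ Finset.range n, Y (2*l) ω i * Y (2*l+1) ω j) :=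
    Finset.measurable_sum _ fun l _ =>
      ((coordm i).comp (hYm _)).mul ((coordm j).comp (hYm _))
  have hc := chernoff (P := P) (fun ω => K / √(2*(n:ℝ)) *
    ∑ l ∈ Finset.range n, Y (2*l) ω i * Y (2*l+1) ω j) (hSm.const_mul _) _ h1
    (by simpa only [neg_mul] using h2) lam
  refine le_trans (measure_mono ?_) hc
  intro ω hω
  have e3 : ∑ l ∈ Finset.range n, areaL (smp (fun u => w u ω) (k+1) i)
        (smp (fun u => w u ω) (k+1) j) (p+l) =
      ∑ l ∈ Finset.range n, Y (2*l) ω i * Y (2*l+1) ω j := by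
    apply Finset.sum_congr rfl
    intro l _
    simp only [areaL, smp, hYd, htt, PiLp.sub_apply]
    push_cast
    rw [← hKd]
    have a1 : (2 * ((p:ℝ) + l) + 1) / K = (2 * p + (2 * l + 1)) / K := by ring
    have a2 : (2 * ((p:ℝ) + l)) / K = (2 * p + 2 * l) / K := by ring
    have a3 : (2 * ((p:ℝ) + l) + 2) / K = (2 * p + (2 * l + 1 + 1)) / K := by ring
    rw [a1, a2, a3]
  simp only [mem_ofPred_eq, not_le] at hω ⊢
  rw [e3] at hω
  rw [abs_mul, abs_of_pos (by positivity), div_mul_eq_mul_div, lt_div_iff₀ hs]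
  rw [div_pow, Real.sq_sqrt hK.le] at hω
  have h2n : √(2*(n:ℝ)) ≤ 2 * √n := by
    rw [Real.sqrt_le_iff]
    refine ⟨by positivity, ?_⟩
    rw [mul_pow, Real.sq_sqrt (by linarith)]; linarith
  have h4 : lam^2 * √n < K * |∑ l ∈ Finset.range n, Y (2*l) ω i * Y (2*l+1) ω j| := by
    have := mul_lt_mul_of_pos_left hω hK
    refine lt_of_le_of_lt (le_of_eq ?_) this
    field_simp
  refine lt_of_le_of_lt ?_ h4
  calc lam * √(2*(n:ℝ)) ≤ lam * (2 * √n) := by gcongr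
    _ = (2 * lam) * √n := by ring
    _ ≤ lam^2 * √n := by
      apply mul_le_mul_of_nonneg_right _ (Real.sqrt_nonneg _); nlinarith

lemma bad_bound {d : ℕ} {w : ℝ → Ω → EuclideanSpace ℝ (Fin d)} (hw : IsBrownianMotion P d w)
    (k : ℕ) (lam : ℝ) (hlam : 2 ≤ lam) :
    P {ω | ¬ Good (fun u => w u ω) k (lam / √(2^(k+1)))}
      ≤ ((d + d * d) * (2^(k+1) + 1)^2 : ℕ) * tailC lam := by
  set N := 2^(k+1) + 1 with hN
  let I1 := Fin d × Fin N × Fin N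
  let I2 := (Fin d × Fin d) × Fin N × Fin N
  let s1 : I1 → Set Ω := fun x => {ω | x.2.1.1 ≤ x.2.2.1 ∧
    ¬ |smp (fun u => w u ω) (k+1) x.1 x.2.2.1 - smp (fun u => w u ω) (k+1) x.1 x.2.1.1|
      ≤ (lam / √(2^(k+1))) * √((x.2.2.1:ℝ) - x.2.1.1)}
  let s2 : I2 → Set Ω := fun x => {ω | x.2.1.1 + x.2.2.1 ≤ 2^k ∧
    ¬ |∑ l ∈ Finset.range x.2.2.1, areaL (smp (fun u => w u ω) (k+1) x.1.1)
        (smp (fun u => w u ω) (k+1) x.1.2) (x.2.1.1+l)| ≤ (lam / √(2^(k+1)))^2 * √x.2.2.1}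
  have b1 : ∀ x, P (s1 x) ≤ tailC lam := by
    rintro ⟨i, p, q⟩
    by_cases h : p.1 ≤ q.1
    · exact (measure_mono (fun ω hω => hω.2)).trans (tail1 hw k lam i p q h (by omega))
    · have : s1 (i, p, q) = ∅ := by
        ext ω; simp only [s1, mem_ofPred_eq, mem_empty_iff_false, iff_false]; tauto
      rw [this]; simp
  have b2 : ∀ x, P (s2 x) ≤ tailC lam := by
    rintro ⟨⟨i, j⟩, p, n⟩
    by_cases h : p.1 + n.1 ≤ 2^k
    · exact (measure_mono (fun ω hω => hω.2)).trans (tail2 hw k lam hlam i j p n h)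
    · have : s2 ((i, j), p, n) = ∅ := by
        ext ω; simp only [s2, mem_ofPred_eq, mem_empty_iff_false, iff_false]; tauto
      rw [this]; simp
  have hsub : {ω | ¬ Good (fun u => w u ω) k (lam / √(2^(k+1)))} ⊆ (⋃ x, s1 x) ∪ (⋃ x, s2 x) := by
    intro ω hω
    by_contra hcon
    apply hω
    simp only [mem_union, mem_iUnion, not_or, not_exists] at hcon
    constructor
    · intro i p q hpq hq
      by_contra hh
      rw [← pow_succ'] at hq
      exact hcon.1 (i, ⟨p, by omega⟩, ⟨q, by omega⟩) ⟨hpq, hh⟩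
    · intro i j p n hpn
      by_contra hh
      have : 2^k ≤ 2^(k+1) := Nat.pow_le_pow_right (by norm_num) (by omega)
      exact hcon.2 ((i, j), ⟨p, by omega⟩, ⟨n, by omega⟩) ⟨hpn, hh⟩
  refine (measure_mono hsub).trans ((measure_union_le _ _).trans ?_)
  have c1 : P (⋃ x, s1 x) ≤ (d * (N * N) : ℕ) * tailC lam := by
    refine (measure_iUnion_fintype_le P s1).trans ((Finset.sum_le_sum fun x _ => b1 x).trans ?_)
    simp [I1]
  have c2 : P (⋃ x, s2 x) ≤ (d * d * (N * N) : ℕ) * tailC lam := by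
    refine (measure_iUnion_fintype_le P s2).trans ((Finset.sum_le_sum fun x _ => b2 x).trans ?_)
    simp [I2]
  refine (add_le_add c1 c2).trans (le_of_eq ?_)
  rw [← add_mul]
  congr 1
  norm_cast
  ring

lemma ae_good {d : ℕ} {w : ℝ → Ω → EuclideanSpace ℝ (Fin d)} (hw : IsBrownianMotion P d w) :
    ∀ᵐ ω ∂P, ∀ᶠ k : ℕ in atTop, Good (fun u => w u ω) k (4 * (k+1) / √(2^(k+1))) := by
  have hs : Summable (fun k : ℕ => ((d + d * d) * 16 * 2 * Real.exp (1/2) * Real.exp (-4)) *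
      (4 * Real.exp (-4))^k) := by
    apply Summable.mul_left
    apply summable_geometric_of_lt_one (by positivity)
    rw [Real.exp_neg, ← div_eq_mul_inv, div_lt_one (Real.exp_pos _)]
    linarith [Real.add_one_le_exp (4:ℝ)]
  have hle : ∀ k : ℕ, P {ω | ¬ Good (fun u => w u ω) k (4 * (k+1) / √(2^(k+1)))} ≤
      ENNReal.ofReal (((d + d * d) * 16 * 2 * Real.exp (1/2) * Real.exp (-4)) *
      (4 * Real.exp (-4))^k) := by
    intro k
    have hk : (0:ℝ) ≤ k := by positivity
    refine (bad_bound hw k (4 * (k+1)) (by linarith)).trans ?_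
    have e : tailC (4 * (k+1)) =
        ENNReal.ofReal (2 * Real.exp (1/2) * (Real.exp (-4) * Real.exp (-4)^k)) := by
      rw [tailC, ENNReal.ofReal_mul (by positivity), ENNReal.ofReal_mul (by norm_num),
        ← Real.exp_nat_mul, ← Real.exp_add]
      congr 3
      · simp
      · ring
    rw [e, ← ENNReal.ofReal_natCast, ← ENNReal.ofReal_mul (by positivity)]
    apply ENNReal.ofReal_le_ofReal
    push_cast
    have h4 : ((2:ℝ)^(k+1) + 1)^2 ≤ 16 * 4^k := by
      have h1 : (1:ℝ) ≤ 2^k := one_le_pow₀ (by norm_num)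
      have h2 : (4:ℝ)^k = 2^k * 2^k := by rw [← mul_pow]; norm_num
      rw [h2, pow_succ (2:ℝ) k]
      nlinarith
    rw [mul_pow]
    calc _ ≤ ((d:ℝ) + d * d) * (16 * 4^k) *
          (2 * Real.exp (1/2) * (Real.exp (-4) * Real.exp (-4)^k)) := by gcongr
      _ = _ := by ring
  have hfin : ∑' k : ℕ, P {ω | ¬ Good (fun u => w u ω) k (4 * (k+1) / √(2^(k+1)))} ≠ ∞ := by
    refine ne_top_of_le_ne_top ?_ (ENNReal.tsum_le_tsum hle)
    exact hs.tsum_ofReal_ne_top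
  filter_upwards [ae_eventually_notMem hfin] with ω hω
  filter_upwards [hω] with k hk
  simpa using hk

lemma sumR (γ : ℝ) (hγ : γ < 1) :
    Summable fun k : ℕ => (4 * ((k:ℝ)+1) / √(2^(k+1)))^2 * (2^k : ℝ)^γ := by
  set r : ℝ := 2^(γ-1) with hr
  have hr0 : 0 < r := by positivity
  have hr1 : r < 1 := Real.rpow_lt_one_of_one_lt_of_neg (by norm_num) (by linarith)
  have e : ∀ k : ℕ, (4 * ((k:ℝ)+1) / √(2^(k+1)))^2 * (2^k : ℝ)^γ
      = (8 / r) * (((k+1 : ℕ):ℝ)^2 * r^(k+1)) := by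
    intro k
    have h1 : (2^k : ℝ)^γ = r^k * 2^k := by
      rw [hr, ← Real.rpow_natCast 2 k, ← Real.rpow_mul (by norm_num),
        ← Real.rpow_mul_natCast (by norm_num), ← Real.rpow_add (by norm_num)]
      congr 1; ring
    rw [div_pow, Real.sq_sqrt (by positivity), h1, pow_succ, pow_succ]
    push_cast
    field_simp
    ring
  have hs : Summable fun k : ℕ => (k:ℝ)^2 * r^k :=
    summable_pow_mul_geometric_of_norm_lt_one 2 (by rwa [Real.norm_of_nonneg hr0.le])
  have := ((summable_nat_add_iff 1).2 hs).mul_left (8 / r)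
  exact this.congr fun k => (e k).symm

end BM16

/-- almost surely, the second-level iterated integrals
`W(k)²_{s,t} = J[w(k), w(k)]_{s,t}` of the dyadic polygonal approximations of a
`d`-dimensional Brownian motion form a Cauchy sequence in the
`(2α, 2m)`-Besov norm. -/
theorem statement16 {Ω : Type*} [MeasurableSpace Ω] (P : Measure Ω) (d : ℕ)
    (w : ℝ → Ω → EuclideanSpace ℝ (Fin d))
    (hw : IsBrownianMotion P d w)
    (m : ℕ) (hm : 1 ≤ m) (α : ℝ) (hα₁ : 1 / 3 < α) (hα₂ : α < 1 / 2)
    (hαm : 1 / 3 < α - 1 / (4 * (m : ℝ)))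
    (hcond : 0 < 4 * (m : ℝ) - 8 * m * α - 1) :
    ∀ᵐ ω ∂P,
      ∀ ε : ℝ, 0 < ε → ∃ N : ℕ, ∀ k ≥ N, ∀ l ≥ N,
        besov2NormE α (m : ℝ)
            (fun s t =>
              Jint (fun v => dyadicApprox (fun u => w u ω) k v)
                  (fun v => dyadicApprox (fun u => w u ω) k v) s t
                - Jint (fun v => dyadicApprox (fun u => w u ω) l v)
                    (fun v => dyadicApprox (fun u => w u ω) l v) s t)
          < ENNReal.ofReal ε := by
  have hm0 : (1:ℝ) ≤ m := by exact_mod_cast hm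
  filter_upwards [BM16.ae_good hw] with ω hω
  have hpos : 0 < (m:ℝ) * (1 / 2 - α) := mul_pos (by linarith) (by linarith)
  exact BM16.determ (fun u => w u ω) (fun k => 4 * ((k:ℝ)+1) / √(2^(k+1)))
    (fun k => by positivity) hω (α + 1/2) (by linarith) (by linarith)
    (BM16.sumR (α + 1/2) (by linarith)) m hm α (by nlinarith)
end
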